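/- Let α > 0 be fixed. For each even positive integer N and each positive integer m, let E_N(m) denote the expected number of real eigenvalues (real roots of the characteristic polynomial, counted with multiplicity) of the product P = X_1⋯X_m of m independent N×N random matrices with i.i.d. real Gaussian entries of mean 0 and variance 1/N. Then for any sequence of positive integers (m_N) indexed by even N with m_N/N → α as N → ∞, one has E_N(m_N)/N → c(α), where c(α) := ∫₀¹ erf(√(α/(8t))) dt. -/

import Mathlib

open MeasureTheory ProbabilityTheory Filter

/-- The error function `erf x = (2/√π) ∫_0^x e^{-s²} ds`. -/
noncomputable def erf (x : ℝ) : ℝ :=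
  (2 / Real.sqrt Real.pi) * ∫ s in (0:ℝ)..x, Real.exp (-s ^ 2)

/-- `c(α) = ∫_0^1 erf(√(α/(8t))) dt`. -/
noncomputable def cFun (α : ℝ) : ℝ :=
  ∫ t in (0:ℝ)..1, erf (Real.sqrt (α / (8 * t)))

/-- The joint law of `m` independent `N × N` matrices with i.i.d. real Gaussian
entries of mean `0` and variance `1/N`. -/
noncomputable def ensembleMeasure (N m : ℕ) :
    Measure (Fin m → Fin N → Fin N → ℝ) :=
  Measure.pi fun _ =>
    Measure.pi fun _ => Measure.pi fun _ => gaussianReal 0 (1 / N)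

/-- The product matrix `P = X_1 ⋯ X_m`. -/
noncomputable def prodMatrix (N m : ℕ) (ω : Fin m → Fin N → Fin N → ℝ) :
    Matrix (Fin N) (Fin N) ℝ :=
  (List.ofFn fun i => Matrix.of (ω i)).prod

/-- The number of real eigenvalues of a matrix, i.e. the number of real roots of
its characteristic polynomial counted with multiplicity. -/
noncomputable def numRealEigs (N : ℕ) (P : Matrix (Fin N) (Fin N) ℝ) : ℕ :=
  (Matrix.charpoly P).roots.card

/-- The expected number of real eigenvalues of the product of `m` independent
`N × N` Gaussian matrices. -/
noncomputable def EN (N m : ℕ) : ℝ :=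
  ∫ ω, (numRealEigs N (prodMatrix N m ω) : ℝ) ∂(ensembleMeasure N m)

/-- The variance of the number of real eigenvalues. -/
noncomputable def VN (N m : ℕ) : ℝ :=
  variance (fun ω => (numRealEigs N (prodMatrix N m ω) : ℝ)) (ensembleMeasure N m)

section Area

variable {W E : Type*} [NormedAddCommGroup W] [NormedSpace ℝ W] [FiniteDimensional ℝ W]
  [NormedAddCommGroup E] [NormedSpace ℝ E] [FiniteDimensional ℝ E]

/-- The Jacobian determinant of `β (w, ·)` at `y`, where `p = (w, y)`. -/
noncomputable def partialJac (β : W × E → E) (p : W × E) : ℝ :=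
  ((fderiv ℝ β p).comp (ContinuousLinearMap.inr ℝ W E)).det

/-- The sum of `g (w, y)` over the regular solutions `y` of `β (w, y) = b`, where `p = (w, b)`. -/
noncomputable def regularSum (β : W × E → E) (g : W × E → ENNReal) (p : W × E) : ENNReal :=
  ∑' y : {y : E // β (p.1, y) = p.2 ∧ partialJac β (p.1, y) ≠ 0}, g (p.1, y)

lemma continuous_partialJac {β : W × E → E} (hβ : ContDiff ℝ 1 β) : Continuous (partialJac β) := by
  have h1 : Continuous (fderiv ℝ β) := hβ.continuous_fderiv one_ne_zero
  unfold partialJac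
  exact ContinuousLinearMap.continuous_det.comp (h1.clm_comp continuous_const)

lemma exists_injOn_nhds {β : W × E → E} (hβ : ContDiff ℝ 1 β) {p : W × E}
    (hp : partialJac β p ≠ 0) :
    ∃ U ∈ nhds p, Set.InjOn (fun q : W × E => (q.1, β q)) U := by
  let L : W × E →L[ℝ] W × E := (ContinuousLinearMap.fst ℝ W E).prod (fderiv ℝ β p)
  have hL : HasStrictFDerivAt (fun q : W × E => (q.1, β q)) L p :=
    (ContinuousLinearMap.fst ℝ W E).hasStrictFDerivAt.prodMk
      (hβ.contDiffAt.hasStrictFDerivAt one_ne_zero)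
  have hker : Function.Injective (L : W × E →ₗ[ℝ] W × E) := by
    rw [← LinearMap.ker_eq_bot, LinearMap.ker_eq_bot']
    rintro ⟨w, y⟩ h
    have h1 : w = 0 := by simpa [L] using congrArg Prod.fst h
    subst h1
    have h2 : ((fderiv ℝ β p).comp (ContinuousLinearMap.inr ℝ W E)) y = 0 := by
      simpa [L] using congrArg Prod.snd h
    have h3 : Function.Injective
        (((fderiv ℝ β p).comp (ContinuousLinearMap.inr ℝ W E) : E →L[ℝ] E) : E →ₗ[ℝ] E) := by
      have hu := LinearMap.isUnit_iff_ker_eq_bot (((fderiv ℝ β p).comp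
        (ContinuousLinearMap.inr ℝ W E) : E →L[ℝ] E) : E →ₗ[ℝ] E)
      rw [← LinearMap.ker_eq_bot, ← hu]
      exact (LinearMap.isUnit_iff_isUnit_det _).2 (isUnit_iff_ne_zero.2 hp)
    have h4 : y = 0 := h3 (by rw [map_zero]; exact h2)
    simp [h4]
  let e : (W × E) ≃L[ℝ] (W × E) :=
    (LinearEquiv.ofInjectiveEndo (L : W × E →ₗ[ℝ] W × E) hker).toContinuousLinearEquiv
  have he : HasStrictFDerivAt (fun q : W × E => (q.1, β q)) (e : W × E →L[ℝ] W × E) p := by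
    convert hL using 1
    ext x <;> simp [e]
  refine ⟨(he.toOpenPartialHomeomorph _).source,
    (he.toOpenPartialHomeomorph _).open_source.mem_nhds he.mem_toOpenPartialHomeomorph_source, ?_⟩
  have := (he.toOpenPartialHomeomorph _).injOn
  simpa using this

variable [MeasurableSpace W] [BorelSpace W] [MeasurableSpace E] [BorelSpace E]

lemma exists_measurable_partition {β : W × E → E} (hβ : ContDiff ℝ 1 β) :
    ∃ D : ℕ → Set (W × E), (∀ i, MeasurableSet (D i)) ∧ Pairwise (Function.onFun Disjoint D) ∧
      (⋃ i, D i) = {p | partialJac β p ≠ 0} ∧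
      ∀ i, Set.InjOn (fun q : W × E => (q.1, β q)) (D i) := by
  classical
  have : ∀ p : W × E, ∃ U : Set (W × E), IsOpen U ∧ (partialJac β p ≠ 0 → p ∈ U) ∧
      Set.InjOn (fun q : W × E => (q.1, β q)) U := by
    intro p
    by_cases hp : partialJac β p ≠ 0
    · obtain ⟨U, hU, hi⟩ := exists_injOn_nhds hβ hp
      obtain ⟨V, hV, hVo, hpV⟩ := mem_nhds_iff.1 hU
      exact ⟨V, hVo, fun _ => hpV, hi.mono hV⟩
    · exact ⟨∅, isOpen_empty, fun h => absurd h hp, by simp⟩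
  choose U hUo hUp hUi using this
  obtain ⟨t, ht, htc, hcov⟩ := TopologicalSpace.countable_cover_nhdsWithin
    (f := U) (s := {p | partialJac β p ≠ 0})
    (fun p hp => mem_nhdsWithin_of_mem_nhds ((hUo p).mem_nhds (hUp p hp)))
  have hR : MeasurableSet {p | partialJac β p ≠ 0} :=
    (isOpen_ne_fun (continuous_partialJac hβ) continuous_const).measurableSet
  rcases t.eq_empty_or_nonempty with rfl | hne
  · refine ⟨fun _ => ∅, by simp, fun i j _ => by simp [Function.onFun], ?_, by simp⟩
    have h0 := Set.subset_empty_iff.1 (by simpa only [Set.biUnion_empty] using hcov)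
    rw [h0, Set.iUnion_empty]
  obtain ⟨u, hu⟩ := htc.exists_eq_range hne
  refine ⟨fun i => disjointed (fun k => U (u k)) i ∩ {p | partialJac β p ≠ 0}, ?_, ?_, ?_, ?_⟩
  · intro i
    exact (MeasurableSet.disjointed (fun k => (hUo (u k)).measurableSet) i).inter hR
  · intro i j hij
    exact (disjoint_disjointed (fun k => U (u k)) hij).mono Set.inter_subset_left
      Set.inter_subset_left
  · rw [← Set.iUnion_inter, iUnion_disjointed, Set.inter_eq_right]
    refine hcov.trans ?_
    simp [hu]
  · intro i
    exact (hUi (u i)).mono (Set.inter_subset_left.trans (disjointed_le (fun k => U (u k)) i))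

/-- Area formula for a family of maps `β (w, ·)` depending on a parameter. -/
theorem regularSum_measurable_and_lintegral {β : W × E → E} (hβ : ContDiff ℝ 1 β)
    {g : W × E → ENNReal} (hg : Measurable g) (μ : Measure E) [μ.IsAddHaarMeasure] :
    Measurable (regularSum β g) ∧ ∀ w, ∫⁻ b, regularSum β g (w, b) ∂μ =
      ∫⁻ y, ENNReal.ofReal |partialJac β (w, y)| * g (w, y) ∂μ := by
  classical
  obtain ⟨D, hDm, hDd, hDu, hDi⟩ := exists_measurable_partition hβ
  let Φ : W × E → W × E := fun q => (q.1, β q)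
  have hΦ : Continuous Φ := continuous_fst.prodMk hβ.continuous
  let S : ℕ → W × E → ENNReal := fun i =>
    Function.extend ((D i).domRestrict Φ) (fun q => g q) 0
  have hemb : ∀ i, MeasurableEmbedding ((D i).domRestrict Φ) := fun i =>
    ContinuousOn.measurableEmbedding (hDm i) hΦ.continuousOn (hDi i)
  have hS : ∀ i, Measurable (S i) := fun i =>
    (hemb i).measurable_extend (hg.comp measurable_subtype_coe) measurable_zero
  have hSin : ∀ i, ∀ q ∈ D i, S i (Φ q) = g q := by
    intro i q hq
    exact (hemb i).injective.extend_apply (fun q : D i => g q) 0 ⟨q, hq⟩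
  have hSout : ∀ i p, p ∉ Φ '' D i → S i p = 0 := by
    intro i p hp
    refine Function.extend_apply' _ _ _ ?_
    rintro ⟨a, ha⟩
    exact hp ⟨a, a.2, ha⟩
  have hsum : ∀ p, regularSum β g p = ∑' i, S i p := by
    rintro ⟨w, b⟩
    have h1 : ∀ i, S i (w, b) =
        ∑' y : {y : E // β (w, y) = b ∧ partialJac β (w, y) ≠ 0},
          (D i).indicator g (w, y) := by
      intro i
      by_cases hp : (w, b) ∈ Φ '' D i
      · obtain ⟨⟨w', y⟩, hq, he⟩ := hp
        have hw : w' = w := congrArg Prod.fst he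
        subst hw
        have hb : β (w', y) = b := congrArg Prod.snd he
        have hreg : partialJac β (w', y) ≠ 0 := by
          have : (w', y) ∈ ⋃ i, D i := Set.mem_iUnion.2 ⟨i, hq⟩
          rw [hDu] at this
          exact this
        rw [← he, hSin i _ hq, tsum_eq_single ⟨y, hb, hreg⟩]
        · simp [hq]
        · rintro ⟨y', hy', _⟩ hne
          refine Set.indicator_of_notMem (fun hmem => hne ?_) _
          have := hDi i hmem hq (by simp [hy', hb])
          simpa using this
      · rw [hSout i _ hp]
        symm
        simp only [ENNReal.tsum_eq_zero]
        rintro ⟨y, hy, _⟩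
        refine Set.indicator_of_notMem (fun hmem => hp ⟨_, hmem, ?_⟩) _
        simp [Φ, hy]
    simp_rw [h1]
    rw [ENNReal.tsum_comm]
    refine tsum_congr ?_
    rintro ⟨y, hy, hreg⟩
    have : (w, y) ∈ ⋃ i, D i := by rw [hDu]; exact hreg
    obtain ⟨i, hi⟩ := Set.mem_iUnion.1 this
    rw [tsum_eq_single i]
    · simp [hi]
    · intro j hj
      refine Set.indicator_of_notMem (fun hmem => ?_) _
      exact (Set.disjoint_left.1 (hDd hj)) hmem hi
  have hfun : regularSum β g = fun p => ∑' i, S i p := funext hsum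
  refine ⟨hfun ▸ Measurable.tsum hS, fun w => ?_⟩
  simp_rw [hsum]
  rw [lintegral_tsum (f := fun i b => S i (w, b))
    (fun i => ((hS i).comp measurable_prodMk_left).aemeasurable)]
  have hpiece : ∀ i, ∫⁻ b, S i (w, b) ∂μ =
      ∫⁻ y, (D i).indicator (fun p => ENNReal.ofReal |partialJac β p| * g p) (w, y) ∂μ := by
    intro i
    let s : Set E := {y | (w, y) ∈ D i}
    have hs : MeasurableSet s := measurable_prodMk_left (hDm i)
    have hinj : Set.InjOn (fun y => β (w, y)) s := by
      intro y hy y' hy' h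
      have := hDi i hy hy' (by simpa using h)
      simpa using this
    have hder : ∀ y ∈ s, HasFDerivWithinAt (fun y => β (w, y))
        ((fderiv ℝ β (w, y)).comp (ContinuousLinearMap.inr ℝ W E)) s y := by
      intro y _
      have h1 : HasFDerivAt β (fderiv ℝ β (w, y)) (w, y) :=
        (hβ.differentiable one_ne_zero _).hasFDerivAt
      exact (h1.comp y (hasFDerivAt_prodMk_right w y)).hasFDerivWithinAt
    have h2 := lintegral_image_eq_lintegral_abs_det_fderiv_mul μ hs hder hinj
      (fun b => S i (w, b))
    have h3 : ∫⁻ b, S i (w, b) ∂μ = ∫⁻ b in (fun y => β (w, y)) '' s, S i (w, b) ∂μ := by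
      symm
      refine setLIntegral_eq_of_support_subset ?_
      intro b hb
      by_contra hcon
      refine hb (hSout i _ ?_)
      rintro ⟨⟨w', y⟩, hq, he⟩
      have hw : w' = w := congrArg Prod.fst he
      subst hw
      exact hcon ⟨y, hq, congrArg Prod.snd he⟩
    rw [h3, h2, ← lintegral_indicator hs]
    refine lintegral_congr fun y => ?_
    by_cases hy : (w, y) ∈ D i
    · have hy' : y ∈ s := hy
      rw [Set.indicator_of_mem hy', Set.indicator_of_mem hy]
      rw [show S i (w, β (w, y)) = g (w, y) from hSin i _ hy]
      rfl
    · have hy' : y ∉ s := hy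
      rw [Set.indicator_of_notMem hy', Set.indicator_of_notMem hy]
  simp_rw [hpiece]
  rw [← lintegral_tsum]
  · refine lintegral_congr fun y => ?_
    by_cases hreg : partialJac β (w, y) = 0
    · rw [hreg]
      simp only [abs_zero, ENNReal.ofReal_zero, zero_mul, ENNReal.tsum_eq_zero]
      intro i
      by_cases hi : (w, y) ∈ D i
      · rw [Set.indicator_of_mem hi, hreg]; simp
      · rw [Set.indicator_of_notMem hi]
    · have : (w, y) ∈ ⋃ i, D i := by rw [hDu]; exact hreg
      obtain ⟨i, hi⟩ := Set.mem_iUnion.1 this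
      rw [tsum_eq_single i]
      · rw [Set.indicator_of_mem hi]
      · intro j hj
        exact Set.indicator_of_notMem (fun hmem => (Set.disjoint_left.1 (hDd hj)) hmem hi) _
  · intro i
    refine Measurable.aemeasurable ?_
    refine Measurable.comp (Measurable.indicator ?_ (hDm i)) measurable_prodMk_left
    exact ((continuous_partialJac hβ).measurable.abs.ennreal_ofReal).mul hg

end Area

section MatrixMeasure

set_option linter.unusedSectionVars false

instance Matrix.instMeasurableSpaceReal {ι κ : Type*} : MeasurableSpace (Matrix ι κ ℝ) :=
  inferInstanceAs (MeasurableSpace (ι → κ → ℝ))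

instance Matrix.instBorelSpaceReal {ι κ : Type*} [Countable ι] [Countable κ] :
    BorelSpace (Matrix ι κ ℝ) :=
  inferInstanceAs (BorelSpace (ι → κ → ℝ))

instance Matrix.instSecondCountableReal {ι κ : Type*} [Countable ι] [Countable κ] :
    SecondCountableTopology (Matrix ι κ ℝ) :=
  inferInstanceAs (SecondCountableTopology (ι → κ → ℝ))

variable {ι κ ι' : Type*} [Fintype ι] [Fintype κ] [Fintype ι']

instance Matrix.instMeasurableMul₂Real [DecidableEq ι] : MeasurableMul₂ (Matrix ι ι ℝ) :=
  ⟨by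
    have : Continuous fun p : Matrix ι ι ℝ × Matrix ι ι ℝ => p.1 * p.2 :=
      continuous_fst.matrix_mul continuous_snd
    exact this.measurable⟩

/-- `Matrix.of` as a measurable equivalence. -/
def matOf (ι κ : Type*) : (ι → κ → ℝ) ≃ᵐ Matrix ι κ ℝ where
  toEquiv := Matrix.of
  measurable_toFun := fun _ hs => hs
  measurable_invFun := fun _ hs => hs

@[simp] lemma matOf_apply (f : ι → κ → ℝ) : matOf ι κ f = Matrix.of f := rfl

@[simp] lemma matOf_symm_apply (Z : Matrix ι κ ℝ) : (matOf ι κ).symm Z = fun i j => Z i j := rfl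

/-- The law of a random matrix with independent entries distributed according to `μ`. -/
noncomputable def matMeasure (μ : Measure ℝ) (ι κ : Type*) [Fintype ι] [Fintype κ] :
    Measure (Matrix ι κ ℝ) :=
  (Measure.pi fun _ : ι => Measure.pi fun _ : κ => μ).map (matOf ι κ)

variable (μ : Measure ℝ)

instance [SigmaFinite μ] : SigmaFinite (matMeasure μ ι κ) :=
  (matOf ι κ).sigmaFinite_map

instance [IsProbabilityMeasure μ] : IsProbabilityMeasure (matMeasure μ ι κ) :=
  Measure.isProbabilityMeasure_map (matOf ι κ).measurable.aemeasurable

lemma measurable_matrix_iff {α : Type*} [MeasurableSpace α] {f : α → Matrix ι κ ℝ} :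
    Measurable f ↔ ∀ i j, Measurable fun a => f a i j := by
  have h : Measurable f ↔ Measurable fun a => (matOf ι κ).symm (f a) :=
    ⟨fun h => (matOf ι κ).symm.measurable.comp h, fun h => (matOf ι κ).measurable.comp h⟩
  refine h.trans (measurable_pi_iff.trans (forall_congr' fun i => ?_))
  exact measurable_pi_iff

lemma measurable_matrix_apply (i : ι) (j : κ) : Measurable fun Z : Matrix ι κ ℝ => Z i j :=
  measurable_matrix_iff.1 measurable_id i j

/-- Matrices as functions on pairs of indices. -/
def matUncurry (ι κ : Type*) [Fintype ι] [Fintype κ] : Matrix ι κ ℝ ≃ᵐ (ι × κ → ℝ) where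
  toFun Z p := Z p.1 p.2
  invFun f := Matrix.of fun i j => f (i, j)
  left_inv _ := rfl
  right_inv _ := rfl
  measurable_toFun := measurable_pi_lambda _ fun p => measurable_matrix_apply p.1 p.2
  measurable_invFun := measurable_matrix_iff.2 fun i j => measurable_pi_apply (i, j)

@[simp] lemma matUncurry_apply (Z : Matrix ι κ ℝ) (p : ι × κ) :
    matUncurry ι κ Z p = Z p.1 p.2 := rfl

lemma matMeasure_apply_box [SigmaFinite μ] (s : ι → κ → Set ℝ) :
    matMeasure μ ι κ {Z | ∀ i j, Z i j ∈ s i j} = ∏ i, ∏ j, μ (s i j) := by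
  have : (matOf ι κ) ⁻¹' {Z : Matrix ι κ ℝ | ∀ i j, Z i j ∈ s i j} =
      Set.univ.pi fun i => Set.univ.pi fun j => s i j := by
    ext Z
    simp [Set.mem_pi]
  rw [matMeasure, (matOf ι κ).map_apply, this, Measure.pi_pi]
  simp_rw [Measure.pi_pi]

lemma map_matUncurry [SigmaFinite μ] :
    (matMeasure μ ι κ).map (matUncurry ι κ) = Measure.pi fun _ : ι × κ => μ := by
  symm
  refine Measure.pi_eq fun s hs => ?_
  rw [(matUncurry ι κ).map_apply, Fintype.prod_prod_type,
    ← matMeasure_apply_box μ fun i j => s (i, j)]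
  congr 1
  ext Z
  simp [Set.mem_pi]

lemma matMeasure_eq_of_map [SigmaFinite μ] {ν : Measure (Matrix ι κ ℝ)}
    (h : ∀ s : ι × κ → Set ℝ, (∀ p, MeasurableSet (s p)) →
      ν {Z | ∀ i j, Z i j ∈ s (i, j)} = ∏ i, ∏ j, μ (s (i, j))) :
    ν = matMeasure μ ι κ := by
  have h1 : ν.map (matUncurry ι κ) = (matMeasure μ ι κ).map (matUncurry ι κ) := by
    rw [map_matUncurry]
    symm
    refine Measure.pi_eq fun s hs => ?_
    rw [(matUncurry ι κ).map_apply, Fintype.prod_prod_type, ← h s hs]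
    congr 1
    ext Z
    simp [Set.mem_pi]
  have h2 := congrArg (Measure.map (matUncurry ι κ).symm) h1
  simpa [MeasurableEquiv.map_map_symm] using h2

lemma measurePreserving_transpose [SigmaFinite μ] :
    MeasurePreserving (Matrix.transpose : Matrix ι κ ℝ → Matrix κ ι ℝ)
      (matMeasure μ ι κ) (matMeasure μ κ ι) := by
  have hm : Measurable (Matrix.transpose : Matrix ι κ ℝ → Matrix κ ι ℝ) :=
    measurable_matrix_iff.2 fun i j => measurable_matrix_apply j i
  refine ⟨hm, matMeasure_eq_of_map μ fun s hs => ?_⟩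
  rw [Measure.map_apply hm]
  · have := matMeasure_apply_box μ (fun i j => s (j, i)) (ι := ι) (κ := κ)
    rw [Finset.prod_comm] at this
    rw [← this]
    congr 1
    ext Z
    exact ⟨fun h i j => h j i, fun h i j => h j i⟩
  · rw [show {Z : Matrix κ ι ℝ | ∀ i j, Z i j ∈ s (i, j)} =
      ⋂ i, ⋂ j, (fun Z => Z i j) ⁻¹' (s (i, j)) by ext; simp]
    exact MeasurableSet.iInter fun i => MeasurableSet.iInter fun j =>
      measurable_matrix_apply i j (hs _)

/-- The square matrix with blocks `a`, `c`, `b`, `D`. -/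
def blk (a : ℝ) (c b : κ → ℝ) (D : Matrix κ κ ℝ) : Matrix (Unit ⊕ κ) (Unit ⊕ κ) ℝ :=
  Matrix.fromBlocks (Matrix.of fun _ _ => a) (Matrix.replicateRow Unit c)
    (Matrix.replicateCol Unit b) D

@[simp] lemma blk_inl_inl (a : ℝ) (c b : κ → ℝ) (D : Matrix κ κ ℝ) (u v : Unit) :
    blk a c b D (Sum.inl u) (Sum.inl v) = a := rfl
@[simp] lemma blk_inl_inr (a : ℝ) (c b : κ → ℝ) (D : Matrix κ κ ℝ) (u : Unit) (k : κ) :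
    blk a c b D (Sum.inl u) (Sum.inr k) = c k := rfl
@[simp] lemma blk_inr_inl (a : ℝ) (c b : κ → ℝ) (D : Matrix κ κ ℝ) (u : Unit) (k : κ) :
    blk a c b D (Sum.inr k) (Sum.inl u) = b k := rfl
@[simp] lemma blk_inr_inr (a : ℝ) (c b : κ → ℝ) (D : Matrix κ κ ℝ) (k l : κ) :
    blk a c b D (Sum.inr k) (Sum.inr l) = D k l := rfl

lemma measurable_blk : Measurable
    fun p : ℝ × (κ → ℝ) × (κ → ℝ) × Matrix κ κ ℝ => blk p.1 p.2.1 p.2.2.1 p.2.2.2 := by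
  refine measurable_matrix_iff.2 ?_
  rintro (i | i) (j | j)
  · exact measurable_fst
  · simp only [blk_inl_inr]; fun_prop
  · simp only [blk_inr_inl]; fun_prop
  · exact (measurable_matrix_apply i j).comp measurable_snd.snd.snd

lemma Measurable.blk {α : Type*} [MeasurableSpace α] {a : α → ℝ} {c b : α → κ → ℝ}
    {D : α → Matrix κ κ ℝ} (ha : Measurable a) (hc : Measurable c) (hb : Measurable b)
    (hD : Measurable D) : Measurable fun x => blk (a x) (c x) (b x) (D x) :=
  measurable_blk.comp (ha.prodMk (hc.prodMk (hb.prodMk hD)))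

lemma measurePreserving_blk [SigmaFinite μ] : MeasurePreserving
    (fun p : ℝ × (κ → ℝ) × (κ → ℝ) × Matrix κ κ ℝ => blk p.1 p.2.1 p.2.2.1 p.2.2.2)
    (μ.prod ((Measure.pi fun _ => μ).prod ((Measure.pi fun _ => μ).prod (matMeasure μ κ κ))))
    (matMeasure μ (Unit ⊕ κ) (Unit ⊕ κ)) := by
  refine ⟨measurable_blk, matMeasure_eq_of_map μ fun s hs => ?_⟩
  rw [Measure.map_apply measurable_blk]
  · have : ((fun p : ℝ × (κ → ℝ) × (κ → ℝ) × Matrix κ κ ℝ => blk p.1 p.2.1 p.2.2.1 p.2.2.2) ⁻¹'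
        {Z | ∀ i j, Z i j ∈ s (i, j)}) = (s (Sum.inl (), Sum.inl ())) ×ˢ
        (Set.univ.pi fun k => s (Sum.inl (), Sum.inr k)) ×ˢ
        (Set.univ.pi fun k => s (Sum.inr k, Sum.inl ())) ×ˢ
        {Z | ∀ i j, Z i j ∈ s (Sum.inr i, Sum.inr j)} := by
      ext ⟨a, c, b, D⟩
      simp only [Set.mem_preimage, Set.mem_ofPred_eq, Sum.forall, Set.mem_prod, Set.mem_pi,
        Set.mem_univ, blk_inl_inl, blk_inl_inr, blk_inr_inl, blk_inr_inr]
      constructor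
      · rintro ⟨h, h3⟩
        obtain ⟨h1, h2⟩ := h ()
        exact ⟨h1 (), fun i _ => h2 i, fun i _ => (h3 i).1 (), fun i => (h3 i).2⟩
      · rintro ⟨h1, h2, h3, h4⟩
        exact ⟨fun _ => ⟨fun _ => h1, fun i => h2 i trivial⟩, fun i => ⟨fun _ => h3 i trivial, h4 i⟩⟩
    rw [this, Measure.prod_prod, Measure.prod_prod, Measure.prod_prod, Measure.pi_pi,
      Measure.pi_pi, matMeasure_apply_box μ fun i j => s (Sum.inr i, Sum.inr j)]
    simp only [Fintype.prod_sum_type, Finset.univ_unique, Finset.prod_singleton,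
      Finset.prod_mul_distrib, PUnit.default_eq_unit]
    ring
  · rw [show {Z : Matrix (Unit ⊕ κ) (Unit ⊕ κ) ℝ | ∀ i j, Z i j ∈ s (i, j)} =
      ⋂ i, ⋂ j, (fun Z => Z i j) ⁻¹' (s (i, j)) by ext; simp]
    exact MeasurableSet.iInter fun i => MeasurableSet.iInter fun j =>
      measurable_matrix_apply i j (hs _)

lemma lintegral_blk [SigmaFinite μ] {F : Matrix (Unit ⊕ κ) (Unit ⊕ κ) ℝ → ENNReal}
    (hF : Measurable F) :
    ∫⁻ Z, F Z ∂matMeasure μ (Unit ⊕ κ) (Unit ⊕ κ) =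
      ∫⁻ a, ∫⁻ c, ∫⁻ b, ∫⁻ D, F (blk a c b D) ∂matMeasure μ κ κ ∂Measure.pi (fun _ => μ)
        ∂Measure.pi (fun _ => μ) ∂μ := by
  have h := hF.comp (measurable_blk (κ := κ))
  rw [← (measurePreserving_blk μ).lintegral_comp hF, lintegral_prod _ (by exact h.aemeasurable)]
  refine lintegral_congr fun a => ?_
  have h := h.comp (measurable_prodMk_left (x := a))
  rw [lintegral_prod _ (by exact h.aemeasurable)]
  refine lintegral_congr fun c => ?_
  have h := h.comp (measurable_prodMk_left (x := c))
  rw [lintegral_prod _ (by exact h.aemeasurable)]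

end MatrixMeasure

section GaussianMatrix

set_option linter.unusedSectionVars false

variable {ι κ : Type*} [Fintype ι] [Fintype κ]

lemma Measure.pi_const_smul {α : Type*} [MeasurableSpace α] (μ : Measure α) [SigmaFinite μ]
    {c : ENNReal} (hc : c ≠ ⊤) :
    (Measure.pi fun _ : ι => c • μ) = c ^ Fintype.card ι • Measure.pi fun _ : ι => μ := by
  lift c to NNReal using hc
  have : SigmaFinite ((c : ENNReal) • μ) := inferInstanceAs (SigmaFinite (c • μ))
  symm
  refine (Measure.pi_eq fun s _ => ?_).symm
  rw [Measure.smul_apply, Measure.pi_pi]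
  simp [Measure.smul_apply, Finset.prod_mul_distrib]

lemma measurable_matrix_mul_const (M : Matrix κ κ ℝ) : Measurable fun Z : Matrix ι κ ℝ => Z * M :=
  (continuous_id.matrix_mul continuous_const).measurable

lemma measurable_const_matrix_mul (M : Matrix ι ι ℝ) : Measurable fun Z : Matrix ι κ ℝ => M * Z :=
  (continuous_const.matrix_mul continuous_id).measurable

lemma lintegral_volume_mul_right [DecidableEq κ] {M : Matrix κ κ ℝ} (hM : M.det ≠ 0)
    {F : Matrix ι κ ℝ → ENNReal} (hF : Measurable F) :
    ∫⁻ Z, F (Z * M) ∂matMeasure volume ι κ =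
      ENNReal.ofReal (|M.det|⁻¹) ^ Fintype.card ι * ∫⁻ Z, F Z ∂matMeasure volume ι κ := by
  have h1 : (matMeasure volume ι κ).map (fun Z : Matrix ι κ ℝ => Z * M) =
      ENNReal.ofReal (|M.det|⁻¹) ^ Fintype.card ι • matMeasure volume ι κ := by
    have hdet : M.transpose.det ≠ 0 := by rwa [Matrix.det_transpose]
    have h2 := Real.map_matrix_volume_pi_eq_smul_volume_pi hdet
    have h3 : (fun Z : Matrix ι κ ℝ => Z * M) ∘ matOf ι κ =
        matOf ι κ ∘ fun f i => Matrix.toLin' M.transpose (f i) := by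
      funext f
      ext i j
      simp [Matrix.mul_apply, Matrix.mulVec, dotProduct, mul_comm]
    have hmeas : Measurable (Matrix.toLin' M.transpose) :=
      (LinearMap.continuous_of_finiteDimensional _).measurable
    have hmeas' : Measurable fun (f : ι → κ → ℝ) i => Matrix.toLin' M.transpose (f i) :=
      measurable_pi_lambda _ fun i => hmeas.comp (measurable_pi_apply i)
    rw [matMeasure, Measure.map_map (measurable_matrix_mul_const M) (matOf ι κ).measurable, h3,
      ← Measure.map_map (matOf ι κ).measurable hmeas']
    have hsf : SigmaFinite ((Measure.pi fun _ : κ => (volume : Measure ℝ)).map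
        (Matrix.toLin' M.transpose)) := by
      rw [← volume_pi, h2]
      exact inferInstanceAs (SigmaFinite (Real.toNNReal _ • _))
    rw [Measure.pi_map_pi (hμ := fun _ => hsf) (fun i => hmeas.aemeasurable)]
    simp_rw [← volume_pi, h2]
    rw [Measure.pi_const_smul _ ENNReal.ofReal_ne_top, Measure.map_smul, Matrix.det_transpose,
      abs_inv]
    rfl
  rw [← lintegral_map hF (measurable_matrix_mul_const M), h1, lintegral_smul_measure, smul_eq_mul]

lemma lintegral_volume_mul_left [DecidableEq ι] {M : Matrix ι ι ℝ} (hM : M.det ≠ 0)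
    {F : Matrix ι κ ℝ → ENNReal} (hF : Measurable F) :
    ∫⁻ Z, F (M * Z) ∂matMeasure volume ι κ =
      ENNReal.ofReal (|M.det|⁻¹) ^ Fintype.card κ * ∫⁻ Z, F Z ∂matMeasure volume ι κ := by
  have ht := measurePreserving_transpose (ι := κ) (κ := ι) volume
  rw [← ht.lintegral_comp (f := fun Z => F (M * Z)) (hF.comp (measurable_const_matrix_mul M)), ← ht.lintegral_comp hF]
  have h := lintegral_volume_mul_right (ι := κ) (M := M.transpose)
    (by rwa [Matrix.det_transpose]) (hF.comp ht.measurable)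
  simpa [Matrix.transpose_mul] using h

/-- The standard Gaussian density on matrices. -/
noncomputable def gdens (Z : Matrix ι κ ℝ) : ENNReal := ∏ i, ∏ j, gaussianPDF 0 1 (Z i j)

lemma measurable_gdens : Measurable (gdens : Matrix ι κ ℝ → ENNReal) := by
  unfold gdens
  refine Finset.measurable_prod _ fun i _ => Finset.measurable_prod _ fun j _ => ?_
  exact (measurable_gaussianPDF 0 1).comp (measurable_matrix_apply i j)

lemma gdens_eq (Z : Matrix ι κ ℝ) :
    gdens Z = ENNReal.ofReal ((√(2 * Real.pi))⁻¹ ^ (Fintype.card ι * Fintype.card κ) *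
      Real.exp (-(Z.transpose * Z).trace / 2)) := by
  have h : ∀ x : ℝ, gaussianPDFReal 0 1 x = (√(2 * Real.pi))⁻¹ * Real.exp (-x ^ 2 / 2) := by
    intro x
    simp [gaussianPDFReal]
  unfold gdens gaussianPDF
  simp_rw [h]
  have h' : ∀ i, ∏ j, ENNReal.ofReal ((√(2 * Real.pi))⁻¹ * Real.exp (-(Z i j) ^ 2 / 2)) =
      ENNReal.ofReal (∏ j, ((√(2 * Real.pi))⁻¹ * Real.exp (-(Z i j) ^ 2 / 2))) := fun i =>
    (ENNReal.ofReal_prod_of_nonneg (fun j _ => by positivity)).symm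
  rw [Finset.prod_congr rfl fun i _ => h' i,
    ← ENNReal.ofReal_prod_of_nonneg (fun (j : ι) _ => by positivity)]
  congr 1
  simp only [Finset.prod_mul_distrib, Finset.prod_const, Finset.card_univ, ← Real.exp_sum]
  rw [← pow_mul, mul_comm (Fintype.card κ)]
  congr 2
  simp only [Matrix.trace, Matrix.diag, Matrix.mul_apply, Matrix.transpose_apply]
  rw [Finset.sum_comm, neg_div, Finset.sum_div, ← Finset.sum_neg_distrib]
  refine Finset.sum_congr rfl fun i _ => ?_
  rw [Finset.sum_div, ← Finset.sum_neg_distrib]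
  refine Finset.sum_congr rfl fun j _ => ?_
  ring

lemma gdens_mul_left [DecidableEq ι] {Q : Matrix ι ι ℝ} (hQ : Q.transpose * Q = 1)
    (Z : Matrix ι κ ℝ) : gdens (Q * Z) = gdens Z := by
  rw [gdens_eq, gdens_eq, Matrix.transpose_mul, Matrix.mul_assoc, ← Matrix.mul_assoc _ Q, hQ,
    Matrix.one_mul]

lemma gdens_mul_right [DecidableEq κ] {Q : Matrix κ κ ℝ} (hQ : Q.transpose * Q = 1)
    (Z : Matrix ι κ ℝ) : gdens (Z * Q) = gdens Z := by
  have hQ' : Q * Q.transpose = 1 := mul_eq_one_comm.1 hQ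
  rw [gdens_eq, gdens_eq, Matrix.transpose_mul, Matrix.trace_mul_comm, ← Matrix.mul_assoc,
    Matrix.mul_assoc Z, hQ', Matrix.mul_one, Matrix.trace_mul_comm]

lemma pi_gaussian_eq_withDensity :
    (Measure.pi fun _ : ι => gaussianReal 0 1) =
      (Measure.pi fun _ : ι => (volume : Measure ℝ)).withDensity
        fun x => ∏ i, gaussianPDF 0 1 (x i) := by
  refine Measure.pi_eq fun s hs => ?_
  rw [withDensity_apply _ (MeasurableSet.univ_pi hs), Measure.restrict_pi_pi]
  have h1 : ∀ x : ι → ℝ, ∏ i, gaussianPDF 0 1 (x i) =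
      ENNReal.ofReal (∏ i, gaussianPDFReal 0 1 (x i)) := fun x => by
    rw [ENNReal.ofReal_prod_of_nonneg fun i _ => gaussianPDFReal_nonneg _ _ _]
    rfl
  simp_rw [h1]
  have hInt : ∀ i, Integrable (gaussianPDFReal 0 1) (volume.restrict (s i)) := fun i =>
    (integrable_gaussianPDFReal 0 1).restrict
  rw [← ofReal_integral_eq_lintegral_ofReal, integral_fintype_prod_eq_prod,
    ENNReal.ofReal_prod_of_nonneg]
  · refine Finset.prod_congr rfl fun i _ => ?_
    rw [gaussianReal_apply 0 one_ne_zero, ofReal_integral_eq_lintegral_ofReal (hInt i)]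
    · rfl
    · exact Eventually.of_forall fun x => gaussianPDFReal_nonneg _ _ _
  · exact fun i _ => integral_nonneg fun x => gaussianPDFReal_nonneg _ _ _
  · exact Integrable.fintype_prod hInt
  · exact Eventually.of_forall fun x => Finset.prod_nonneg fun i _ => gaussianPDFReal_nonneg _ _ _

/-- The law of a matrix with independent standard Gaussian entries. -/
noncomputable abbrev gin (ι κ : Type*) [Fintype ι] [Fintype κ] : Measure (Matrix ι κ ℝ) :=
  matMeasure (gaussianReal 0 1) ι κ

lemma lintegral_gin {F : Matrix ι κ ℝ → ENNReal} (hF : Measurable F) :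
    ∫⁻ Z, F Z ∂gin ι κ = ∫⁻ Z, gdens Z * F Z ∂matMeasure volume ι κ := by
  have hG : Measurable fun x : ι × κ → ℝ => F ((matUncurry ι κ).symm x) :=
    hF.comp (matUncurry ι κ).symm.measurable
  have h1 : ∀ μ : Measure ℝ, SigmaFinite μ → ∀ F : Matrix ι κ ℝ → ENNReal, Measurable F →
      ∫⁻ Z, F Z ∂matMeasure μ ι κ =
      ∫⁻ x, F ((matUncurry ι κ).symm x) ∂Measure.pi fun _ : ι × κ => μ := by
    intro μ _ F hF
    rw [← map_matUncurry, lintegral_map_equiv]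
    simp
  rw [h1 _ inferInstance F hF, h1 _ inferInstance (fun Z => gdens Z * F Z) (measurable_gdens.mul hF),
    pi_gaussian_eq_withDensity, lintegral_withDensity_eq_lintegral_mul _ _ hG]
  · refine lintegral_congr fun x => ?_
    simp only [Pi.mul_apply, gdens]
    rw [Fintype.prod_prod_type]
    rfl
  · exact Finset.measurable_prod _ fun i _ =>
      (measurable_gaussianPDF 0 1).comp (measurable_pi_apply i)

lemma abs_det_of_orthogonal [DecidableEq κ] {Q : Matrix κ κ ℝ} (hQ : Q.transpose * Q = 1) :
    |Q.det| = 1 := by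
  have := congrArg Matrix.det hQ
  rw [Matrix.det_mul, Matrix.det_transpose, Matrix.det_one, ← pow_two] at this
  rw [← sq_eq_sq₀ (abs_nonneg _) zero_le_one, sq_abs, this, one_pow]

lemma lintegral_gin_mul_right [DecidableEq κ] {Q : Matrix κ κ ℝ} (hQ : Q.transpose * Q = 1)
    {F : Matrix ι κ ℝ → ENNReal} (hF : Measurable F) :
    ∫⁻ Z, F (Z * Q) ∂gin ι κ = ∫⁻ Z, F Z ∂gin ι κ := by
  have hd := abs_det_of_orthogonal hQ
  have hd0 : Q.det ≠ 0 := fun h => by simp [h] at hd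
  have := lintegral_volume_mul_right (ι := ι) hd0 (measurable_gdens.mul hF)
  rw [hd] at this
  rw [lintegral_gin (F := fun Z => F (Z * Q)) (hF.comp (measurable_matrix_mul_const Q)), lintegral_gin hF]
  simpa [gdens_mul_right hQ] using this

lemma lintegral_gin_mul_left [DecidableEq ι] {Q : Matrix ι ι ℝ} (hQ : Q.transpose * Q = 1)
    {F : Matrix ι κ ℝ → ENNReal} (hF : Measurable F) :
    ∫⁻ Z, F (Q * Z) ∂gin ι κ = ∫⁻ Z, F Z ∂gin ι κ := by
  have hd := abs_det_of_orthogonal hQ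
  have hd0 : Q.det ≠ 0 := fun h => by simp [h] at hd
  have := lintegral_volume_mul_left (κ := κ) hd0 (measurable_gdens.mul hF)
  rw [hd] at this
  rw [lintegral_gin (F := fun Z => F (Q * Z)) (hF.comp (measurable_const_matrix_mul Q)), lintegral_gin hF]
  simpa [gdens_mul_left hQ] using this

end GaussianMatrix

section Bartlett

set_option linter.unusedSectionVars false

variable {ι κ : Type*} [Fintype ι] [Fintype κ]

/-- The matrix obtained by placing the row `c` on top of `D`. -/
def rowAdj (c : κ → ℝ) (D : Matrix κ κ ℝ) : Matrix (Unit ⊕ κ) κ ℝ :=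
  Matrix.of (Sum.elim (fun _ => c) D)

/-- The matrix obtained by placing the column `v` in front of `Y`. -/
def colAdj (v : Unit ⊕ κ → ℝ) (Y : Matrix (Unit ⊕ κ) κ ℝ) : Matrix (Unit ⊕ κ) (Unit ⊕ κ) ℝ :=
  Matrix.of fun i => Sum.elim (fun _ => v i) (fun j => Y i j)

lemma mul_colAdj (Q : Matrix (Unit ⊕ κ) (Unit ⊕ κ) ℝ) (v : Unit ⊕ κ → ℝ)
    (Y : Matrix (Unit ⊕ κ) κ ℝ) : Q * colAdj v Y = colAdj (Q.mulVec v) (Q * Y) := by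
  ext i (j | j) <;> simp [colAdj, Matrix.mul_apply, Matrix.mulVec, dotProduct]

lemma colAdj_rowAdj (a : ℝ) (b c : κ → ℝ) (D : Matrix κ κ ℝ) :
    colAdj (Sum.elim (fun _ => a) b) (rowAdj c D) = blk a c b D := by
  ext (i | i) (j | j) <;> rfl

lemma measurable_colAdj (v : Unit ⊕ κ → ℝ) : Measurable (colAdj v) := by
  refine measurable_matrix_iff.2 ?_
  rintro i (j | j)
  · exact measurable_const
  · exact measurable_matrix_apply i j

lemma measurePreserving_rowAdj (μ : Measure ℝ) [SigmaFinite μ] : MeasurePreserving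
    (fun p : (κ → ℝ) × Matrix κ κ ℝ => rowAdj p.1 p.2)
    ((Measure.pi fun _ => μ).prod (matMeasure μ κ κ)) (matMeasure μ (Unit ⊕ κ) κ) := by
  have hm : Measurable (fun p : (κ → ℝ) × Matrix κ κ ℝ => rowAdj p.1 p.2) := by
    refine measurable_matrix_iff.2 ?_
    rintro (i | i) j
    · exact (measurable_pi_apply j).comp measurable_fst
    · exact (measurable_matrix_apply i j).comp measurable_snd
  refine ⟨hm, matMeasure_eq_of_map μ fun s hs => ?_⟩
  rw [Measure.map_apply hm]
  · have : ((fun p : (κ → ℝ) × Matrix κ κ ℝ => rowAdj p.1 p.2) ⁻¹'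
        {Z | ∀ i j, Z i j ∈ s (i, j)}) =
        (Set.univ.pi fun k => s (Sum.inl (), k)) ×ˢ
        {Z | ∀ i j, Z i j ∈ s (Sum.inr i, j)} := by
      ext ⟨c, D⟩
      constructor
      · exact fun h => ⟨fun k _ => h (Sum.inl ()) k, fun i j => h (Sum.inr i) j⟩
      · rintro ⟨h1, h2⟩ (i | i) j
        · exact h1 j trivial
        · exact h2 i j
    rw [this, Measure.prod_prod, Measure.pi_pi,
      matMeasure_apply_box μ fun i j => s (Sum.inr i, j)]
    simp only [Fintype.prod_sum_type, Finset.univ_unique, Finset.prod_singleton,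
      PUnit.default_eq_unit]
  · rw [show {Z : Matrix (Unit ⊕ κ) κ ℝ | ∀ i j, Z i j ∈ s (i, j)} =
      ⋂ i, ⋂ j, (fun Z => Z i j) ⁻¹' (s (i, j)) by ext; simp]
    exact MeasurableSet.iInter fun i => MeasurableSet.iInter fun j =>
      measurable_matrix_apply i j (hs _)

lemma lintegral_rowAdj (μ : Measure ℝ) [SigmaFinite μ] {F : Matrix (Unit ⊕ κ) κ ℝ → ENNReal}
    (hF : Measurable F) :
    ∫⁻ Z, F Z ∂matMeasure μ (Unit ⊕ κ) κ =
      ∫⁻ c, ∫⁻ D, F (rowAdj c D) ∂matMeasure μ κ κ ∂Measure.pi (fun _ => μ) := by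
  have hp := measurePreserving_rowAdj (κ := κ) μ
  rw [← hp.lintegral_comp hF, lintegral_prod _ (by exact (hF.comp hp.measurable).aemeasurable)]

/-- A Householder reflection mapping `v` to a multiple of a basis vector. -/
lemma exists_orthogonal_mulVec_eq [DecidableEq ι] (v : ι → ℝ) (i₀ : ι) :
    ∃ Q : Matrix ι ι ℝ, Q.transpose * Q = 1 ∧
      Q.mulVec v = Pi.single i₀ (√(v ⬝ᵥ v)) := by
  set ρ : ℝ := √(v ⬝ᵥ v) with hρ
  have hvv : 0 ≤ v ⬝ᵥ v := Finset.sum_nonneg fun i _ => mul_self_nonneg _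
  have hρ2 : ρ * ρ = v ⬝ᵥ v := Real.mul_self_sqrt hvv
  set u : ι → ℝ := v - Pi.single i₀ ρ with hu
  by_cases hu0 : u = 0
  · refine ⟨1, by simp, ?_⟩
    rw [Matrix.one_mulVec]
    exact sub_eq_zero.1 hu0
  have huu : u ⬝ᵥ u ≠ 0 := by rwa [ne_eq, dotProduct_self_eq_zero]
  have h1 : u ⬝ᵥ u = 2 * (u ⬝ᵥ v) := by
    simp only [hu, dotProduct_sub, sub_dotProduct, dotProduct_single, single_dotProduct,
      Pi.sub_apply, Pi.single_eq_same]
    linarith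
  have hsymm : (1 - (2 / (u ⬝ᵥ u)) • Matrix.vecMulVec u u).transpose =
      1 - (2 / (u ⬝ᵥ u)) • Matrix.vecMulVec u u := by
    simp [Matrix.transpose_sub, Matrix.transpose_smul, Matrix.transpose_vecMulVec]
  refine ⟨1 - (2 / (u ⬝ᵥ u)) • Matrix.vecMulVec u u, ?_, ?_⟩
  · rw [hsymm]
    have h2 : Matrix.vecMulVec u u * Matrix.vecMulVec u u = (u ⬝ᵥ u) • Matrix.vecMulVec u u := by
      ext i j
      simp only [Matrix.mul_apply, Matrix.vecMulVec_apply, Matrix.smul_apply, dotProduct,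
        smul_eq_mul, Finset.sum_mul]
      exact Finset.sum_congr rfl fun k _ => by ring
    rw [sub_mul, one_mul, mul_sub, mul_one, Matrix.smul_mul, Matrix.mul_smul, h2, smul_smul,
      smul_smul, mul_assoc, div_mul_cancel₀ _ huu]
    module
  · have h3 : (Matrix.vecMulVec u u).mulVec v = (u ⬝ᵥ v) • u := by
      ext i
      simp only [Matrix.mulVec, dotProduct, Matrix.vecMulVec_apply, Pi.smul_apply, smul_eq_mul,
        Finset.sum_mul]
      exact Finset.sum_congr rfl fun k _ => by ring
    have h4 : 2 / (u ⬝ᵥ u) * (u ⬝ᵥ v) = 1 := by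
      rw [h1] at huu ⊢
      have : u ⬝ᵥ v ≠ 0 := fun h => huu (by rw [h, mul_zero])
      field_simp
    rw [Matrix.sub_mulVec, Matrix.one_mulVec, Matrix.smul_mulVec, h3, smul_smul, h4, one_smul, hu]
    simp

/-- The density `r ^ s * exp (-r ^ 2 / 2)`. -/
noncomputable def chiWeight (s : ℕ) (r : ℝ) : ℝ := |r| ^ s * Real.exp (-r ^ 2 / 2)

/-- The total mass of `chiWeight s` on the positive half-line. -/
noncomputable def chiMass (s : ℕ) : ENNReal := ∫⁻ r in Set.Ioi 0, ENNReal.ofReal (chiWeight s r)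

/-- The chi distribution with `s + 1` degrees of freedom. -/
noncomputable def chi (s : ℕ) : Measure ℝ :=
  (chiMass s)⁻¹ • (volume.restrict (Set.Ioi 0)).withDensity fun r => ENNReal.ofReal (chiWeight s r)

lemma continuous_chiWeight (s : ℕ) : Continuous (chiWeight s) := by
  unfold chiWeight; fun_prop

lemma chiWeight_nonneg (s : ℕ) (r : ℝ) : 0 ≤ chiWeight s r := by unfold chiWeight; positivity

lemma chiWeight_neg (s : ℕ) (r : ℝ) : chiWeight s (-r) = chiWeight s r := by simp [chiWeight]

lemma lintegral_chi (s : ℕ) {f : ℝ → ENNReal} (hf : Measurable f) :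
    ∫⁻ r, f r ∂chi s =
      (chiMass s)⁻¹ * ∫⁻ r in Set.Ioi 0, ENNReal.ofReal (chiWeight s r) * f r := by
  rw [chi, lintegral_smul_measure, lintegral_withDensity_eq_lintegral_mul _
    (continuous_chiWeight s).measurable.ennreal_ofReal hf]
  rfl

lemma lintegral_eq_Ioi_add {f : ℝ → ENNReal} (hf : Measurable f) :
    ∫⁻ x, f x = ∫⁻ x in Set.Ioi 0, (f x + f (-x)) := by
  rw [lintegral_add_left hf]
  have h1 : ∫⁻ x in Set.Ioi (0 : ℝ), f (-x) = ∫⁻ x in Set.Iio 0, f x := by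
    have := (Measure.measurePreserving_neg (volume : Measure ℝ)).setLIntegral_comp_preimage
      (measurableSet_Iio (a := (0 : ℝ))) hf
    simpa using this
  rw [h1, ← lintegral_add_compl f (measurableSet_Ioi (a := (0 : ℝ)))]
  congr 1
  rw [Set.compl_Ioi]
  exact setLIntegral_congr Iio_ae_eq_Iic.symm

lemma lintegral_comp_smul_pi {a : ℝ} (ha : a ≠ 0) {f : (κ → ℝ) → ENNReal} (hf : Measurable f) :
    ∫⁻ y, f y = ENNReal.ofReal (|a| ^ Fintype.card κ) * ∫⁻ y, f (a • y) := by
  have h := Measure.map_addHaar_smul (volume : Measure (κ → ℝ)) ha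
  have h2 : ∫⁻ y, f (a • y) = ∫⁻ y, f y ∂(volume.map (a • · : (κ → ℝ) → (κ → ℝ))) :=
    (lintegral_map hf (measurable_const_smul a)).symm
  rw [h2, h, lintegral_smul_measure, smul_eq_mul, ← mul_assoc, ← ENNReal.ofReal_mul (by positivity),
    Module.finrank_fintype_fun_eq_card, abs_inv, abs_pow, mul_inv_cancel₀, ENNReal.ofReal_one,
    one_mul]
  exact pow_ne_zero _ (abs_ne_zero.2 ha)

lemma lintegral_comp_mul_real {a : ℝ} (ha : a ≠ 0) {f : ℝ → ENNReal} (hf : Measurable f) :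
    ∫⁻ x, f (a * x) = ENNReal.ofReal |a|⁻¹ * ∫⁻ x, f x := by
  have h := Real.map_volume_mul_left ha
  rw [← lintegral_map hf (measurable_const_mul a), h, lintegral_smul_measure, smul_eq_mul, abs_inv]

lemma lintegral_pi_gaussian {f : (κ → ℝ) → ENNReal} (hf : Measurable f) :
    ∫⁻ x, f x ∂Measure.pi (fun _ : κ => gaussianReal 0 1) =
      ∫⁻ x, ENNReal.ofReal ((√(2 * Real.pi))⁻¹ ^ Fintype.card κ * Real.exp (-(x ⬝ᵥ x) / 2)) *
        f x := by
  rw [pi_gaussian_eq_withDensity, lintegral_withDensity_eq_lintegral_mul _ _ hf]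
  · refine lintegral_congr fun x => ?_
    simp only [Pi.mul_apply]
    congr 1
    simp only [gaussianPDF]
    rw [← ENNReal.ofReal_prod_of_nonneg fun i _ => gaussianPDFReal_nonneg _ _ _]
    congr 1
    simp only [gaussianPDFReal, NNReal.coe_one, mul_one, sub_zero, Finset.prod_mul_distrib,
      Finset.prod_const, Finset.card_univ, ← Real.exp_sum]
    congr 2
    rw [dotProduct, neg_div, Finset.sum_div, ← Finset.sum_neg_distrib]
    exact Finset.sum_congr rfl fun i _ => by ring
  · exact Finset.measurable_prod _ fun i _ =>
      (measurable_gaussianPDF 0 1).comp (measurable_pi_apply i)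

lemma lintegral_gaussian {f : ℝ → ENNReal} (hf : Measurable f) :
    ∫⁻ x, f x ∂gaussianReal 0 1 =
      ∫⁻ x, ENNReal.ofReal ((√(2 * Real.pi))⁻¹ * Real.exp (-x ^ 2 / 2)) * f x := by
  rw [gaussianReal_of_var_ne_zero 0 one_ne_zero,
    lintegral_withDensity_eq_lintegral_mul _ (measurable_gaussianPDF 0 1) hf]
  refine lintegral_congr fun x => ?_
  simp [gaussianPDF, gaussianPDFReal]

/-- The integral over the affine chart of projective space. -/
noncomputable def chartMass (κ : Type*) [Fintype κ] : ENNReal :=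
  ∫⁻ y : κ → ℝ, ENNReal.ofReal ((√(1 + y ⬝ᵥ y))⁻¹ ^ (Fintype.card κ + 1))

lemma lintegral_norm_gaussian_aux {g : ℝ → ENNReal} (hg : Measurable g) :
    ∫⁻ a, ∫⁻ b : κ → ℝ, g (√(a ^ 2 + b ⬝ᵥ b)) ∂Measure.pi (fun _ => gaussianReal 0 1)
      ∂gaussianReal 0 1 =
    ENNReal.ofReal ((√(2 * Real.pi))⁻¹ ^ (Fintype.card κ + 1)) * chartMass κ *
      ∫⁻ s, ENNReal.ofReal (chiWeight (Fintype.card κ) s) * g |s| := by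
  set n := Fintype.card κ with hn
  set K : ℝ := (√(2 * Real.pi))⁻¹ with hK
  have hK0 : 0 ≤ K := by positivity
  have hdot : Continuous fun y : κ → ℝ => y ⬝ᵥ y := by unfold dotProduct; fun_prop
  have hm1 : Measurable fun p : ℝ × (κ → ℝ) => g (√(p.1 ^ 2 + p.2 ⬝ᵥ p.2)) := by
    refine hg.comp (Continuous.measurable ?_)
    have := hdot.comp (continuous_snd (X := ℝ))
    simp only [Function.comp_def] at this
    fun_prop
  have hin : Measurable fun a => ∫⁻ b : κ → ℝ, g (√(a ^ 2 + b ⬝ᵥ b))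
      ∂Measure.pi (fun _ => gaussianReal 0 1) := hm1.lintegral_prod_right'
  rw [lintegral_gaussian hin]
  have step1 : ∀ a : ℝ, a ≠ 0 →
      ENNReal.ofReal (K * Real.exp (-a ^ 2 / 2)) * ∫⁻ b : κ → ℝ, g (√(a ^ 2 + b ⬝ᵥ b))
        ∂Measure.pi (fun _ => gaussianReal 0 1) =
      ∫⁻ y : κ → ℝ, ENNReal.ofReal (K ^ (n + 1) * (√(1 + y ⬝ᵥ y))⁻¹ ^ n) *
        (ENNReal.ofReal (chiWeight n (√(1 + y ⬝ᵥ y) * a)) * g |√(1 + y ⬝ᵥ y) * a|) := by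
    intro a ha
    have hm2 : Measurable fun b : κ → ℝ => g (√(a ^ 2 + b ⬝ᵥ b)) :=
      hm1.comp measurable_prodMk_left
    have hm3 : Measurable fun x : κ → ℝ => ENNReal.ofReal (K ^ n * Real.exp (-(x ⬝ᵥ x) / 2)) *
        g (√(a ^ 2 + x ⬝ᵥ x)) := by
      refine Measurable.mul ?_ hm2
      exact (Continuous.measurable (by fun_prop)).ennreal_ofReal
    have hpg := lintegral_pi_gaussian hm2
    have hsm := lintegral_comp_smul_pi ha hm3
    rw [← hn] at hpg hsm
    rw [← hK] at hpg
    rw [hpg, hsm, ← mul_assoc,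
      ← ENNReal.ofReal_mul (by positivity), ← lintegral_const_mul]
    · refine lintegral_congr fun y => ?_
      have hy : 0 ≤ y ⬝ᵥ y := Finset.sum_nonneg fun i _ => mul_self_nonneg _
      have hρ : 0 < √(1 + y ⬝ᵥ y) := Real.sqrt_pos.2 (by linarith)
      have hρ2 : √(1 + y ⬝ᵥ y) ^ 2 = 1 + y ⬝ᵥ y := Real.sq_sqrt (by linarith)
      have e1 : √(a ^ 2 + (a • y) ⬝ᵥ (a • y)) = |√(1 + y ⬝ᵥ y) * a| := by
        rw [← Real.sqrt_sq_eq_abs, mul_pow, hρ2]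
        congr 1
        simp only [smul_dotProduct, dotProduct_smul, smul_eq_mul]
        ring
      rw [e1, ← mul_assoc, ← mul_assoc, ← ENNReal.ofReal_mul (by positivity),
        ← ENNReal.ofReal_mul (by positivity)]
      congr 2
      have e2 : chiWeight n (√(1 + y ⬝ᵥ y) * a) = √(1 + y ⬝ᵥ y) ^ n * |a| ^ n *
          (Real.exp (-a ^ 2 / 2) * Real.exp (-(a • y ⬝ᵥ a • y) / 2)) := by
        rw [chiWeight, abs_mul, abs_of_pos hρ, mul_pow, ← Real.exp_add]
        congr 2
        rw [mul_pow, hρ2]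
        simp only [smul_dotProduct, dotProduct_smul, smul_eq_mul]
        ring
      rw [e2, inv_pow (√(1 + y ⬝ᵥ y)) n]
      have hρn : √(1 + y ⬝ᵥ y) ^ n ≠ 0 := pow_ne_zero _ hρ.ne'
      rw [show K ^ (n + 1) * (√(1 + y ⬝ᵥ y) ^ n)⁻¹ * (√(1 + y ⬝ᵥ y) ^ n * |a| ^ n *
        (Real.exp (-a ^ 2 / 2) * Real.exp (-(a • y ⬝ᵥ a • y) / 2))) =
        ((√(1 + y ⬝ᵥ y) ^ n)⁻¹ * √(1 + y ⬝ᵥ y) ^ n) * (K ^ (n + 1) * |a| ^ n *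
        (Real.exp (-a ^ 2 / 2) * Real.exp (-(a • y ⬝ᵥ a • y) / 2))) by ring,
        inv_mul_cancel₀ hρn]
      ring
    · exact hm3.comp (measurable_const_smul a)
  have hae : ∀ᵐ a : ℝ, a ≠ 0 := by simp [ae_iff]
  rw [lintegral_congr_ae (hae.mono step1), lintegral_lintegral_swap]
  · have hcm : Measurable fun y : κ → ℝ => ENNReal.ofReal ((√(1 + y ⬝ᵥ y))⁻¹ ^ (n + 1)) :=
      Measurable.ennreal_ofReal (((hdot.measurable.const_add 1).sqrt.inv).pow_const _)
    rw [chartMass, ← hn, ← lintegral_const_mul _ hcm, ← lintegral_mul_const _ (hcm.const_mul _)]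
    · refine lintegral_congr fun y => ?_
      have hy : 0 ≤ y ⬝ᵥ y := Finset.sum_nonneg fun i _ => mul_self_nonneg _
      have hρ : 0 < √(1 + y ⬝ᵥ y) := Real.sqrt_pos.2 (by linarith)
      have hm4 : Measurable fun s => ENNReal.ofReal (chiWeight n s) * g |s| :=
        (continuous_chiWeight n).measurable.ennreal_ofReal.mul (hg.comp measurable_abs)
      have hm5 : Measurable fun x => ENNReal.ofReal (chiWeight n (√(1 + y ⬝ᵥ y) * x)) *
          g |√(1 + y ⬝ᵥ y) * x| := hm4.comp (measurable_const_mul _)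
      rw [lintegral_const_mul _ hm5,
        lintegral_comp_mul_real (f := fun s => ENNReal.ofReal (chiWeight n s) * g |s|) hρ.ne' hm4, ← mul_assoc, ← ENNReal.ofReal_mul (by positivity),
        ← ENNReal.ofReal_mul (by positivity), abs_of_pos hρ, pow_succ (√(1 + y ⬝ᵥ y))⁻¹]
      congr 2
      ring
  · refine Measurable.aemeasurable ?_
    have hρm : Measurable fun p : ℝ × (κ → ℝ) => √(1 + p.2 ⬝ᵥ p.2) :=
      ((hdot.measurable.comp measurable_snd).const_add 1).sqrt
    refine Measurable.mul ?_ (Measurable.mul ?_ ?_)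
    · exact ((hρm.inv.pow_const n).const_mul _).ennreal_ofReal
    · exact ((continuous_chiWeight n).measurable.comp (hρm.mul measurable_fst)).ennreal_ofReal
    · exact hg.comp (hρm.mul measurable_fst).abs

lemma lintegral_chiWeight_abs (n : ℕ) {g : ℝ → ENNReal} (hg : Measurable g) :
    ∫⁻ s, ENNReal.ofReal (chiWeight n s) * g |s| =
      2 * ∫⁻ s in Set.Ioi 0, ENNReal.ofReal (chiWeight n s) * g s := by
  rw [lintegral_eq_Ioi_add (f := fun s => ENNReal.ofReal (chiWeight n s) * g |s|)
    ((continuous_chiWeight n).measurable.ennreal_ofReal.mul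
    (hg.comp measurable_abs)), ← lintegral_const_mul]
  · refine setLIntegral_congr_fun measurableSet_Ioi fun s hs => ?_
    simp only [chiWeight_neg, abs_neg, abs_of_pos (Set.mem_Ioi.1 hs)]
    ring
  · exact (continuous_chiWeight n).measurable.ennreal_ofReal.mul hg

lemma chartMass_mul_chiMass :
    ENNReal.ofReal ((√(2 * Real.pi))⁻¹ ^ (Fintype.card κ + 1)) * chartMass κ *
      (2 * chiMass (Fintype.card κ)) = 1 := by
  have h := lintegral_norm_gaussian_aux (κ := κ) (g := fun _ => 1) measurable_const
  rw [lintegral_chiWeight_abs _ measurable_const] at h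
  simpa [chiMass] using h.symm

lemma chiMass_ne (s : ℕ) : chiMass s ≠ 0 ∧ chiMass s ≠ ⊤ := by
  have h := chartMass_mul_chiMass (κ := Fin s)
  rw [Fintype.card_fin] at h
  constructor
  · intro h0
    simp [h0] at h
  · intro h0
    rw [h0, ENNReal.mul_top two_ne_zero, ENNReal.mul_top'] at h
    split_ifs at h <;> simp at h

instance (s : ℕ) : IsProbabilityMeasure (chi s) := by
  refine ⟨?_⟩
  rw [← lintegral_one, lintegral_chi s measurable_const]
  simp only [mul_one]
  exact ENNReal.inv_mul_cancel (chiMass_ne s).1 (chiMass_ne s).2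

lemma lintegral_norm_gaussian {g : ℝ → ENNReal} (hg : Measurable g) :
    ∫⁻ a, ∫⁻ b : κ → ℝ, g (√(a ^ 2 + b ⬝ᵥ b)) ∂Measure.pi (fun _ => gaussianReal 0 1)
      ∂gaussianReal 0 1 = ∫⁻ r, g r ∂chi (Fintype.card κ) := by
  rw [lintegral_norm_gaussian_aux hg, lintegral_chiWeight_abs _ hg, lintegral_chi _ hg]
  have h := chartMass_mul_chiMass (κ := κ)
  rw [← mul_assoc] at h ⊢
  rw [ENNReal.eq_inv_of_mul_eq_one_left h]

/-- Replacing the first column of a Gaussian matrix by a multiple of the first basis vector. -/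
theorem lintegral_gin_eq_blk [DecidableEq κ] {F : Matrix (Unit ⊕ κ) (Unit ⊕ κ) ℝ → ENNReal}
    (hF : Measurable F) (hinv : ∀ Q Z : Matrix (Unit ⊕ κ) (Unit ⊕ κ) ℝ,
      Q.transpose * Q = 1 → F (Q * Z) = F Z) :
    ∫⁻ Z, F Z ∂gin (Unit ⊕ κ) (Unit ⊕ κ) =
      ∫⁻ r, ∫⁻ c, ∫⁻ D, F (blk r c 0 D) ∂gin κ κ ∂Measure.pi (fun _ => gaussianReal 0 1)
        ∂chi (Fintype.card κ) := by
  have hm4 : Measurable fun p : ((ℝ × (κ → ℝ)) × (κ → ℝ)) × Matrix κ κ ℝ =>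
      F (blk p.1.1.1 p.1.1.2 p.1.2 p.2) := by
    refine hF.comp (Measurable.blk ?_ ?_ ?_ ?_) <;> fun_prop
  have hm3 := hm4.lintegral_prod_right' (ν := gin κ κ)
  rw [lintegral_blk _ hF]
  have key : ∀ (a : ℝ) (b : κ → ℝ),
      ∫⁻ c, ∫⁻ D, F (blk a c b D) ∂gin κ κ ∂Measure.pi (fun _ => gaussianReal 0 1) =
      ∫⁻ c, ∫⁻ D, F (blk (√(a ^ 2 + b ⬝ᵥ b)) c 0 D) ∂gin κ κ
        ∂Measure.pi (fun _ => gaussianReal 0 1) := by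
    intro a b
    have hcol : ∀ (a : ℝ) (b : κ → ℝ),
        ∫⁻ c, ∫⁻ D, F (blk a c b D) ∂gin κ κ ∂Measure.pi (fun _ => gaussianReal 0 1) =
        ∫⁻ Y, F (colAdj (Sum.elim (fun _ => a) b) Y) ∂gin (Unit ⊕ κ) κ := by
      intro a b
      rw [lintegral_rowAdj (F := fun Y => F (colAdj (Sum.elim (fun _ => a) b) Y))
        _ (hF.comp (measurable_colAdj _))]
      simp_rw [colAdj_rowAdj]
    obtain ⟨Q, hQ, hQv⟩ := exists_orthogonal_mulVec_eq
      (Sum.elim (fun _ : Unit => a) b) (Sum.inl ())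
    have hv : Q.mulVec (Sum.elim (fun _ : Unit => a) b) =
        Sum.elim (fun _ => √(a ^ 2 + b ⬝ᵥ b)) 0 := by
      rw [hQv]
      ext (i | i)
      · simp [dotProduct, pow_two]
      · simp
    rw [hcol, hcol, ← lintegral_gin_mul_left hQ
      (F := fun Y => F (colAdj (Sum.elim (fun _ => √(a ^ 2 + b ⬝ᵥ b)) 0) Y))
      (hF.comp (measurable_colAdj _))]
    refine lintegral_congr fun Y => ?_
    rw [← hv, ← mul_colAdj, hinv Q _ hQ]
  have hswap : ∀ a : ℝ, ∫⁻ c, ∫⁻ b, ∫⁻ D, F (blk a c b D) ∂gin κ κ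
      ∂Measure.pi (fun _ => gaussianReal 0 1) ∂Measure.pi (fun _ => gaussianReal 0 1) =
      ∫⁻ b, ∫⁻ c, ∫⁻ D, F (blk a c b D) ∂gin κ κ ∂Measure.pi (fun _ => gaussianReal 0 1)
      ∂Measure.pi (fun _ => gaussianReal 0 1) := by
    intro a
    rw [lintegral_lintegral_swap]
    have h : Measurable fun p : (κ → ℝ) × (κ → ℝ) => ((a, p.1), p.2) :=
      ((measurable_const (a := a)).prodMk measurable_fst).prodMk measurable_snd
    exact (hm3.comp h).aemeasurable
  have e : ∀ a : ℝ, ∫⁻ c, ∫⁻ b, ∫⁻ D, F (blk a c b D) ∂gin κ κ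
      ∂Measure.pi (fun _ => gaussianReal 0 1) ∂Measure.pi (fun _ => gaussianReal 0 1) =
      ∫⁻ b : κ → ℝ, ∫⁻ c, ∫⁻ D, F (blk (√(a ^ 2 + b ⬝ᵥ b)) c 0 D) ∂gin κ κ
        ∂Measure.pi (fun _ => gaussianReal 0 1) ∂Measure.pi (fun _ => gaussianReal 0 1) :=
    fun a => (hswap a).trans (lintegral_congr fun b => key a b)
  refine (lintegral_congr e).trans ?_
  refine lintegral_norm_gaussian (g := fun r => ∫⁻ c, ∫⁻ D, F (blk r c 0 D) ∂gin κ κ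
    ∂Measure.pi (fun _ => gaussianReal 0 1)) ?_
  refine Measurable.lintegral_prod_right' (f := fun p : ℝ × (κ → ℝ) =>
    ∫⁻ D, F (blk p.1 p.2 0 D) ∂gin κ κ) ?_
  exact hm3.comp (measurable_id.prodMk measurable_const)

end Bartlett

section Powers
set_option linter.unusedSectionVars false
open Matrix

/-- The law of the product of `m` independent elements with law `μ`. -/
noncomputable def mpow {M : Type*} [Monoid M] [MeasurableSpace M] (μ : Measure M) : ℕ → Measure M
  | 0 => Measure.dirac 1
  | m + 1 => μ.mconv (mpow μ m)

section General
variable {M : Type*} [Monoid M] [MeasurableSpace M] [MeasurableMul₂ M] (μ : Measure M)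

instance [IsProbabilityMeasure μ] (m : ℕ) : IsProbabilityMeasure (mpow μ m) := by
  induction m with
  | zero => unfold mpow; infer_instance
  | succ m ih => unfold mpow; infer_instance

lemma lintegral_mpow_zero {f : M → ENNReal} (hf : Measurable f) :
    ∫⁻ x, f x ∂mpow μ 0 = f 1 := by
  rw [mpow, lintegral_dirac' _ hf]

lemma lintegral_mpow_succ [IsProbabilityMeasure μ] (m : ℕ) {f : M → ENNReal} (hf : Measurable f) :
    ∫⁻ x, f x ∂mpow μ (m + 1) = ∫⁻ x, ∫⁻ y, f (x * y) ∂mpow μ m ∂μ := by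
  rw [mpow, Measure.lintegral_mconv hf]

lemma lintegral_mpow_succ' [IsProbabilityMeasure μ] (m : ℕ) {f : M → ENNReal} (hf : Measurable f) :
    ∫⁻ x, f x ∂mpow μ (m + 1) = ∫⁻ y, ∫⁻ x, f (x * y) ∂μ ∂mpow μ m := by
  rw [lintegral_mpow_succ μ m hf, lintegral_lintegral_swap]
  exact (hf.comp measurable_mul).aemeasurable

end General

variable {κ : Type*} [Fintype κ] [DecidableEq κ]

lemma blk_mul_blk (a a' : ℝ) (c c' b b' : κ → ℝ) (D D' : Matrix κ κ ℝ) :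
    blk a c b D * blk a' c' b' D' =
      blk (a * a' + c ⬝ᵥ b') (a • c' + c ᵥ* D') (a' • b + D *ᵥ b') (vecMulVec b c' + D * D') := by
  ext (i | i) (j | j)
  · simp [Matrix.mul_apply, dotProduct]
  · simp [Matrix.mul_apply, dotProduct, vecMul]
  · simp [Matrix.mul_apply, dotProduct, mulVec, mul_comm]
  · simp [Matrix.mul_apply, vecMulVec_apply]

lemma blk_zero_mul_blk_zero (a a' : ℝ) (c c' : κ → ℝ) (D D' : Matrix κ κ ℝ) :
    blk a c 0 D * blk a' c' 0 D' = blk (a * a') (a • c' + c ᵥ* D') 0 (D * D') := by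
  simp [blk_mul_blk]

lemma det_blk_zero (a : ℝ) (c : κ → ℝ) (D : Matrix κ κ ℝ) : (blk a c 0 D).det = a * D.det := by
  have h : Matrix.replicateCol Unit (0 : κ → ℝ) = 0 := by ext; simp
  rw [blk, h, Matrix.det_fromBlocks_zero₂₁]
  simp

/-- Triangular reduction of a product of Gaussian matrices applied to a fixed matrix `W`. -/
theorem lintegral_mpow_gin_blk (m : ℕ) :
    ∀ {F : Matrix (Unit ⊕ κ) (Unit ⊕ κ) ℝ → ENNReal} {f : ℝ × Matrix κ κ ℝ → ENNReal},
      Measurable F → Measurable f →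
      (∀ Q Z : Matrix (Unit ⊕ κ) (Unit ⊕ κ) ℝ, Q.transpose * Q = 1 → F (Q * Z) = F Z) →
      (∀ r c D, F (blk r c 0 D) = f (r, D)) →
      ∀ {W Q : Matrix (Unit ⊕ κ) (Unit ⊕ κ) ℝ} {τ : ℝ} {u : κ → ℝ} {L : Matrix κ κ ℝ},
      Q.transpose * Q = 1 → Q * W = blk τ u 0 L →
      ∫⁻ M, F (M * W) ∂mpow (gin (Unit ⊕ κ) (Unit ⊕ κ)) m =
        ∫⁻ ξ, ∫⁻ A, f (ξ * τ, A * L) ∂mpow (gin κ κ) m ∂mpow (chi (Fintype.card κ)) m := by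
  induction m with
  | zero =>
    intro F f hF hf hinv hFf W Q τ u L hQ hW
    rw [lintegral_mpow_zero (f := fun M => F (M * W)) _ (by fun_prop),
      lintegral_mpow_zero]
    · rw [lintegral_mpow_zero]
      · simp only [one_mul, ← hFf τ u L, ← hW, hinv Q W hQ]
      · fun_prop
    · refine Measurable.lintegral_prod_right' (f := fun p : ℝ × Matrix κ κ ℝ =>
        f (p.1 * τ, p.2 * L)) ?_
      fun_prop
  | succ m ih =>
    intro F f hF hf hinv hFf W Q τ u L hQ hW
    set F' : Matrix (Unit ⊕ κ) (Unit ⊕ κ) ℝ → ENNReal :=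
      fun Y => ∫⁻ X, F (X * Y) ∂gin (Unit ⊕ κ) (Unit ⊕ κ) with hF'
    set f' : ℝ × Matrix κ κ ℝ → ENNReal :=
      fun p => ∫⁻ ρ, ∫⁻ A, f (ρ * p.1, A * p.2) ∂gin κ κ ∂chi (Fintype.card κ) with hf'
    have hF'm : Measurable F' := Measurable.lintegral_prod_right'
      (f := fun p : Matrix (Unit ⊕ κ) (Unit ⊕ κ) ℝ × Matrix (Unit ⊕ κ) (Unit ⊕ κ) ℝ =>
        F (p.2 * p.1)) (by fun_prop)
    have hg3 : Measurable fun q : ((ℝ × Matrix κ κ ℝ) × ℝ) × Matrix κ κ ℝ =>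
        f (q.1.2 * q.1.1.1, q.2 * q.1.1.2) := by fun_prop
    have hf'm : Measurable f' := Measurable.lintegral_prod_right'
      (f := fun q : (ℝ × Matrix κ κ ℝ) × ℝ => ∫⁻ A, f (q.2 * q.1.1, A * q.1.2) ∂gin κ κ)
      hg3.lintegral_prod_right'
    have hinv' : ∀ Q Z : Matrix (Unit ⊕ κ) (Unit ⊕ κ) ℝ, Q.transpose * Q = 1 →
        F' (Q * Z) = F' Z := by
      intro Q Z hQ
      simp only [hF']
      rw [← lintegral_gin_mul_right hQ (F := fun X => F (X * Z)) (by fun_prop)]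
      simp only [Matrix.mul_assoc]
    have hFf' : ∀ r c D, F' (blk r c 0 D) = f' (r, D) := by
      intro r c D
      simp only [hF', hf']
      rw [lintegral_gin_eq_blk (F := fun X => F (X * blk r c 0 D)) (by fun_prop)
        (fun Q Z hQ => by simp only [Matrix.mul_assoc, hinv Q _ hQ])]
      simp [blk_zero_mul_blk_zero, hFf]
    rw [lintegral_mpow_succ' _ m (by fun_prop)]
    simp only [Matrix.mul_assoc]
    rw [show (∫⁻ y, ∫⁻ x, F (x * (y * W)) ∂gin (Unit ⊕ κ) (Unit ⊕ κ)
      ∂mpow (gin (Unit ⊕ κ) (Unit ⊕ κ)) m) = _ from ih hF'm hf'm hinv' hFf' hQ hW]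
    have hg : Measurable fun p : ℝ × Matrix κ κ ℝ => f (p.1 * τ, p.2 * L) := by fun_prop
    rw [lintegral_mpow_succ' _ m (Measurable.lintegral_prod_right' hg)]
    refine lintegral_congr fun ξ => ?_
    simp only [hf']
    rw [lintegral_lintegral_swap]
    · refine lintegral_congr fun ρ => ?_
      rw [lintegral_mpow_succ' _ m (by fun_prop)]
      simp only [mul_assoc]
    · refine Measurable.aemeasurable ?_
      exact Measurable.lintegral_prod_right' (f := fun q : (Matrix κ κ ℝ × ℝ) × Matrix κ κ ℝ =>
        f (q.1.2 * (ξ * τ), q.2 * (q.1.1 * L))) (by fun_prop)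

end Powers

section EigenArea
open Matrix
set_option linter.unusedSectionVars false

variable {κ : Type*} [Fintype κ] [DecidableEq κ]

/-- `eigMap ((a, c, D), y) = b` says that `(1, y)` is an eigenvector of `blk a c b D`. -/
def eigMap (p : (ℝ × (κ → ℝ) × (κ → κ → ℝ)) × (κ → ℝ)) : κ → ℝ :=
  (p.1.1 + p.1.2.1 ⬝ᵥ p.2) • p.2 - Matrix.of p.1.2.2 *ᵥ p.2

/-- The eigenvalue of the eigenvector `(1, y)`. -/
def eigVal (p : (ℝ × (κ → ℝ) × (κ → κ → ℝ)) × (κ → ℝ)) : ℝ := p.1.1 + p.1.2.1 ⬝ᵥ p.2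

/-- The deflated matrix after removing the eigenvector `(1, y)`. -/
def deflated (p : (ℝ × (κ → ℝ) × (κ → κ → ℝ)) × (κ → ℝ)) : Matrix κ κ ℝ :=
  Matrix.of p.1.2.2 - vecMulVec p.2 p.1.2.1

lemma eigMap_apply (p : (ℝ × (κ → ℝ) × (κ → κ → ℝ)) × (κ → ℝ)) (i : κ) :
    eigMap p i = (p.1.1 + ∑ j, p.1.2.1 j * p.2 j) * p.2 i - ∑ j, p.1.2.2 i j * p.2 j := rfl

lemma contDiff_eigMap : ContDiff ℝ 1 (eigMap (κ := κ)) := by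
  rw [contDiff_pi]
  intro i
  simp only [eigMap_apply]
  fun_prop

lemma partialJac_eigMap (p : (ℝ × (κ → ℝ) × (κ → κ → ℝ)) × (κ → ℝ)) :
    partialJac eigMap p = (eigVal p • (1 : Matrix κ κ ℝ) - deflated p).det := by
  obtain ⟨w, y⟩ := p
  have h1 : HasFDerivAt (fun y : κ → ℝ => (w, y))
      (ContinuousLinearMap.inr ℝ (ℝ × (κ → ℝ) × (κ → κ → ℝ)) (κ → ℝ)) y :=
    hasFDerivAt_prodMk_right w y
  have h2 := ((contDiff_eigMap (κ := κ)).differentiable one_ne_zero (w, y)).hasFDerivAt.comp y h1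
  let ℓ : (κ → ℝ) →L[ℝ] ℝ :=
    LinearMap.toContinuousLinearMap (dotProductBilin ℝ ℝ w.2.1)
  let T : (κ → ℝ) →L[ℝ] (κ → ℝ) :=
    LinearMap.toContinuousLinearMap (Matrix.toLin' (Matrix.of w.2.2))
  have h3 := ((ℓ.hasFDerivAt (x := y)).const_add w.1 |>.smul (hasFDerivAt_id y)).sub
    (T.hasFDerivAt (x := y))
  have h4 := h2.unique (f := fun y : κ → ℝ => eigMap (w, y)) h3
  rw [partialJac, h4, ContinuousLinearMap.det, ← LinearMap.det_toLin']
  congr 1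
  refine LinearMap.ext fun v => ?_
  ext i
  simp [ℓ, T, eigVal, deflated, Matrix.vecMulVec_mulVec]
  ring

/-- The coordinates of a matrix used by `eigMap`. -/
def matCoords (Z : Matrix (Unit ⊕ κ) (Unit ⊕ κ) ℝ) :
    (ℝ × (κ → ℝ) × (κ → κ → ℝ)) × (κ → ℝ) :=
  ((Z (Sum.inl ()) (Sum.inl ()), fun j => Z (Sum.inl ()) (Sum.inr j),
    fun i j => Z (Sum.inr i) (Sum.inr j)), fun i => Z (Sum.inr i) (Sum.inl ()))

lemma matCoords_blk (a : ℝ) (c b : κ → ℝ) (D : Matrix κ κ ℝ) :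
    matCoords (blk a c b D) = ((a, c, (matOf κ κ).symm D), b) := rfl

lemma measurable_matCoords : Measurable (matCoords (κ := κ)) := by
  unfold matCoords
  refine Measurable.prodMk (Measurable.prodMk (measurable_matrix_apply _ _)
    (Measurable.prodMk ?_ ?_)) ?_
  · exact measurable_pi_lambda _ fun j => measurable_matrix_apply _ _
  · exact measurable_pi_lambda _ fun i => measurable_pi_lambda _ fun j =>
      measurable_matrix_apply _ _
  · exact measurable_pi_lambda _ fun j => measurable_matrix_apply _ _

/-- The sum of `h (l, B)` over the nondegenerate eigenvectors `(1, y)` of `Z`, where `l` is the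
eigenvalue and `B` the deflated matrix. -/
noncomputable def eigSum (h : ℝ × Matrix κ κ ℝ → ENNReal) (Z : Matrix (Unit ⊕ κ) (Unit ⊕ κ) ℝ) :
    ENNReal :=
  regularSum eigMap (fun p => h (eigVal p, deflated p)) (matCoords Z)

lemma measurable_eigVal : Measurable (eigVal (κ := κ)) := by
  have : Continuous (eigVal (κ := κ)) := by
    unfold eigVal dotProduct
    fun_prop
  exact this.measurable

lemma measurable_deflated : Measurable (deflated (κ := κ)) := by
  refine measurable_matrix_iff.2 fun i j => ?_
  simp only [deflated, Matrix.sub_apply, Matrix.of_apply, vecMulVec_apply]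
  fun_prop

lemma measurable_eigSum {h : ℝ × Matrix κ κ ℝ → ENNReal} (hh : Measurable h) :
    Measurable (eigSum h) :=
  (regularSum_measurable_and_lintegral contDiff_eigMap
    (g := fun p => h (eigVal p, deflated p))
    (hh.comp (measurable_eigVal.prodMk measurable_deflated)) volume).1.comp measurable_matCoords

lemma lintegral_volume_add {ι : Type*} [Fintype ι] (C : Matrix ι κ ℝ)
    {F : Matrix ι κ ℝ → ENNReal} (hF : Measurable F) :
    ∫⁻ D, F (D + C) ∂matMeasure volume ι κ = ∫⁻ D, F D ∂matMeasure volume ι κ := by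
  have hC : Measurable fun D : Matrix ι κ ℝ => F (D + C) :=
    hF.comp (continuous_id.add continuous_const).measurable
  rw [matMeasure, lintegral_map hF (matOf ι κ).measurable, lintegral_map hC (matOf ι κ).measurable]
  exact lintegral_add_right_eq_self (μ := Measure.pi fun _ : ι => Measure.pi fun _ : κ =>
    (volume : Measure ℝ)) (fun D : ι → κ → ℝ => F (matOf ι κ D)) (fun i j => C i j)

lemma lintegral_triple {α β γ : Type*} [MeasurableSpace α] [MeasurableSpace β] [MeasurableSpace γ]
    (μ : Measure α) (ν : Measure β) (ρ : Measure γ) [SFinite ν] [SFinite ρ]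
    {F : α × β × γ → ENNReal} (hF : Measurable F) :
    ∫⁻ p, F p ∂μ.prod (ν.prod ρ) = ∫⁻ a, ∫⁻ b, ∫⁻ c, F (a, b, c) ∂ρ ∂ν ∂μ := by
  rw [lintegral_prod _ hF.aemeasurable]
  refine lintegral_congr fun a => ?_
  have h : Measurable fun q : β × γ => F (a, q) := hF.comp measurable_prodMk_left
  rw [lintegral_prod _ h.aemeasurable]

lemma lintegral_rotate {α β γ δ : Type*} [MeasurableSpace α] [MeasurableSpace β]
    [MeasurableSpace γ] [MeasurableSpace δ] (μ : Measure α) (ν : Measure β) (ρ : Measure γ)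
    (σ : Measure δ) [SFinite μ] [SFinite ν] [SFinite ρ] [SFinite σ]
    {F : (α × β × γ) × δ → ENNReal} (hF : Measurable F) :
    ∫⁻ a, ∫⁻ b, ∫⁻ c, ∫⁻ y, F ((a, b, c), y) ∂σ ∂ρ ∂ν ∂μ =
      ∫⁻ y, ∫⁻ a, ∫⁻ b, ∫⁻ c, F ((a, b, c), y) ∂ρ ∂ν ∂μ ∂σ := by
  rw [← lintegral_triple μ ν ρ (F := fun q => ∫⁻ y, F (q, y) ∂σ) hF.lintegral_prod_right',
    lintegral_lintegral_swap (f := fun q y => F (q, y)) hF.aemeasurable]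
  exact lintegral_congr fun y => lintegral_triple μ ν ρ (F := fun q => F (q, y))
    (hF.comp (measurable_id.prodMk measurable_const))

/-- The shear with first column `(1, y)`. -/
def shear (y : κ → ℝ) : Matrix (Unit ⊕ κ) (Unit ⊕ κ) ℝ := blk 1 0 y 1

lemma shear_conj (y c : κ → ℝ) (l : ℝ) (B : Matrix κ κ ℝ) :
    shear y * blk l c 0 B * shear (-y) =
      blk (l - c ⬝ᵥ y) c (eigMap ((l - c ⬝ᵥ y, c, (matOf κ κ).symm (B + vecMulVec y c)), y))
        (B + vecMulVec y c) := by
  rw [shear, shear, blk_mul_blk, blk_mul_blk]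
  congr 1
  · simp [sub_eq_add_neg]
  · simp
  · ext i
    simp only [eigMap, Matrix.add_mulVec, Matrix.mulVec_neg, vecMulVec_mulVec, Pi.add_apply,
      Pi.smul_apply, Pi.neg_apply, Pi.sub_apply, smul_eq_mul]
    simp [mulVec, dotProduct, Matrix.one_apply, add_mul, Finset.sum_add_distrib, vecMulVec_apply,
      Finset.mul_sum, mul_assoc]
    ring
  · simp [add_comm]

/-- The eigenvector area formula. -/
theorem lintegral_eigSum {h : ℝ × Matrix κ κ ℝ → ENNReal} (hh : Measurable h)
    {f : Matrix (Unit ⊕ κ) (Unit ⊕ κ) ℝ → ENNReal} (hf : Measurable f) :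
    ∫⁻ Z, f Z * eigSum h Z ∂matMeasure volume (Unit ⊕ κ) (Unit ⊕ κ) =
      ∫⁻ y : κ → ℝ, ∫⁻ l, ∫⁻ c : κ → ℝ, ∫⁻ B, (ENNReal.ofReal |(l • (1 : Matrix κ κ ℝ) - B).det| *
        h (l, B)) * f (shear y * blk l c 0 B * shear (-y)) ∂matMeasure volume κ κ := by
  set ν := matMeasure volume κ κ with hν
  set Φ : (ℝ × (κ → ℝ) × (κ → κ → ℝ)) × (κ → ℝ) → ENNReal := fun p =>
    ENNReal.ofReal |partialJac eigMap p| * (h (eigVal p, deflated p) *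
      f (blk p.1.1 p.1.2.1 (eigMap p) (matOf κ κ p.1.2.2))) with hΦ
  have hg0 : Measurable fun p : (ℝ × (κ → ℝ) × (κ → κ → ℝ)) × (κ → ℝ) =>
      h (eigVal p, deflated p) := hh.comp (measurable_eigVal.prodMk measurable_deflated)
  have hg1 : Measurable fun p : (ℝ × (κ → ℝ) × (κ → κ → ℝ)) × (κ → ℝ) =>
      h (eigVal p, deflated p) * f (blk p.1.1 p.1.2.1 (eigMap p) (matOf κ κ p.1.2.2)) := by
    refine hg0.mul (hf.comp (Measurable.blk ?_ ?_ ?_ ?_))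
    · fun_prop
    · fun_prop
    · exact contDiff_eigMap.continuous.measurable
    · exact (matOf κ κ).measurable.comp (by fun_prop)
  have hΦm : Measurable Φ :=
    (continuous_partialJac contDiff_eigMap).measurable.abs.ennreal_ofReal.mul hg1
  have hΦ' : ∀ p, Φ p = ENNReal.ofReal |partialJac eigMap p| * (h (eigVal p, deflated p) *
      f (blk p.1.1 p.1.2.1 (eigMap p) (matOf κ κ p.1.2.2))) := fun _ => rfl
  clear_value Φ
  have hD : Measurable fun q : (ℝ × (κ → ℝ) × Matrix κ κ ℝ) × (κ → ℝ) =>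
      (matOf κ κ).symm q.1.2.2 := (matOf κ κ).symm.measurable.comp (by fun_prop)
  have hKm : Measurable fun q : (ℝ × (κ → ℝ) × Matrix κ κ ℝ) × (κ → ℝ) =>
      Φ ((q.1.1, q.1.2.1, (matOf κ κ).symm q.1.2.2), q.2) :=
    hΦm.comp (Measurable.prodMk (Measurable.prodMk (by fun_prop)
      (Measurable.prodMk (by fun_prop) hD)) (by fun_prop))
  have step1 : ∫⁻ Z, f Z * eigSum h Z ∂matMeasure volume (Unit ⊕ κ) (Unit ⊕ κ) =
      ∫⁻ a : ℝ, ∫⁻ c : κ → ℝ, (∫⁻ D, (∫⁻ y : κ → ℝ, Φ ((a, c, (matOf κ κ).symm D), y)) ∂ν) := by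
    rw [lintegral_blk (F := fun Z => f Z * eigSum h Z) _ (hf.mul (measurable_eigSum hh))]
    refine lintegral_congr fun a => lintegral_congr fun c => ?_
    rw [lintegral_lintegral_swap]
    · refine lintegral_congr fun D => ?_
      have h1 := (regularSum_measurable_and_lintegral contDiff_eigMap hg1 volume).2
        (a, c, (matOf κ κ).symm D)
      rw [← volume_pi]
      simp_rw [hΦ']
      refine Eq.trans (lintegral_congr fun b => ?_) h1
      rw [eigSum, matCoords_blk, regularSum, regularSum, ← ENNReal.tsum_mul_left]
      refine tsum_congr fun y => ?_
      rw [mul_comm, show eigMap ((a, c, (matOf κ κ).symm D), y.1) = b from y.2.1]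
      rfl
    · have := hf.mul (measurable_eigSum hh)
      exact (this.comp (Measurable.blk measurable_const measurable_const measurable_fst
        measurable_snd)).aemeasurable
  have hK2 : ∀ y, Measurable fun q : ℝ × (κ → ℝ) × Matrix κ κ ℝ =>
      Φ ((q.1, q.2.1, (matOf κ κ).symm q.2.2), y) := fun y =>
    hKm.comp (measurable_id.prodMk measurable_const)
  have step2 : ∫⁻ a : ℝ, ∫⁻ c : κ → ℝ, (∫⁻ D, (∫⁻ y : κ → ℝ, Φ ((a, c, (matOf κ κ).symm D), y)) ∂ν) =
      ∫⁻ y : κ → ℝ, ∫⁻ a : ℝ, ∫⁻ c : κ → ℝ, ∫⁻ D, Φ ((a, c, (matOf κ κ).symm D), y) ∂ν := by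
    exact lintegral_rotate volume volume ν volume hKm
  rw [step1, step2]
  refine lintegral_congr fun y => ?_
  have hK3 : Measurable fun q : ℝ × (κ → ℝ) => ∫⁻ D, Φ ((q.1, q.2, (matOf κ κ).symm D), y) ∂ν := by
    have : Measurable fun r : (ℝ × (κ → ℝ)) × Matrix κ κ ℝ =>
        Φ ((r.1.1, r.1.2, (matOf κ κ).symm r.2), y) :=
      (hK2 y).comp (by fun_prop : Measurable fun r : (ℝ × (κ → ℝ)) × Matrix κ κ ℝ =>
        (r.1.1, r.1.2, r.2))
    exact this.lintegral_prod_right'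
  have hdot : Measurable fun c : κ → ℝ => c ⬝ᵥ y := by
    unfold dotProduct
    fun_prop
  have hK4 : Measurable fun q : (κ → ℝ) × ℝ =>
      ∫⁻ D, Φ ((q.2 - q.1 ⬝ᵥ y, q.1, (matOf κ κ).symm D), y) ∂ν :=
    hK3.comp ((measurable_snd.sub (hdot.comp measurable_fst)).prodMk measurable_fst)
  rw [lintegral_lintegral_swap hK3.aemeasurable]
  have step3 : ∀ c : κ → ℝ, ∫⁻ a : ℝ, ∫⁻ D, Φ ((a, c, (matOf κ κ).symm D), y) ∂ν =
      ∫⁻ l : ℝ, ∫⁻ D, Φ ((l - c ⬝ᵥ y, c, (matOf κ κ).symm D), y) ∂ν := fun c =>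
    (lintegral_sub_right_eq_self
      (fun a : ℝ => ∫⁻ D, Φ ((a, c, (matOf κ κ).symm D), y) ∂ν) (c ⬝ᵥ y)).symm
  rw [lintegral_congr step3, lintegral_lintegral_swap hK4.aemeasurable]
  refine lintegral_congr fun l => lintegral_congr fun c => ?_
  have hK5 : Measurable fun D : Matrix κ κ ℝ => Φ ((l - c ⬝ᵥ y, c, (matOf κ κ).symm D), y) :=
    (hK2 y).comp (by fun_prop : Measurable fun D : Matrix κ κ ℝ => (l - c ⬝ᵥ y, c, D))
  rw [hν, ← lintegral_volume_add (vecMulVec y c) hK5]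
  refine lintegral_congr fun B => ?_
  rw [shear_conj]
  have e1 : eigVal ((l - c ⬝ᵥ y, c, (matOf κ κ).symm (B + vecMulVec y c)), y) = l := by
    simp [eigVal]
  have e2 : deflated ((l - c ⬝ᵥ y, c, (matOf κ κ).symm (B + vecMulVec y c)), y) = B := by
    ext i j
    simp [deflated]
  rw [hΦ', partialJac_eigMap, e1, e2, mul_assoc]
  rfl

end EigenArea

section NullSets
open Matrix
set_option linter.unusedSectionVars false

variable {ι κ : Type*} [Fintype ι] [DecidableEq ι] [Fintype κ] [DecidableEq κ]

/-- A set which meets every line in a given direction in a null set is null. -/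
lemma volume_null_of_lines (d : Matrix ι κ ℝ) {S : Set (Matrix ι κ ℝ)} (hS : MeasurableSet S)
    (h : ∀ Z, volume {t : ℝ | Z + t • d ∈ S} = 0) : matMeasure volume ι κ S = 0 := by
  have hm : Measurable fun p : Matrix ι κ ℝ × ℝ => p.1 + p.2 • d :=
    (continuous_fst.add (continuous_snd.smul continuous_const)).measurable
  have hI : Measurable (S.indicator (1 : Matrix ι κ ℝ → ENNReal)) := measurable_one.indicator hS
  have h1 : ∫⁻ Z, ∫⁻ t, S.indicator 1 (Z + t • d) ∂gaussianReal 0 1 ∂matMeasure volume ι κ = 0 := by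
    have h0 : Measurable fun Z => ∫⁻ t : ℝ, S.indicator (1 : Matrix ι κ ℝ → ENNReal)
      (Z + t • d) ∂gaussianReal 0 1 := (hI.comp hm).lintegral_prod_right'
    rw [lintegral_eq_zero_iff h0]
    refine Eventually.of_forall fun Z => ?_
    have h2 : MeasurableSet {t : ℝ | Z + t • d ∈ S} :=
      (hm.comp (measurable_prodMk_left (x := Z))) hS
    have h3 : (fun t : ℝ => S.indicator (1 : Matrix ι κ ℝ → ENNReal) (Z + t • d)) =
        {t : ℝ | Z + t • d ∈ S}.indicator 1 := rfl
    simp only [Pi.zero_apply]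
    rw [h3, lintegral_indicator_one h2]
    exact gaussianReal_absolutelyContinuous 0 one_ne_zero (h Z)
  rw [lintegral_lintegral_swap (f := fun Z (t : ℝ) => S.indicator (1 : Matrix ι κ ℝ → ENNReal)
    (Z + t • d)) (hI.comp hm).aemeasurable] at h1
  simp_rw [lintegral_volume_add _ hI, lintegral_indicator_one hS] at h1
  simpa using h1

lemma gin_null {S : Set (Matrix ι κ ℝ)} (h : matMeasure volume ι κ S = 0) : gin ι κ S = 0 := by
  obtain ⟨T, hST, hT, hT0⟩ := exists_measurable_superset_of_null h
  refine measure_mono_null hST ?_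
  have h0 : Measurable fun Z => gdens Z * T.indicator 1 Z :=
    measurable_gdens.mul (measurable_one.indicator hT)
  rw [← lintegral_indicator_one hT, lintegral_gin (measurable_one.indicator hT),
    lintegral_eq_zero_iff h0]
  have : ∀ᵐ Z ∂matMeasure volume ι κ, Z ∉ T := measure_eq_zero_iff_ae_notMem.1 hT0
  filter_upwards [this] with Z hZ
  simp [hZ]

lemma volume_mul_right_null {M : Matrix κ κ ℝ} (hM : M.det ≠ 0) {S : Set (Matrix ι κ ℝ)}
    (h : matMeasure volume ι κ S = 0) : matMeasure volume ι κ {X | X * M ∈ S} = 0 := by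
  obtain ⟨T, hST, hT, hT0⟩ := exists_measurable_superset_of_null h
  have hsub : {X | X * M ∈ S} ⊆ {X : Matrix ι κ ℝ | X * M ∈ T} := fun X hX => hST hX
  refine measure_mono_null hsub ?_
  have hm : MeasurableSet {X : Matrix ι κ ℝ | X * M ∈ T} := measurable_matrix_mul_const M hT
  have hI : Measurable (T.indicator (1 : Matrix ι κ ℝ → ENNReal)) := measurable_one.indicator hT
  have h2 := lintegral_volume_mul_right hM hI
  rw [lintegral_indicator_one hT, hT0, mul_zero] at h2
  rw [← lintegral_indicator_one hm]
  exact h2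

lemma volume_det_eq_zero : matMeasure volume ι ι {Z | Z.det = 0} = 0 := by
  refine volume_null_of_lines 1 ?_ fun Z => ?_
  · exact (continuous_id.matrix_det.measurable) (measurableSet_singleton 0)
  · refine Set.Finite.measure_zero ?_ _
    refine Set.Finite.subset ((-Z).charpoly.roots.toFinset.finite_toSet) fun t ht => ?_
    have ht' : (Z + t • (1 : Matrix ι ι ℝ)).det = 0 := ht
    simp only [Finset.mem_coe, Multiset.mem_toFinset]
    rw [Polynomial.mem_roots (Matrix.charpoly_monic _).ne_zero, Polynomial.IsRoot,
      Matrix.eval_charpoly, ← ht', sub_neg_eq_add, add_comm, Matrix.smul_one_eq_diagonal]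
    rfl

lemma ae_mpow_succ {M : Type*} [Monoid M] [MeasurableSpace M] [MeasurableMul₂ M] {μ : Measure M}
    [IsProbabilityMeasure μ] {m : ℕ} {q : M → Prop} {S : Set M} (hq : ∀ᵐ y ∂mpow μ m, q y)
    (hS : MeasurableSet S) (h : ∀ y, q y → μ {x | x * y ∈ S} = 0) : mpow μ (m + 1) S = 0 := by
  have hI : Measurable (S.indicator (1 : M → ENNReal)) := measurable_one.indicator hS
  rw [← lintegral_indicator_one hS, lintegral_mpow_succ' _ _ hI,
    lintegral_eq_zero_iff]
  · filter_upwards [hq] with y hy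
    have h2 : MeasurableSet {x | x * y ∈ S} := (measurable_mul_const y) hS
    exact (lintegral_indicator_one h2).trans (h y hy)
  · exact Measurable.lintegral_prod_right' (f := fun p : M × M => S.indicator 1 (p.2 * p.1))
      (by fun_prop)

lemma ae_mpow_of_mul {M : Type*} [Monoid M] [MeasurableSpace M] [MeasurableMul₂ M] {μ : Measure M}
    [IsProbabilityMeasure μ] {q : M → Prop} (hqm : MeasurableSet {x | q x}) (h1 : q 1)
    (hmul : ∀ x y, q x → q y → q (x * y)) (hμ : ∀ᵐ x ∂μ, q x) (m : ℕ) : ∀ᵐ x ∂mpow μ m, q x := by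
  induction m with
  | zero => rw [mpow, ae_dirac_iff hqm]; exact h1
  | succ m ih =>
    refine ae_mpow_succ ih hqm.compl fun y hy => measure_eq_zero_iff_ae_notMem.2 ?_
    filter_upwards [hμ] with x hx h
    exact h (hmul x y hx hy)

lemma measurableSet_det_ne_zero : MeasurableSet {Z : Matrix ι ι ℝ | Z.det ≠ 0} :=
  (continuous_id.matrix_det.measurable) (measurableSet_singleton 0).compl

lemma ae_det_ne_zero (m : ℕ) : ∀ᵐ Z ∂mpow (gin ι ι) m, Z.det ≠ 0 := by
  refine ae_mpow_of_mul measurableSet_det_ne_zero (by simp) ?_ ?_ m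
  · intro x y hx hy
    rw [Matrix.det_mul]
    exact mul_ne_zero hx hy
  · have := gin_null (volume_det_eq_zero (ι := ι))
    filter_upwards [measure_eq_zero_iff_ae_notMem.1 this] with Z hZ using hZ

/-- Lebesgue-null sets of matrices are null for products of Gaussian matrices. -/
lemma mpow_gin_null {S : Set (Matrix ι ι ℝ)} (h : matMeasure volume ι ι S = 0) (m : ℕ) :
    mpow (gin ι ι) (m + 1) S = 0 := by
  obtain ⟨T, hST, hT, hT0⟩ := exists_measurable_superset_of_null h
  refine measure_mono_null hST ?_
  exact ae_mpow_succ (ae_det_ne_zero m) hT fun M hM => gin_null (volume_mul_right_null hM hT0)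

lemma ae_chi_pos (s : ℕ) : ∀ᵐ r ∂chi s, 0 < r := by
  have h : ∀ᵐ r ∂(volume.restrict (Set.Ioi (0 : ℝ))), 0 < r :=
    (ae_restrict_mem measurableSet_Ioi)
  exact Measure.ae_smul_measure ((withDensity_absolutelyContinuous _ _).ae_le h) _

lemma ae_mpow_chi_pos (s m : ℕ) : ∀ᵐ r ∂mpow (chi s) m, 0 < r :=
  ae_mpow_of_mul measurableSet_Ioi one_pos (fun _ _ => mul_pos) (ae_chi_pos s) m

end NullSets

section Deflation
open Matrix
set_option linter.unusedSectionVars false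

variable {κ : Type*} [Fintype κ] [DecidableEq κ]

lemma lintegral_vecMul_gaussianPDF {M : Matrix κ κ ℝ} (hM : M.det ≠ 0) (e : κ → ℝ) :
    ∫⁻ c : κ → ℝ, ∏ j, gaussianPDF 0 1 ((c ᵥ* M + e) j) = ENNReal.ofReal (|M.det|⁻¹) := by
  have hM' : (M.transpose).det ≠ 0 := by rwa [Matrix.det_transpose]
  have hp : Measurable fun x : κ → ℝ => ∏ j, gaussianPDF 0 1 (x j) :=
    Finset.measurable_prod _ fun j _ => (measurable_gaussianPDF 0 1).comp (measurable_pi_apply j)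
  have hpe : Measurable fun x : κ → ℝ => ∏ j, gaussianPDF 0 1 ((x + e) j) :=
    hp.comp (measurable_add_const e)
  have h1 := Real.map_matrix_volume_pi_eq_smul_volume_pi hM'
  have hm : Measurable (toLin' M.transpose) :=
    (LinearMap.continuous_on_pi _).measurable
  have h2 : ∫⁻ c : κ → ℝ, ∏ j, gaussianPDF 0 1 ((c ᵥ* M + e) j) =
      ∫⁻ x, ∏ j, gaussianPDF 0 1 ((x + e) j) ∂(volume.map (toLin' M.transpose)) := by
    rw [lintegral_map hpe hm]
    simp only [toLin'_apply, mulVec_transpose]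
  have h3 : ∫⁻ x : κ → ℝ, ∏ j, gaussianPDF 0 1 (x j) = 1 := by
    have := measure_univ (μ := Measure.pi fun _ : κ => gaussianReal 0 1)
    rwa [pi_gaussian_eq_withDensity, withDensity_apply _ MeasurableSet.univ,
      setLIntegral_univ] at this
  rw [h2, h1, lintegral_smul_measure, lintegral_add_right_eq_self
    (fun x : κ → ℝ => ∏ j, gaussianPDF 0 1 (x j)) e, h3, Matrix.det_transpose, abs_inv]
  simp

lemma gdens_blk_zero (a : ℝ) (c : κ → ℝ) (D : Matrix κ κ ℝ) :
    gdens (blk a c 0 D) = gaussianPDF 0 1 a * (∏ j, gaussianPDF 0 1 (c j)) *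
      (ENNReal.ofReal ((√(2 * Real.pi))⁻¹ ^ Fintype.card κ) * gdens D) := by
  have h0 : gaussianPDF 0 1 0 = ENNReal.ofReal ((√(2 * Real.pi))⁻¹) := by
    simp [gaussianPDF, gaussianPDFReal]
  simp only [gdens, Fintype.prod_sum_type, blk_inl_inl, blk_inl_inr, blk_inr_inl, blk_inr_inr,
    Finset.univ_unique, Finset.prod_singleton, Pi.zero_apply, h0, Finset.prod_mul_distrib,
    Finset.prod_const, Finset.card_univ, Finset.card_singleton, pow_one]
  rw [ENNReal.ofReal_pow (by positivity)]
  ring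

lemma inv_blk_zero {a : ℝ} (ha : a ≠ 0) (c : κ → ℝ) {D : Matrix κ κ ℝ} (hD : D.det ≠ 0) :
    (blk a c 0 D)⁻¹ = blk a⁻¹ (-(a⁻¹ • (c ᵥ* D⁻¹))) 0 D⁻¹ := by
  refine Matrix.inv_eq_right_inv ?_
  rw [blk_zero_mul_blk_zero, Matrix.mul_nonsing_inv _ (Ne.isUnit hD), mul_inv_cancel₀ ha]
  rw [smul_neg, smul_smul, mul_inv_cancel₀ ha, one_smul, neg_add_cancel]
  ext (i | i) (j | j) <;> simp [Matrix.one_apply]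


lemma lintegral_conj_volume {g : Matrix κ κ ℝ → ENNReal} (hg : Measurable g)
    {L L' : Matrix κ κ ℝ} (hL : L.det ≠ 0) (hL' : L'.det ≠ 0) :
    ∫⁻ B, g B * gdens (L * (B * L'⁻¹)) ∂matMeasure volume κ κ =
      ENNReal.ofReal (|L'.det| ^ Fintype.card κ * |L.det|⁻¹ ^ Fintype.card κ) *
        ∫⁻ A, g (L⁻¹ * A * L') ∂gin κ κ := by
  have hdi : (L'⁻¹).det = (L'.det)⁻¹ := by
    rw [Matrix.det_nonsing_inv, Ring.inverse_eq_inv']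
  have hdi0 : (L'⁻¹).det ≠ 0 := by rw [hdi]; exact inv_ne_zero hL'
  have hLL : L⁻¹ * L = 1 := Matrix.nonsing_inv_mul _ (Ne.isUnit hL)
  have hLL' : L'⁻¹ * L' = 1 := Matrix.nonsing_inv_mul _ (Ne.isUnit hL')
  have hF : Measurable fun A : Matrix κ κ ℝ => g (L⁻¹ * A * L') := by
    have : Measurable fun A : Matrix κ κ ℝ => L⁻¹ * A * L' := by fun_prop
    exact hg.comp this
  have hF2 : Measurable fun A : Matrix κ κ ℝ => gdens A * g (L⁻¹ * A * L') :=
    measurable_gdens.mul hF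
  have hF3 : Measurable fun A : Matrix κ κ ℝ => gdens (L * A) * g (L⁻¹ * (L * A) * L') :=
    hF2.comp (measurable_const_matrix_mul L)
  have e1 := lintegral_volume_mul_left hL hF2
  have e2 := lintegral_volume_mul_right hdi0 hF3
  rw [hdi, abs_inv, inv_inv, e1] at e2
  rw [lintegral_gin hF, ENNReal.ofReal_mul (by positivity), mul_assoc,
    ENNReal.ofReal_pow (by positivity), ENNReal.ofReal_pow (by positivity), ← e2]
  refine lintegral_congr fun B => ?_
  have : L⁻¹ * (L * (B * L'⁻¹)) * L' = B := by
    rw [← Matrix.mul_assoc L⁻¹, hLL, Matrix.one_mul, Matrix.mul_assoc, hLL', Matrix.mul_one]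
  rw [this, mul_comm]

lemma lintegral_gaussianPDF_mul {J : ℝ → ENNReal} (hJ : Measurable J) {ρ ρ' : ℝ} (hρ : ρ ≠ 0)
    (hρ' : ρ' ≠ 0) :
    ∫⁻ l, gaussianPDF 0 1 (ρ * ρ'⁻¹ * l) * J l =
      ENNReal.ofReal (|ρ * ρ'⁻¹|⁻¹) * ∫⁻ x, J (x * (ρ' / ρ)) ∂gaussianReal 0 1 := by
  have hJm : Measurable fun x : ℝ => J (x * (ρ' / ρ)) := by fun_prop
  rw [gaussianReal_of_var_ne_zero 0 one_ne_zero,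
    lintegral_withDensity_eq_lintegral_mul _ (measurable_gaussianPDF 0 1) hJm,
    ← lintegral_comp_mul_real (mul_ne_zero hρ (inv_ne_zero hρ'))
    ((measurable_gaussianPDF 0 1).mul hJm)]
  refine lintegral_congr fun l => ?_
  have : ρ * ρ'⁻¹ * l * (ρ' / ρ) = l := by field_simp
  simp only [Pi.mul_apply, this]

lemma blk_conj_eq (ρ : ℝ) {ρ' : ℝ} (hρ' : ρ' ≠ 0) (u u' : κ → ℝ) (L : Matrix κ κ ℝ)
    {L' : Matrix κ κ ℝ} (hL' : L'.det ≠ 0) (l : ℝ) (B : Matrix κ κ ℝ) :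
    ∃ e : κ → ℝ, ∀ c : κ → ℝ, blk ρ u 0 L * blk l c 0 B * (blk ρ' u' 0 L')⁻¹ =
      blk (ρ * ρ'⁻¹ * l) (c ᵥ* (ρ • L'⁻¹) + e) 0 (L * (B * L'⁻¹)) := by
  refine ⟨(u ᵥ* B) ᵥ* L'⁻¹ + (ρ * l) • -(ρ'⁻¹ • (u' ᵥ* L'⁻¹)), fun c => ?_⟩
  rw [inv_blk_zero hρ' u' hL', blk_zero_mul_blk_zero, blk_zero_mul_blk_zero]
  congr 1
  · ring
  · rw [add_vecMul, smul_vecMul, vecMul_smul]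
    abel
  · rw [Matrix.mul_assoc]

lemma lintegral_blk_conj_inner {g : Matrix κ κ ℝ → ENNReal} (hg : Measurable g)
    {ρ ρ' : ℝ} (hρ : ρ ≠ 0) (hρ' : ρ' ≠ 0) (u u' : κ → ℝ) (L : Matrix κ κ ℝ) {L' : Matrix κ κ ℝ}
    (hL' : L'.det ≠ 0) (l : ℝ) :
    ∫⁻ c : κ → ℝ, ∫⁻ B, g B * gdens (blk ρ u 0 L * blk l c 0 B * (blk ρ' u' 0 L')⁻¹)
        ∂matMeasure volume κ κ =
      ENNReal.ofReal ((√(2 * Real.pi))⁻¹ ^ Fintype.card κ) *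
        ENNReal.ofReal (|(ρ • L'⁻¹).det|⁻¹) * (gaussianPDF 0 1 (ρ * ρ'⁻¹ * l) *
        ∫⁻ B, g B * gdens (L * (B * L'⁻¹)) ∂matMeasure volume κ κ) := by
  have hdM : (ρ • L'⁻¹).det ≠ 0 := by
    rw [Matrix.det_smul, Matrix.det_nonsing_inv, Ring.inverse_eq_inv']
    exact mul_ne_zero (pow_ne_zero _ hρ) (inv_ne_zero hL')
  have hm0 : Measurable fun B : Matrix κ κ ℝ => gdens (L * (B * L'⁻¹)) := by
    have : Measurable fun B : Matrix κ κ ℝ => L * (B * L'⁻¹) := by fun_prop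
    exact measurable_gdens.comp this
  have hinvm : Measurable fun q : (κ → ℝ) × Matrix κ κ ℝ =>
      g q.2 * gdens (blk ρ u 0 L * blk l q.1 0 q.2 * (blk ρ' u' 0 L')⁻¹) := by
    have h1 : Measurable fun q : (κ → ℝ) × Matrix κ κ ℝ => blk l q.1 0 q.2 :=
      Measurable.blk (by fun_prop) (by fun_prop) (by fun_prop) (by fun_prop)
    have h2 : Measurable fun q : (κ → ℝ) × Matrix κ κ ℝ =>
      blk ρ u 0 L * blk l q.1 0 q.2 * (blk ρ' u' 0 L')⁻¹ := by fun_prop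
    exact (hg.comp measurable_snd).mul (measurable_gdens.comp h2)
  have hinner : ∀ B, ∫⁻ c : κ → ℝ, g B *
      gdens (blk ρ u 0 L * blk l c 0 B * (blk ρ' u' 0 L')⁻¹) =
      ENNReal.ofReal ((√(2 * Real.pi))⁻¹ ^ Fintype.card κ) *
      ENNReal.ofReal (|(ρ • L'⁻¹).det|⁻¹) * gaussianPDF 0 1 (ρ * ρ'⁻¹ * l) *
      (g B * gdens (L * (B * L'⁻¹))) := by
    intro B
    obtain ⟨e, he⟩ := blk_conj_eq ρ hρ' u u' L hL' l B
    have hm1 : Measurable fun c : κ → ℝ => ∏ j, gaussianPDF 0 1 ((c ᵥ* (ρ • L'⁻¹) + e) j) := by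
      refine Finset.measurable_prod _ fun j _ => (measurable_gaussianPDF 0 1).comp ?_
      simp only [Pi.add_apply, vecMul, dotProduct]
      fun_prop
    rw [← lintegral_vecMul_gaussianPDF hdM e, mul_assoc, mul_assoc, mul_left_comm,
      ← lintegral_mul_const _ hm1]
    refine lintegral_congr fun c => ?_
    rw [he, gdens_blk_zero]
    ring
  rw [lintegral_lintegral_swap hinvm.aemeasurable, lintegral_congr hinner,
    lintegral_const_mul _ (f := fun B => g B * gdens (L * (B * L'⁻¹))) (hg.mul hm0)]
  ring

/-- The deflation integral in triangular coordinates. -/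
lemma lintegral_blk_conj {G : ℝ × Matrix κ κ ℝ → ENNReal} (hG : Measurable G)
    {ρ ρ' : ℝ} (hρ : ρ ≠ 0) (hρ' : ρ' ≠ 0) (u u' : κ → ℝ) {L L' : Matrix κ κ ℝ}
    (hL : L.det ≠ 0) (hL' : L'.det ≠ 0) :
    ∫⁻ l, ∫⁻ c : κ → ℝ, ∫⁻ B, G (l, B) * gdens (blk ρ u 0 L * blk l c 0 B * (blk ρ' u' 0 L')⁻¹)
        ∂matMeasure volume κ κ =
      ENNReal.ofReal ((√(2 * Real.pi))⁻¹ ^ Fintype.card κ * (|ρ|⁻¹ ^ (Fintype.card κ + 1) * |ρ'| *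
        |L.det|⁻¹ ^ Fintype.card κ * |L'.det| ^ (Fintype.card κ + 1))) *
      ∫⁻ x, ∫⁻ A, G (x * (ρ' / ρ), L⁻¹ * A * L') ∂gin κ κ ∂gaussianReal 0 1 := by
  have hGB : ∀ l, Measurable fun B => G (l, B) := fun l => hG.comp measurable_prodMk_left
  have hJ0 : Measurable fun l : ℝ => ∫⁻ A, G (l, L⁻¹ * A * L') ∂gin κ κ := by
    refine Measurable.lintegral_prod_right' (f := fun q : ℝ × Matrix κ κ ℝ =>
      G (q.1, L⁻¹ * q.2 * L')) ?_
    fun_prop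
  have hJ1 : Measurable fun l : ℝ => gaussianPDF 0 1 (ρ * ρ'⁻¹ * l) *
      ∫⁻ A, G (l, L⁻¹ * A * L') ∂gin κ κ :=
    ((measurable_gaussianPDF 0 1).comp (measurable_const_mul _)).mul hJ0
  have hcomm : ∀ l, ∫⁻ c : κ → ℝ, ∫⁻ B, G (l, B) *
      gdens (blk ρ u 0 L * blk l c 0 B * (blk ρ' u' 0 L')⁻¹) ∂matMeasure volume κ κ =
      ENNReal.ofReal ((√(2 * Real.pi))⁻¹ ^ Fintype.card κ) *
        ENNReal.ofReal (|(ρ • L'⁻¹).det|⁻¹) *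
        ENNReal.ofReal (|L'.det| ^ Fintype.card κ * |L.det|⁻¹ ^ Fintype.card κ) *
      (gaussianPDF 0 1 (ρ * ρ'⁻¹ * l) * ∫⁻ A, G (l, L⁻¹ * A * L') ∂gin κ κ) := fun l => by
    rw [lintegral_blk_conj_inner (hGB l) hρ hρ' u u' L hL' l,
      lintegral_conj_volume (hGB l) hL hL']
    ring
  rw [lintegral_congr hcomm, lintegral_const_mul _ hJ1, lintegral_gaussianPDF_mul hJ0 hρ hρ',
    ← mul_assoc, ← ENNReal.ofReal_mul (by positivity), ← ENNReal.ofReal_mul (by positivity),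
    ← ENNReal.ofReal_mul (by positivity)]
  congr 2
  rw [Matrix.det_smul, Matrix.det_nonsing_inv, Ring.inverse_eq_inv', abs_mul, abs_mul, abs_pow,
    abs_inv, abs_inv]
  simp only [inv_pow, pow_succ]
  have h1 : |ρ| ≠ 0 := abs_ne_zero.2 hρ
  have h2 : |ρ'| ≠ 0 := abs_ne_zero.2 hρ'
  have h3 : |L.det| ≠ 0 := abs_ne_zero.2 hL
  have h4 : |L'.det| ≠ 0 := abs_ne_zero.2 hL'
  field_simp

end Deflation

section DeflationFormula
open Matrix
set_option linter.unusedSectionVars false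

variable {κ : Type*} [Fintype κ] [DecidableEq κ]

lemma measurable_matrix_inv {ι : Type*} [Fintype ι] [DecidableEq ι] :
    Measurable fun Z : Matrix ι ι ℝ => Z⁻¹ := by
  have h : ∀ Z : Matrix ι ι ℝ, Z⁻¹ = (Z.det)⁻¹ • Z.adjugate := fun Z => by
    rw [Matrix.inv_def, Ring.inverse_eq_inv']
  simp only [h]
  have hd : Measurable fun Z : Matrix ι ι ℝ => Z.det := (continuous_id.matrix_det).measurable
  have ha : Measurable fun Z : Matrix ι ι ℝ => Z.adjugate :=
    (continuous_id.matrix_adjugate).measurable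
  refine measurable_matrix_iff.2 fun i j => ?_
  exact hd.inv.mul ((measurable_matrix_apply i j).comp ha)

lemma shear_mul_shear_neg (y : κ → ℝ) : shear y * shear (-y) = 1 := by
  rw [shear, shear, blk_mul_blk]
  ext (i | i) (j | j) <;> simp [Matrix.one_apply]

lemma det_shear (y : κ → ℝ) : (shear y).det = 1 := by
  rw [shear, blk, Matrix.det_fromBlocks_one₂₂]
  simp [Matrix.det_unique]

lemma measurable_shear : Measurable (shear (κ := κ)) :=
  Measurable.blk measurable_const measurable_const measurable_id measurable_const

/-- The orthogonal-triangular factorization of a shear. -/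
lemma exists_orthogonal_mul_shear (y : κ → ℝ) :
    ∃ (Q : Matrix (Unit ⊕ κ) (Unit ⊕ κ) ℝ) (u : κ → ℝ) (L : Matrix κ κ ℝ), Q.transpose * Q = 1 ∧
      Q * shear y = blk (√(1 + y ⬝ᵥ y)) u 0 L ∧ |√(1 + y ⬝ᵥ y) * L.det| = 1 := by
  obtain ⟨Q, hQ, hv⟩ := exists_orthogonal_mulVec_eq (Sum.elim (fun _ : Unit => (1 : ℝ)) y)
    (Sum.inl ())
  have hn : Sum.elim (fun _ : Unit => (1 : ℝ)) y ⬝ᵥ Sum.elim (fun _ : Unit => (1 : ℝ)) y =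
      1 + y ⬝ᵥ y := by
    simp [dotProduct]
  rw [hn] at hv
  have hcol : ∀ i, (Q * shear y) i (Sum.inl ()) =
      (Pi.single (Sum.inl ()) (√(1 + y ⬝ᵥ y)) : Unit ⊕ κ → ℝ) i := by
    intro i
    rw [← hv, Matrix.mul_apply, mulVec, dotProduct]
    refine Finset.sum_congr rfl fun j _ => ?_
    rcases j with j | j <;> simp [shear]
  have hb : Q * shear y = blk (√(1 + y ⬝ᵥ y)) (fun j => (Q * shear y) (Sum.inl ()) (Sum.inr j)) 0
      (Matrix.of fun i j => (Q * shear y) (Sum.inr i) (Sum.inr j)) := by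
    ext (i | i) (j | j)
    · rw [hcol]; simp
    · simp
    · rw [hcol]; simp
    · simp
  refine ⟨Q, _, _, hQ, hb, ?_⟩
  rw [← det_blk_zero, ← hb, Matrix.det_mul, det_shear, mul_one]
  exact abs_det_of_orthogonal hQ


/-- The change-of-variables integrand of the deflation formula. -/
noncomputable def deflTerm (G : ℝ × Matrix κ κ ℝ → ENNReal)
    (U V : Matrix (Unit ⊕ κ) (Unit ⊕ κ) ℝ) : ENNReal :=
  ENNReal.ofReal (|V.det|⁻¹) ^ (Fintype.card κ + 1) *
    ∫⁻ l, ∫⁻ c : κ → ℝ, ∫⁻ B, G (l, B) * gdens (U * blk l c 0 B * V⁻¹) ∂matMeasure volume κ κ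

lemma measurable_deflTerm {G : ℝ × Matrix κ κ ℝ → ENNReal} (hG : Measurable G) :
    Measurable fun p : Matrix (Unit ⊕ κ) (Unit ⊕ κ) ℝ × Matrix (Unit ⊕ κ) (Unit ⊕ κ) ℝ =>
      deflTerm G p.1 p.2 := by
  have hd : Measurable fun p : Matrix (Unit ⊕ κ) (Unit ⊕ κ) ℝ × Matrix (Unit ⊕ κ) (Unit ⊕ κ) ℝ =>
      p.2.det := (continuous_id.matrix_det).measurable.comp measurable_snd
  have h1 : Measurable fun q : (((Matrix (Unit ⊕ κ) (Unit ⊕ κ) ℝ ×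
      Matrix (Unit ⊕ κ) (Unit ⊕ κ) ℝ) × ℝ) × (κ → ℝ)) × Matrix κ κ ℝ =>
      blk q.1.1.2 q.1.2 0 q.2 :=
    Measurable.blk (by fun_prop) (by fun_prop) (by fun_prop) (by fun_prop)
  have h2 : Measurable fun q : (((Matrix (Unit ⊕ κ) (Unit ⊕ κ) ℝ ×
      Matrix (Unit ⊕ κ) (Unit ⊕ κ) ℝ) × ℝ) × (κ → ℝ)) × Matrix κ κ ℝ =>
      (q.1.1.1.2)⁻¹ := measurable_matrix_inv.comp (by fun_prop)
  have h3 : Measurable fun q : (((Matrix (Unit ⊕ κ) (Unit ⊕ κ) ℝ ×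
      Matrix (Unit ⊕ κ) (Unit ⊕ κ) ℝ) × ℝ) × (κ → ℝ)) × Matrix κ κ ℝ =>
      q.1.1.1.1 * blk q.1.1.2 q.1.2 0 q.2 * (q.1.1.1.2)⁻¹ := by fun_prop
  have h4 : Measurable fun q : (((Matrix (Unit ⊕ κ) (Unit ⊕ κ) ℝ ×
      Matrix (Unit ⊕ κ) (Unit ⊕ κ) ℝ) × ℝ) × (κ → ℝ)) × Matrix κ κ ℝ =>
      G (q.1.1.2, q.2) * gdens (q.1.1.1.1 * blk q.1.1.2 q.1.2 0 q.2 * (q.1.1.1.2)⁻¹) :=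
    (hG.comp (by fun_prop)).mul (measurable_gdens.comp h3)
  have h5 := (h4.lintegral_prod_right' (ν := matMeasure volume κ κ)).lintegral_prod_right'
    (ν := (volume : Measure (κ → ℝ)))
  have h6 := h5.lintegral_prod_right' (ν := (volume : Measure ℝ))
  have h7 : Measurable fun p : Matrix (Unit ⊕ κ) (Unit ⊕ κ) ℝ × Matrix (Unit ⊕ κ) (Unit ⊕ κ) ℝ =>
      ENNReal.ofReal (|p.2.det|⁻¹) ^ (Fintype.card κ + 1) := by fun_prop
  exact h7.mul h6

lemma measurable_deflTerm_right {G : ℝ × Matrix κ κ ℝ → ENNReal} (hG : Measurable G)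
    (U : Matrix (Unit ⊕ κ) (Unit ⊕ κ) ℝ) : Measurable fun V => deflTerm G U V := by
  have h : Measurable fun V : Matrix (Unit ⊕ κ) (Unit ⊕ κ) ℝ => (U, V) := by fun_prop
  have h2 := (measurable_deflTerm hG).comp h
  exact h2

lemma deflTerm_mul_left {G : ℝ × Matrix κ κ ℝ → ENNReal}
    {Q : Matrix (Unit ⊕ κ) (Unit ⊕ κ) ℝ} (hQ : Q.transpose * Q = 1)
    (U V : Matrix (Unit ⊕ κ) (Unit ⊕ κ) ℝ) : deflTerm G (Q * U) V = deflTerm G U V := by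
  simp only [deflTerm, Matrix.mul_assoc Q, gdens_mul_left hQ]

lemma deflTerm_mul_right {G : ℝ × Matrix κ κ ℝ → ENNReal}
    {Q : Matrix (Unit ⊕ κ) (Unit ⊕ κ) ℝ} (hQ : Q.transpose * Q = 1)
    (U V : Matrix (Unit ⊕ κ) (Unit ⊕ κ) ℝ) : deflTerm G U (Q * V) = deflTerm G U V := by
  have hi : Q⁻¹ = Q.transpose := Matrix.inv_eq_left_inv hQ
  have hQ' : Q.transpose.transpose * Q.transpose = 1 := by
    rw [Matrix.transpose_transpose]
    exact mul_eq_one_comm.1 hQ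
  simp only [deflTerm, Matrix.mul_inv_rev, hi, ← Matrix.mul_assoc, gdens_mul_right hQ',
    Matrix.det_mul, abs_mul, abs_det_of_orthogonal hQ, one_mul]

lemma deflTerm_blk {G : ℝ × Matrix κ κ ℝ → ENNReal} (hG : Measurable G)
    {ρ ρ' : ℝ} (hρ : ρ ≠ 0) (hρ' : ρ' ≠ 0) (u u' : κ → ℝ) {L L' : Matrix κ κ ℝ}
    (hL : L.det ≠ 0) (hL' : L'.det ≠ 0) :
    deflTerm G (blk ρ u 0 L) (blk ρ' u' 0 L') =
      ENNReal.ofReal ((√(2 * Real.pi))⁻¹ ^ Fintype.card κ * (|ρ|⁻¹ ^ (Fintype.card κ + 1) *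
        |ρ'|⁻¹ ^ Fintype.card κ * |L.det|⁻¹ ^ Fintype.card κ)) *
      ∫⁻ x, ∫⁻ A, G (x * (ρ' / ρ), L⁻¹ * A * L') ∂gin κ κ ∂gaussianReal 0 1 := by
  rw [deflTerm, lintegral_blk_conj hG hρ hρ' u u' hL hL', ← mul_assoc,
    ← ENNReal.ofReal_pow (by positivity), ← ENNReal.ofReal_mul (by positivity), det_blk_zero,
    abs_mul]
  congr 2
  have h1 : |ρ| ≠ 0 := abs_ne_zero.2 hρ
  have h2 : |ρ'| ≠ 0 := abs_ne_zero.2 hρ'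
  have h3 : |L.det| ≠ 0 := abs_ne_zero.2 hL
  have h4 : |L'.det| ≠ 0 := abs_ne_zero.2 hL'
  simp only [mul_inv, mul_pow, inv_pow, pow_succ]
  field_simp

lemma deflTerm_eq_zero {G : ℝ × Matrix κ κ ℝ → ENNReal}
    (U : Matrix (Unit ⊕ κ) (Unit ⊕ κ) ℝ) {V : Matrix (Unit ⊕ κ) (Unit ⊕ κ) ℝ} (hV : V.det = 0) :
    deflTerm G U V = 0 := by
  simp [deflTerm, hV]

lemma deflTerm_blk_indep {G : ℝ × Matrix κ κ ℝ → ENNReal} (hG : Measurable G)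
    {ρ : ℝ} (hρ : ρ ≠ 0) (u : κ → ℝ) {L : Matrix κ κ ℝ} (hL : L.det ≠ 0) (r : ℝ) (c : κ → ℝ)
    (D : Matrix κ κ ℝ) :
    deflTerm G (blk ρ u 0 L) (blk r c 0 D) = deflTerm G (blk ρ u 0 L) (blk r 0 0 D) := by
  by_cases h : r * D.det = 0
  · rw [deflTerm_eq_zero _ (by rw [det_blk_zero, h]), deflTerm_eq_zero _ (by rw [det_blk_zero, h])]
  · rw [deflTerm_blk hG hρ (left_ne_zero_of_mul h) u c hL (right_ne_zero_of_mul h),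
      deflTerm_blk hG hρ (left_ne_zero_of_mul h) u 0 hL (right_ne_zero_of_mul h)]

lemma lintegral_deflTerm_reduce {G : ℝ × Matrix κ κ ℝ → ENNReal} (hG : Measurable G) (m : ℕ)
    {ρ : ℝ} (hρ : ρ ≠ 0) {u : κ → ℝ} {L : Matrix κ κ ℝ} (hL : L.det ≠ 0)
    {Q W : Matrix (Unit ⊕ κ) (Unit ⊕ κ) ℝ} (hQ : Q.transpose * Q = 1)
    (hW : Q * W = blk ρ u 0 L) :
    ∫⁻ M, deflTerm G W (M * W) ∂mpow (gin (Unit ⊕ κ) (Unit ⊕ κ)) m =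
      ∫⁻ ξ, ∫⁻ A, deflTerm G (blk ρ u 0 L) (blk (ξ * ρ) 0 0 (A * L)) ∂mpow (gin κ κ) m
        ∂mpow (chi (Fintype.card κ)) m := by
  have hF := measurable_deflTerm_right hG (blk ρ u 0 L)
  have hbm : Measurable fun p : ℝ × Matrix κ κ ℝ => blk p.1 0 0 p.2 :=
    Measurable.blk (by fun_prop) (by fun_prop) (by fun_prop) (by fun_prop)
  have hf : Measurable fun p : ℝ × Matrix κ κ ℝ =>
    deflTerm G (blk ρ u 0 L) (blk p.1 0 0 p.2) := hF.comp hbm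
  have hU : ∀ V, deflTerm G W V = deflTerm G (blk ρ u 0 L) V := fun V => by
    rw [← hW, deflTerm_mul_left hQ]
  simp only [hU]
  exact lintegral_mpow_gin_blk m hF hf (fun Q Z hQ => deflTerm_mul_right hQ _ _)
    (deflTerm_blk_indep hG hρ u hL) hQ hW

lemma lintegral_gaussian_mpow_succ {G : ℝ × Matrix κ κ ℝ → ENNReal} (hG : Measurable G) (m : ℕ)
    (ξ : ℝ) :
    ∫⁻ A, ∫⁻ x, ∫⁻ A', G (x * ξ, A' * A) ∂gin κ κ ∂gaussianReal 0 1 ∂mpow (gin κ κ) m =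
      ∫⁻ x, ∫⁻ A, G (x * ξ, A) ∂mpow (gin κ κ) (m + 1) ∂gaussianReal 0 1 := by
  have hm : Measurable fun q : (Matrix κ κ ℝ × ℝ) × Matrix κ κ ℝ => G (q.1.2 * ξ, q.2 * q.1.1) := by
    fun_prop
  rw [lintegral_lintegral_swap (hm.lintegral_prod_right').aemeasurable]
  refine lintegral_congr fun x => ?_
  rw [lintegral_mpow_succ' _ m (f := fun A => G (x * ξ, A)) (by fun_prop)]

/-- Averaging the deflation integrand at a fixed eigenvector. -/
lemma lintegral_deflTerm_shear {G : ℝ × Matrix κ κ ℝ → ENNReal} (hG : Measurable G)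
    (hconj : ∀ l (L B : Matrix κ κ ℝ), L.det ≠ 0 → G (l, L⁻¹ * B * L) = G (l, B)) (m : ℕ)
    (y : κ → ℝ) :
    ∫⁻ M, deflTerm G (shear y) (M * shear y) ∂mpow (gin (Unit ⊕ κ) (Unit ⊕ κ)) m =
      ENNReal.ofReal ((√(1 + y ⬝ᵥ y))⁻¹ ^ (Fintype.card κ + 1)) *
      ∫⁻ ξ, ENNReal.ofReal ((√(2 * Real.pi))⁻¹ ^ Fintype.card κ * ξ⁻¹ ^ Fintype.card κ) *
        ∫⁻ x, ∫⁻ A, G (x * ξ, A) ∂mpow (gin κ κ) (m + 1) ∂gaussianReal 0 1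
        ∂mpow (chi (Fintype.card κ)) m := by
  obtain ⟨Q, u, L, hQ, hW, hdet⟩ := exists_orthogonal_mul_shear y
  have hyy : 0 ≤ y ⬝ᵥ y := Finset.sum_nonneg fun i _ => mul_self_nonneg _
  have hρ : 0 < √(1 + y ⬝ᵥ y) := by positivity
  generalize √(1 + y ⬝ᵥ y) = ρ at *
  have hLd : L.det ≠ 0 := by
    intro h0
    simp [h0] at hdet
  have hρL : ρ * |L.det| = 1 := by rwa [abs_mul, abs_of_pos hρ] at hdet
  have hm1 : Measurable fun q : (ℝ × ℝ) × Matrix κ κ ℝ => G (q.1.2 * q.1.1, q.2) := by fun_prop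
  have hm2 := (hm1.lintegral_prod_right' (ν := mpow (gin κ κ) (m + 1))).lintegral_prod_right'
    (ν := gaussianReal 0 1)
  have hm3 : Measurable fun ξ : ℝ => ENNReal.ofReal ((√(2 * Real.pi))⁻¹ ^ Fintype.card κ *
    ξ⁻¹ ^ Fintype.card κ) := by fun_prop
  rw [lintegral_deflTerm_reduce hG m hρ.ne' hLd hQ hW,
    ← lintegral_const_mul _ (f := fun ξ : ℝ => ENNReal.ofReal ((√(2 * Real.pi))⁻¹ ^ Fintype.card κ *
      ξ⁻¹ ^ Fintype.card κ) * ∫⁻ x, ∫⁻ A, G (x * ξ, A) ∂mpow (gin κ κ) (m + 1)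
      ∂gaussianReal 0 1) (hm3.mul hm2)]
  refine lintegral_congr_ae ?_
  filter_upwards [ae_mpow_chi_pos (Fintype.card κ) m] with ξ hξ
  have hm4 : Measurable fun q : (Matrix κ κ ℝ × ℝ) × Matrix κ κ ℝ =>
    G (q.1.2 * ξ, q.2 * q.1.1) := by fun_prop
  rw [← lintegral_gaussian_mpow_succ hG m ξ, ← mul_assoc,
    ← ENNReal.ofReal_mul (by positivity),
    ← lintegral_const_mul _ (f := fun A => ∫⁻ x, ∫⁻ A', G (x * ξ, A' * A) ∂gin κ κ
      ∂gaussianReal 0 1) hm4.lintegral_prod_right'.lintegral_prod_right']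
  refine lintegral_congr_ae ?_
  filter_upwards [ae_det_ne_zero (ι := κ) m] with A hA
  rw [deflTerm_blk hG hρ.ne' (mul_pos hξ hρ).ne' u 0 hLd
    (by rw [Matrix.det_mul]; exact mul_ne_zero hA hLd)]
  congr 1
  · congr 1
    have h1 : |L.det| = ρ⁻¹ := by field_simp; linarith
    rw [abs_of_pos hρ, abs_of_pos (mul_pos hξ hρ), h1]
    simp only [mul_inv, mul_pow, inv_pow, inv_inv]
    have := hρ.ne'
    have := hξ.ne'
    field_simp
  · refine lintegral_congr fun x => lintegral_congr fun A' => ?_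
    rw [mul_div_cancel_right₀ _ hρ.ne', ← hconj _ L (A' * A) hLd]
    simp only [Matrix.mul_assoc]

lemma lintegral_eigSum_mul {h : ℝ × Matrix κ κ ℝ → ENNReal} (hh : Measurable h)
    {M : Matrix (Unit ⊕ κ) (Unit ⊕ κ) ℝ} (hM : M.det ≠ 0) :
    ∫⁻ X, eigSum h (X * M) ∂gin (Unit ⊕ κ) (Unit ⊕ κ) =
      ∫⁻ y : κ → ℝ, deflTerm (fun p : ℝ × Matrix κ κ ℝ =>
        ENNReal.ofReal |(p.1 • (1 : Matrix κ κ ℝ) - p.2).det| * h p) (shear y) (M * shear y) := by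
  have hMi : M * M⁻¹ = 1 := Matrix.mul_nonsing_inv _ (Ne.isUnit hM)
  have hE := measurable_eigSum hh
  have hgM : Measurable fun Z : Matrix (Unit ⊕ κ) (Unit ⊕ κ) ℝ => gdens (Z * M⁻¹) := by
    have h1 : Measurable fun Z : Matrix (Unit ⊕ κ) (Unit ⊕ κ) ℝ => Z * M⁻¹ := by fun_prop
    exact measurable_gdens.comp h1
  have hEM : Measurable fun Z : Matrix (Unit ⊕ κ) (Unit ⊕ κ) ℝ => eigSum h (Z * M) := by
    have h1 : Measurable fun Z : Matrix (Unit ⊕ κ) (Unit ⊕ κ) ℝ => Z * M := by fun_prop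
    exact hE.comp h1
  have hF : Measurable fun Z : Matrix (Unit ⊕ κ) (Unit ⊕ κ) ℝ => gdens (Z * M⁻¹) * eigSum h Z :=
    hgM.mul hE
  have e1 := lintegral_volume_mul_right hM hF
  simp only [Matrix.mul_assoc, hMi, Matrix.mul_one] at e1
  rw [lintegral_gin hEM, e1, lintegral_eigSum hh hgM, ← lintegral_const_mul']
  swap
  · exact ENNReal.pow_ne_top ENNReal.ofReal_ne_top
  refine lintegral_congr fun y => ?_
  have hinv : (M * shear y)⁻¹ = shear (-y) * M⁻¹ := by
    rw [Matrix.mul_inv_rev]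
    congr 1
    exact Matrix.inv_eq_right_inv (shear_mul_shear_neg y)
  rw [deflTerm, hinv, Matrix.det_mul, det_shear, mul_one]
  simp only [Fintype.card_sum, Fintype.card_unit, add_comm 1, Matrix.mul_assoc]

lemma lintegral_eigSum_mpow_aux {h : ℝ × Matrix κ κ ℝ → ENNReal} (hh : Measurable h)
    (hconj : ∀ l (L B : Matrix κ κ ℝ), L.det ≠ 0 → h (l, L⁻¹ * B * L) = h (l, B)) (m : ℕ) :
    ∫⁻ P, eigSum h P ∂mpow (gin (Unit ⊕ κ) (Unit ⊕ κ)) (m + 1) =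
      chartMass κ *
      ∫⁻ ξ, ENNReal.ofReal ((√(2 * Real.pi))⁻¹ ^ Fintype.card κ * ξ⁻¹ ^ Fintype.card κ) *
        ∫⁻ x, ∫⁻ A, ENNReal.ofReal |((x * ξ) • (1 : Matrix κ κ ℝ) - A).det| * h (x * ξ, A)
          ∂mpow (gin κ κ) (m + 1) ∂gaussianReal 0 1 ∂mpow (chi (Fintype.card κ)) m := by
  set G : ℝ × Matrix κ κ ℝ → ENNReal := fun p =>
    ENNReal.ofReal |(p.1 • (1 : Matrix κ κ ℝ) - p.2).det| * h p with hGdef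
  have hG : Measurable G := by
    have hd : Measurable fun p : ℝ × Matrix κ κ ℝ => (p.1 • (1 : Matrix κ κ ℝ) - p.2).det := by
      have : Continuous fun p : ℝ × Matrix κ κ ℝ => (p.1 • (1 : Matrix κ κ ℝ) - p.2).det := by
        fun_prop
      exact this.measurable
    exact (hd.abs.ennreal_ofReal).mul hh
  have hGc : ∀ l (L B : Matrix κ κ ℝ), L.det ≠ 0 → G (l, L⁻¹ * B * L) = G (l, B) := by
    intro l L B hL
    have hLL : L⁻¹ * L = 1 := Matrix.nonsing_inv_mul _ (Ne.isUnit hL)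
    have e : l • (1 : Matrix κ κ ℝ) - L⁻¹ * B * L = L⁻¹ * (l • (1 : Matrix κ κ ℝ) - B) * L := by
      rw [Matrix.mul_sub, Matrix.sub_mul]
      simp [hLL]
    simp only [hGdef, hconj l L B hL, e, Matrix.det_mul]
    rw [mul_right_comm, ← Matrix.det_mul, hLL, Matrix.det_one, one_mul]
  have hGe : ∀ l A, ENNReal.ofReal |(l • (1 : Matrix κ κ ℝ) - A).det| * h (l, A) = G (l, A) :=
    fun _ _ => rfl
  have hE := measurable_eigSum hh
  have h1 : ∀ᵐ M ∂mpow (gin (Unit ⊕ κ) (Unit ⊕ κ)) m,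
      ∫⁻ X, eigSum h (X * M) ∂gin (Unit ⊕ κ) (Unit ⊕ κ) =
      ∫⁻ y : κ → ℝ, deflTerm G (shear y) (M * shear y) := by
    filter_upwards [ae_det_ne_zero m] with M hM
    exact lintegral_eigSum_mul hh hM
  clear_value G
  simp only [hGe]
  have hm : Measurable fun p : Matrix (Unit ⊕ κ) (Unit ⊕ κ) ℝ × (κ → ℝ) =>
      deflTerm G (shear p.2) (p.1 * shear p.2) := by
    have hs : Measurable fun p : Matrix (Unit ⊕ κ) (Unit ⊕ κ) ℝ × (κ → ℝ) => shear p.2 :=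
      measurable_shear.comp measurable_snd
    have hs2 : Measurable fun p : Matrix (Unit ⊕ κ) (Unit ⊕ κ) ℝ × (κ → ℝ) =>
      (shear p.2, p.1 * shear p.2) := by fun_prop
    have := (measurable_deflTerm hG).comp hs2
    exact this
  have hc : Measurable fun y : κ → ℝ =>
      ENNReal.ofReal ((√(1 + y ⬝ᵥ y))⁻¹ ^ (Fintype.card κ + 1)) := by
    simp only [dotProduct]
    fun_prop
  rw [lintegral_mpow_succ' _ m hE, lintegral_congr_ae h1, lintegral_lintegral_swap hm.aemeasurable,
    lintegral_congr fun y => lintegral_deflTerm_shear hG hGc m y, lintegral_mul_const _ hc]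
  rfl

lemma lintegral_gaussian_eq_chi (n : ℕ) {g : ℝ → ENNReal} (hg : Measurable g) {ξ : ℝ} (hξ : 0 < ξ) :
    ENNReal.ofReal (ξ⁻¹ ^ n) * ∫⁻ x, ENNReal.ofReal (|x * ξ| ^ n) * g (x * ξ) ∂gaussianReal 0 1 =
      ENNReal.ofReal ((√(2 * Real.pi))⁻¹) * chiMass n *
        ∫⁻ r, (g (r * ξ) + g (-(r * ξ))) ∂chi n := by
  have hm : Measurable fun x : ℝ => ENNReal.ofReal (|x * ξ| ^ n) * g (x * ξ) := by fun_prop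
  have hm2 : Measurable fun x : ℝ => ENNReal.ofReal ((√(2 * Real.pi))⁻¹ * Real.exp (-x ^ 2 / 2)) *
    (ENNReal.ofReal (|x * ξ| ^ n) * g (x * ξ)) := by fun_prop
  have hm3 : Measurable fun r : ℝ => g (r * ξ) + g (-(r * ξ)) := by fun_prop
  rw [lintegral_gaussian hm, lintegral_eq_Ioi_add hm2, lintegral_chi n hm3, ← mul_assoc, mul_assoc _ (chiMass n),
    ENNReal.mul_inv_cancel (chiMass_ne n).1 (chiMass_ne n).2, mul_one,
    ← lintegral_const_mul' _ _ ENNReal.ofReal_ne_top, ← lintegral_const_mul' _ _ ENNReal.ofReal_ne_top]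
  refine setLIntegral_congr_fun measurableSet_Ioi fun x hx => ?_
  have hx : 0 < x := hx
  have e : ξ⁻¹ ^ n * ((√(2 * Real.pi))⁻¹ * Real.exp (-x ^ 2 / 2) * |x * ξ| ^ n) =
      (√(2 * Real.pi))⁻¹ * chiWeight n x := by
    rw [abs_mul, abs_of_pos hξ, mul_pow, chiWeight, inv_pow]
    have := hξ.ne'
    field_simp
  simp only [neg_mul, abs_neg, neg_sq]
  rw [← mul_add, ← mul_add, ← mul_assoc, ← mul_assoc, ← mul_assoc,
    ← ENNReal.ofReal_mul (by positivity), ← ENNReal.ofReal_mul (by positivity),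
    ← ENNReal.ofReal_mul (by positivity)]
  congr 2
  rw [← e]; ring

/-- The mean of the statistic `eigSum h` of a product of Gaussian matrices. -/
theorem two_mul_lintegral_eigSum_mpow {h : ℝ × Matrix κ κ ℝ → ENNReal} (hh : Measurable h)
    (hconj : ∀ l (L B : Matrix κ κ ℝ), L.det ≠ 0 → h (l, L⁻¹ * B * L) = h (l, B)) (m : ℕ)
    {g : ℝ → ENNReal} (hg : Measurable g)
    (hgh : ∀ l : ℝ, l ≠ 0 → g l = ∫⁻ A, ENNReal.ofReal |((1 : Matrix κ κ ℝ) - l⁻¹ • A).det| * h (l, A)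
      ∂mpow (gin κ κ) (m + 1)) :
    2 * ∫⁻ P, eigSum h P ∂mpow (gin (Unit ⊕ κ) (Unit ⊕ κ)) (m + 1) =
      ∫⁻ r, (g r + g (-r)) ∂mpow (chi (Fintype.card κ)) (m + 1) := by
  set n := Fintype.card κ with hn
  have hm3 : Measurable fun r : ℝ => g r + g (-r) := by fun_prop
  have key : ∀ l : ℝ, l ≠ 0 →
      ∫⁻ A, ENNReal.ofReal |(l • (1 : Matrix κ κ ℝ) - A).det| * h (l, A)
        ∂mpow (gin κ κ) (m + 1) = ENNReal.ofReal (|l| ^ n) * g l := by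
    intro l hl
    rw [hgh l hl, ← lintegral_const_mul' _ _ ENNReal.ofReal_ne_top]
    refine lintegral_congr fun A => ?_
    rw [← mul_assoc, ← ENNReal.ofReal_mul (by positivity)]
    congr 2
    have : l • (1 : Matrix κ κ ℝ) - A = l • (1 - l⁻¹ • A) := by
      rw [smul_sub, smul_smul, mul_inv_cancel₀ hl, one_smul]
    rw [this, Matrix.det_smul, abs_mul, abs_pow]
  have hmc : chartMass κ * (ENNReal.ofReal ((√(2 * Real.pi))⁻¹ ^ n) *
      (ENNReal.ofReal ((√(2 * Real.pi))⁻¹) * chiMass n)) * 2 = 1 := by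
    rw [← chartMass_mul_chiMass (κ := κ), ← hn, pow_succ, ENNReal.ofReal_mul (by positivity)]
    ring
  rw [lintegral_eigSum_mpow_aux hh hconj m, lintegral_mpow_succ' _ m hm3]
  have hfin : ∀ᵐ ξ ∂mpow (chi n) m, ENNReal.ofReal ((√(2 * Real.pi))⁻¹ ^ n * ξ⁻¹ ^ n) *
        ∫⁻ x, ∫⁻ A, ENNReal.ofReal |((x * ξ) • (1 : Matrix κ κ ℝ) - A).det| * h (x * ξ, A)
          ∂mpow (gin κ κ) (m + 1) ∂gaussianReal 0 1 =
      ENNReal.ofReal ((√(2 * Real.pi))⁻¹ ^ n) * (ENNReal.ofReal ((√(2 * Real.pi))⁻¹) * chiMass n) *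
        ∫⁻ r, (g (r * ξ) + g (-(r * ξ))) ∂chi n := by
    filter_upwards [ae_mpow_chi_pos n m] with ξ hξ
    rw [ENNReal.ofReal_mul (by positivity), mul_assoc, mul_assoc,
      ← lintegral_gaussian_eq_chi n hg hξ]
    congr 2
    refine lintegral_congr_ae ?_
    have hx0 : ∀ᵐ x ∂gaussianReal 0 1, x ≠ 0 := by
      have : NullSingletonClass (gaussianReal 0 1) := nullSingletonClass_gaussianReal one_ne_zero
      exact (measure_eq_zero_iff_ae_notMem.1 (measure_singleton (0 : ℝ)))
    filter_upwards [hx0] with x hx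
    exact key _ (mul_ne_zero hx hξ.ne')
  have hm4 : Measurable fun q : ℝ × ℝ => g (q.2 * q.1) + g (-(q.2 * q.1)) := by fun_prop
  rw [lintegral_congr_ae hfin, lintegral_const_mul _ hm4.lintegral_prod_right', ← mul_assoc,
    ← mul_assoc, mul_assoc 2 (chartMass κ), mul_comm 2, hmc, one_mul]

end DeflationFormula

section Generic
open Matrix
set_option linter.unusedSectionVars false

variable {κ : Type*} [Fintype κ] [DecidableEq κ]

section Krylov

variable {ι : Type*} [Fintype ι] [DecidableEq ι] {n : ℕ}

/-- The Krylov matrix whose rows are the `i₀`-th rows of the powers of `Z`. -/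
def krylov {R : Type*} [CommRing R] (e : ι → ℕ) (i₀ : ι) (Z : Matrix ι ι R) : Matrix ι ι R :=
  Matrix.of fun i j => (Z ^ e i) i₀ j

lemma det_krylov_map {R S : Type*} [CommRing R] [CommRing S] (f : R →+* S) (e : ι → ℕ) (i₀ : ι)
    (Z : Matrix ι ι R) : (krylov e i₀ (f.mapMatrix Z)).det = f (krylov e i₀ Z).det := by
  rw [RingHom.map_det]
  congr 1
  ext i j
  simp only [krylov, of_apply, RingHom.mapMatrix_apply, Matrix.map_apply]
  rw [← RingHom.mapMatrix_apply, ← map_pow]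
  rfl

lemma det_krylov_smul (e : ι → ℕ) (i₀ : ι) (t : ℝ) (Z : Matrix ι ι ℝ) :
    (krylov e i₀ (t • Z)).det = (∏ i, t ^ e i) * (krylov e i₀ Z).det := by
  rw [← Matrix.det_diagonal, ← Matrix.det_mul]
  congr 1
  ext i j
  simp [krylov, smul_pow]

/-- The shift along an enumeration of the index set. -/
def shift (e : ι ≃ Fin n) : Matrix ι ι ℝ :=
  Matrix.of fun i j => if (e j : ℕ) = e i + 1 then 1 else 0

lemma shift_apply (e : ι ≃ Fin n) (i j : ι) :
    shift e i j = if (e j : ℕ) = e i + 1 then 1 else 0 := rfl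

lemma shift_pow_apply (e : ι ≃ Fin n) {i₀ : ι} (h0 : (e i₀ : ℕ) = 0) (k : ℕ) (j : ι) :
    (shift e ^ k) i₀ j = if (e j : ℕ) = k then 1 else 0 := by
  induction k generalizing j with
  | zero =>
    rw [pow_zero, Matrix.one_apply]
    refine if_congr ?_ rfl rfl
    rw [← h0, ← Fin.ext_iff, e.injective.eq_iff, eq_comm]
  | succ k ih =>
    rw [pow_succ, Matrix.mul_apply]
    simp only [ih, shift_apply]
    split_ifs with hj
    · have hk : k < n := by have := (e j).2; omega
      rw [Finset.sum_eq_single (e.symm ⟨k, hk⟩)]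
      · simp [hj]
      · intro l _ hl
        rw [if_neg, zero_mul]
        intro h
        exact hl (by rw [Equiv.eq_symm_apply]; exact Fin.ext h)
      · simp
    · refine Finset.sum_eq_zero fun l _ => ?_
      split_ifs with h1 h2
      · omega
      · simp
      · simp
      · simp

lemma det_krylov_shift (e : ι ≃ Fin n) {i₀ : ι} (h0 : (e i₀ : ℕ) = 0) :
    (krylov (fun i => (e i : ℕ)) i₀ (shift e)).det = 1 := by
  rw [← Matrix.det_one (n := ι)]
  congr 1
  ext i j
  simp only [krylov, of_apply, shift_pow_apply e h0, Matrix.one_apply]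
  refine if_congr ?_ rfl rfl
  rw [← Fin.ext_iff, e.injective.eq_iff, eq_comm]

lemma volume_krylov_eq_zero (e : ι ≃ Fin n) {i₀ : ι} (h0 : (e i₀ : ℕ) = 0) :
    matMeasure volume ι ι {Z | (krylov (fun i => (e i : ℕ)) i₀ Z).det = 0} = 0 := by
  have hc : Continuous fun Z : Matrix ι ι ℝ => (krylov (fun i => (e i : ℕ)) i₀ Z).det := by
    refine Continuous.matrix_det ?_
    refine continuous_matrix fun i j => ?_
    exact (continuous_id.pow (e i : ℕ)).matrix_elem i₀ j
  refine volume_null_of_lines (shift e) (hc.measurable (measurableSet_singleton 0)) fun Z => ?_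
  set M : Matrix ι ι (Polynomial ℝ) :=
    (shift e).map Polynomial.C + (Polynomial.X : Polynomial ℝ) • Z.map Polynomial.C with hM
  set p := (krylov (fun i => (e i : ℕ)) i₀ M).det with hp
  have hev : ∀ s, p.eval s = (krylov (fun i => (e i : ℕ)) i₀ (shift e + s • Z)).det := by
    intro s
    rw [hp, ← Polynomial.coe_evalRingHom, ← det_krylov_map]
    congr 2
    ext i j
    simp [hM]
    exact mul_comm _ _
  have hp0 : p ≠ 0 := by
    intro h
    have := hev 0
    rw [zero_smul, add_zero, det_krylov_shift e h0, h] at this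
    simp at this
  refine measure_mono_null (t := {0} ∪ (fun s : ℝ => s⁻¹) '' {s | p.IsRoot s}) ?_ ?_
  · intro t ht
    by_cases h : t = 0
    · left; exact h
    · right
      refine ⟨t⁻¹, ?_, inv_inv t⟩
      have ht : (krylov (fun i => (e i : ℕ)) i₀ (Z + t • shift e)).det = 0 := ht
      have e1 : Z + t • shift e = t • (shift e + t⁻¹ • Z) := by
        rw [smul_add, smul_smul, mul_inv_cancel₀ h, one_smul, add_comm]
      rw [e1, det_krylov_smul] at ht
      change p.eval t⁻¹ = 0
      rw [hev]
      exact (mul_eq_zero.1 ht).resolve_left (Finset.prod_ne_zero_iff.2 fun i _ => pow_ne_zero _ h)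
  · exact ((Set.finite_singleton 0).union
      ((Polynomial.finite_setOfPred_isRoot hp0).image _)).measure_zero _

lemma det_krylov_eq_zero (e : ι → ℕ) {i₀ : ι} {Z : Matrix ι ι ℝ} {l : ℝ} {v : ι → ℝ} (hv : v ≠ 0)
    (hZ : Z *ᵥ v = l • v) (h0 : v i₀ = 0) : (krylov e i₀ Z).det = 0 := by
  refine Matrix.exists_mulVec_eq_zero_iff.1 ⟨v, hv, ?_⟩
  have hp : ∀ k : ℕ, (Z ^ k) *ᵥ v = l ^ k • v := by
    intro k
    induction k with
    | zero => simp
    | succ k ih => rw [pow_succ, ← Matrix.mulVec_mulVec, hZ, Matrix.mulVec_smul, ih, smul_smul,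
        pow_succ, mul_comm]
  ext i
  have := congrFun (hp (e i)) i₀
  change (Z ^ e i *ᵥ v) i₀ = 0
  rw [this]
  simp [h0]

/-- Almost no matrix has an eigenvector with a vanishing given coordinate. -/
lemma ae_eigenvector_apply_ne_zero (i₀ : ι) : ∀ᵐ Z ∂matMeasure volume ι ι,
    ∀ (l : ℝ) (v : ι → ℝ), v ≠ 0 → Z *ᵥ v = l • v → v i₀ ≠ 0 := by
  have hpos : 0 < Fintype.card ι := Fintype.card_pos_iff.2 ⟨i₀⟩
  let e0 := Fintype.equivFin ι
  let e := e0.trans (Equiv.swap (e0 i₀) ⟨0, hpos⟩)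
  have h0 : (e i₀ : ℕ) = 0 := by simp [e]
  filter_upwards [measure_eq_zero_iff_ae_notMem.1 (volume_krylov_eq_zero e h0)] with Z hZ l v hv h hi
  exact hZ (det_krylov_eq_zero _ hv h hi)

end Krylov

section Sard

variable {W E : Type*} [NormedAddCommGroup W] [NormedSpace ℝ W] [FiniteDimensional ℝ W]
  [NormedAddCommGroup E] [NormedSpace ℝ E] [FiniteDimensional ℝ E]
  [MeasurableSpace W] [BorelSpace W] [MeasurableSpace E] [BorelSpace E]

lemma measurableSet_critical {β : W × E → E} (hβ : ContDiff ℝ 1 β) :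
    MeasurableSet {p : W × E | ∃ y, β (p.1, y) = p.2 ∧ partialJac β (p.1, y) = 0} := by
  have hcl : IsClosed {p : W × E | partialJac β p = 0} :=
    isClosed_singleton.preimage (continuous_partialJac hβ)
  have hσ : IsSigmaCompact ((fun q : W × E => (q.1, β q)) '' {p | partialJac β p = 0}) :=
    (isSigmaCompact_univ.of_isClosed_subset hcl (Set.subset_univ _)).image
      (continuous_fst.prodMk hβ.continuous)
  obtain ⟨K, hK, hU⟩ := hσ
  have : {p : W × E | ∃ y, β (p.1, y) = p.2 ∧ partialJac β (p.1, y) = 0} = ⋃ n, K n := by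
    rw [hU]
    ext ⟨w, b⟩
    constructor
    · rintro ⟨y, h1, h2⟩
      exact ⟨(w, y), h2, Prod.ext rfl h1⟩
    · rintro ⟨⟨w', y⟩, h2, h1⟩
      obtain ⟨rfl, rfl⟩ := Prod.ext_iff.1 h1
      exact ⟨y, rfl, h2⟩
  rw [this]
  exact MeasurableSet.iUnion fun n => (hK n).isClosed.measurableSet

lemma measure_critical_slice {β : W × E → E} (hβ : ContDiff ℝ 1 β) (μ : Measure E)
    [μ.IsAddHaarMeasure] (w : W) :
    μ {b | ∃ y, β (w, y) = b ∧ partialJac β (w, y) = 0} = 0 := by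
  have h := addHaar_image_eq_zero_of_det_fderivWithin_eq_zero μ (f := fun y => β (w, y))
    (s := {y | partialJac β (w, y) = 0})
    (f' := fun y => (fderiv ℝ β (w, y)).comp (ContinuousLinearMap.inr ℝ W E))
    (fun y _ => ((hβ.differentiable one_ne_zero (w, y)).hasFDerivAt.comp y
      (hasFDerivAt_prodMk_right w y)).hasFDerivWithinAt) (fun y hy => hy)
  refine measure_mono_null ?_ h
  rintro b ⟨y, h1, h2⟩
  exact ⟨y, h2, h1⟩

end Sard

/-- For almost every matrix, every eigenvector `(1, y)` is nondegenerate. -/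
lemma ae_partialJac_ne_zero : ∀ᵐ Z ∂matMeasure volume (Unit ⊕ κ) (Unit ⊕ κ),
    ∀ y, eigMap ((matCoords Z).1, y) = (matCoords Z).2 →
      partialJac eigMap ((matCoords Z).1, y) ≠ 0 := by
  set S : Set (Matrix (Unit ⊕ κ) (Unit ⊕ κ) ℝ) := matCoords ⁻¹' {p | ∃ y,
    eigMap (p.1, y) = p.2 ∧ partialJac eigMap (p.1, y) = 0} with hS
  have hSm : MeasurableSet S := (measurableSet_critical contDiff_eigMap).preimage
    measurable_matCoords
  have h0 : matMeasure volume (Unit ⊕ κ) (Unit ⊕ κ) S = 0 := by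
    have hF : Measurable (S.indicator (1 : Matrix (Unit ⊕ κ) (Unit ⊕ κ) ℝ → ENNReal)) :=
      measurable_one.indicator hSm
    rw [← lintegral_indicator_one hSm, lintegral_blk volume hF]
    refine lintegral_eq_zero_of_ae_eq_zero (ae_of_all _ fun a =>
      lintegral_eq_zero_of_ae_eq_zero (ae_of_all _ fun c => ?_))
    have hm := (hF.comp (Measurable.blk (measurable_const (a := a)) (measurable_const (a := c))
        measurable_fst measurable_snd) : Measurable _)
    beta_reduce
    rw [lintegral_lintegral_swap (f := fun b D => S.indicator 1 (blk a c b D))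
      (by exact hm.aemeasurable)]
    refine lintegral_eq_zero_of_ae_eq_zero (ae_of_all _ fun D => ?_)
    refine lintegral_eq_zero_of_ae_eq_zero ?_
    have := measure_eq_zero_iff_ae_notMem.1 (measure_critical_slice (contDiff_eigMap (κ := κ))
      volume (a, c, (matOf κ κ).symm D))
    rw [volume_pi] at this
    filter_upwards [this] with b hb
    exact Set.indicator_of_notMem (s := S) hb _
  filter_upwards [measure_eq_zero_iff_ae_notMem.1 h0] with Z hZ y hy hJ
  exact hZ ⟨y, hy, hJ⟩

end Generic

section GenericSum
open Matrix Polynomial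
set_option linter.unusedSectionVars false

variable {κ : Type*} [Fintype κ] [DecidableEq κ]

/-- All real eigenvectors of `Z` have nonzero first coordinate and are nondegenerate. -/
def IsGeneric (Z : Matrix (Unit ⊕ κ) (Unit ⊕ κ) ℝ) : Prop :=
  (∀ (l : ℝ) (v : Unit ⊕ κ → ℝ), v ≠ 0 → Z *ᵥ v = l • v → v (Sum.inl ()) ≠ 0) ∧
  ∀ y, eigMap ((matCoords Z).1, y) = (matCoords Z).2 →
    partialJac eigMap ((matCoords Z).1, y) ≠ 0

lemma ae_isGeneric (m : ℕ) :
    ∀ᵐ Z ∂mpow (gin (Unit ⊕ κ) (Unit ⊕ κ)) (m + 1), IsGeneric Z :=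
  mpow_gin_null (ae_iff.1 ((ae_eigenvector_apply_ne_zero (Sum.inl ())).and ae_partialJac_ne_zero)) m

lemma charpoly_eq_of_eigMap {Z : Matrix (Unit ⊕ κ) (Unit ⊕ κ) ℝ} {y : κ → ℝ}
    (h : eigMap ((matCoords Z).1, y) = (matCoords Z).2) :
    Z.charpoly = (X - C (eigVal ((matCoords Z).1, y))) *
      (deflated ((matCoords Z).1, y)).charpoly := by
  set l := eigVal ((matCoords Z).1, y) with hl
  set B := deflated ((matCoords Z).1, y) with hB
  set c := (matCoords Z).1.2.1 with hc
  have ha : l - c ⬝ᵥ y = (matCoords Z).1.1 := by simp [hl, eigVal, hc]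
  have hD : B + vecMulVec y c = matOf κ κ (matCoords Z).1.2.2 := by
    simp [hB, deflated, hc]
  have h1 := shear_conj y c l B
  rw [ha, hD] at h1
  have h2 : blk (matCoords Z).1.1 c (eigMap (((matCoords Z).1.1, c,
      (matOf κ κ).symm (matOf κ κ (matCoords Z).1.2.2)), y)) (matOf κ κ (matCoords Z).1.2.2) = Z := by
    have : eigMap (((matCoords Z).1.1, c,
      (matOf κ κ).symm (matOf κ κ (matCoords Z).1.2.2)), y) = (matCoords Z).2 := h
    rw [this]
    ext (i | i) (j | j) <;> rfl
  rw [h2] at h1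
  rw [← h1, Matrix.charpoly_mul_comm, ← Matrix.mul_assoc]
  have h3 : shear (-y) * shear y = 1 := by simpa using shear_mul_shear_neg (-y)
  rw [h3, Matrix.one_mul, blk]
  have h4 : replicateCol Unit (0 : κ → ℝ) = 0 := by ext; rfl
  rw [h4, Matrix.charpoly_fromBlocks_zero₂₁]
  congr 1
  simp [Matrix.charpoly, Matrix.charmatrix]

lemma mulVec_elim_iff {Z : Matrix (Unit ⊕ κ) (Unit ⊕ κ) ℝ} {y : κ → ℝ} {l : ℝ} :
    Z *ᵥ Sum.elim (fun _ => 1) y = l • Sum.elim (fun _ => 1) y ↔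
      eigVal ((matCoords Z).1, y) = l ∧ eigMap ((matCoords Z).1, y) = (matCoords Z).2 := by
  have e1 : (Z *ᵥ Sum.elim (fun _ => 1) y) (Sum.inl ()) = eigVal ((matCoords Z).1, y) := by
    simp [mulVec, dotProduct, eigVal, matCoords]
  have e2 : ∀ i, (Z *ᵥ Sum.elim (fun _ => 1) y) (Sum.inr i) =
      (matCoords Z).2 i + (Matrix.of (matCoords Z).1.2.2 *ᵥ y) i := by
    intro i
    simp [mulVec, dotProduct, matCoords]
  constructor
  · intro h
    have h1 : eigVal ((matCoords Z).1, y) = l := by rw [← e1, h]; simp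
    refine ⟨h1, ?_⟩
    ext i
    have h2 := congrFun h (Sum.inr i)
    rw [e2] at h2
    simp at h2
    change (eigVal ((matCoords Z).1, y)) * y i - (Matrix.of (matCoords Z).1.2.2 *ᵥ y) i = _
    rw [h1]
    linarith
  · rintro ⟨h1, h2⟩
    ext (⟨⟩ | i)
    · rw [e1, h1]; simp
    · rw [e2, ← h2, ← h1]
      change (eigVal ((matCoords Z).1, y)) * y i - (Matrix.of (matCoords Z).1.2.2 *ᵥ y) i + _ = _
      simp

lemma isRoot_charpoly_iff {ι : Type*} [Fintype ι] [DecidableEq ι] {Z : Matrix ι ι ℝ} {l : ℝ} :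
    Z.charpoly.IsRoot l ↔ ∃ v ≠ 0, Z *ᵥ v = l • v := by
  rw [Polynomial.IsRoot, Matrix.eval_charpoly, ← Matrix.exists_mulVec_eq_zero_iff]
  refine exists_congr fun v => and_congr_right fun _ => ?_
  rw [Matrix.sub_mulVec, sub_eq_zero, eq_comm]
  simp [← Matrix.smul_one_eq_diagonal, Matrix.smul_mulVec]

lemma IsGeneric.eigMap_of_isRoot {Z : Matrix (Unit ⊕ κ) (Unit ⊕ κ) ℝ} (hZ : IsGeneric Z) {l : ℝ}
    (hl : Z.charpoly.IsRoot l) :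
    ∃ y, eigVal ((matCoords Z).1, y) = l ∧ eigMap ((matCoords Z).1, y) = (matCoords Z).2 := by
  obtain ⟨v, hv, h⟩ := isRoot_charpoly_iff.1 hl
  have h0 := hZ.1 l v hv h
  refine ⟨fun i => (v (Sum.inl ()))⁻¹ * v (Sum.inr i), mulVec_elim_iff.1 ?_⟩
  have e : Sum.elim (fun _ => 1) (fun i => (v (Sum.inl ()))⁻¹ * v (Sum.inr i)) =
      (v (Sum.inl ()))⁻¹ • v := by
    ext (⟨⟩ | i)
    · simp [h0]
    · simp
  rw [e, Matrix.mulVec_smul, h, smul_comm]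

lemma IsGeneric.nodup_roots {Z : Matrix (Unit ⊕ κ) (Unit ⊕ κ) ℝ} (hZ : IsGeneric Z) :
    Z.charpoly.roots.Nodup := by
  rw [Multiset.nodup_iff_count_le_one]
  intro l
  rw [count_roots]
  by_cases hl : Z.charpoly.IsRoot l
  · obtain ⟨y, h1, h2⟩ := hZ.eigMap_of_isRoot hl
    have h3 := hZ.2 y h2
    have h4 := charpoly_eq_of_eigMap h2
    rw [partialJac_eigMap] at h3
    rw [h1] at h3 h4
    rw [h4, rootMultiplicity_mul (by rw [← h4]; exact Z.charpoly_monic.ne_zero),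
      rootMultiplicity_X_sub_C_self, rootMultiplicity_eq_zero]
    rw [IsRoot, Matrix.eval_charpoly]
    convert h3
    simp [← Matrix.smul_one_eq_diagonal, Matrix.smul_mulVec]
  · rw [rootMultiplicity_eq_zero hl]
    exact zero_le_one

/-- Sums over the eigenvectors of a generic matrix are sums over the real eigenvalues. -/
lemma IsGeneric.eigSum_eq {Z : Matrix (Unit ⊕ κ) (Unit ⊕ κ) ℝ} (hZ : IsGeneric Z)
    (H : ℝ → ℝ[X] → ENNReal) :
    eigSum (fun p => H p.1 p.2.charpoly) Z =
      ∑ l ∈ Z.charpoly.roots.toFinset, H l (Z.charpoly /ₘ (X - C l)) := by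
  have hne := Z.charpoly_monic.ne_zero
  have hroot : ∀ y, eigMap ((matCoords Z).1, y) = (matCoords Z).2 →
      eigVal ((matCoords Z).1, y) ∈ Z.charpoly.roots.toFinset := by
    intro y hy
    rw [Multiset.mem_toFinset, mem_roots hne, charpoly_eq_of_eigMap hy]
    simp
  let φ : {y // eigMap ((matCoords Z).1, y) = (matCoords Z).2 ∧
      partialJac eigMap ((matCoords Z).1, y) ≠ 0} → {l // l ∈ Z.charpoly.roots.toFinset} :=
    fun y => ⟨eigVal ((matCoords Z).1, y), hroot y y.2.1⟩
  have hφ : Function.Bijective φ := by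
    constructor
    · rintro ⟨y, hy⟩ ⟨y', hy'⟩ h
      have h' : eigVal ((matCoords Z).1, y) = eigVal ((matCoords Z).1, y') := congrArg Subtype.val h
      have h1 := mulVec_elim_iff.2 ⟨rfl, hy.1⟩
      have h2 := mulVec_elim_iff.2 ⟨h'.symm, hy'.1⟩
      by_contra hne
      refine hZ.1 _ (Sum.elim (fun _ => 1) y - Sum.elim (fun _ => 1) y') ?_
        (by rw [Matrix.mulVec_sub, h1, h2, smul_sub]) (by simp)
      intro h3
      refine hne (Subtype.ext (funext fun i => ?_))
      have := congrFun h3 (Sum.inr i)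
      simpa [sub_eq_zero] using this
    · rintro ⟨l, hl⟩
      obtain ⟨y, h1, h2⟩ := hZ.eigMap_of_isRoot ((mem_roots hne).1 (Multiset.mem_toFinset.1 hl))
      exact ⟨⟨y, h2, hZ.2 y h2⟩, Subtype.ext h1⟩
  rw [← Finset.tsum_subtype, ← (Equiv.ofBijective φ hφ).tsum_eq, eigSum, regularSum]
  refine tsum_congr fun y => ?_
  have h4 := charpoly_eq_of_eigMap y.2.1
  have h5 : (deflated ((matCoords Z).1, y.1)).charpoly =
      Z.charpoly /ₘ (X - C (eigVal ((matCoords Z).1, y.1))) := by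
    conv_rhs => rw [h4]
    rw [mul_divByMonic_cancel_left _ (monic_X_sub_C _)]
  simp only [h5]
  rfl

end GenericSum

section DetMoments
open Matrix
set_option linter.unusedSectionVars false

variable {κ : Type*} [Fintype κ] [DecidableEq κ]

lemma gaussian_moments : Integrable (fun x : ℝ => x) (gaussianReal 0 1) ∧
    ∫ x, x ∂gaussianReal 0 1 = 0 ∧ Integrable (fun x : ℝ => x * x) (gaussianReal 0 1) ∧
    ∫ x, x * x ∂gaussianReal 0 1 = 1 := by
  have h2 : MemLp (id : ℝ → ℝ) 2 (gaussianReal 0 1) := memLp_id_gaussianReal 2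
  have hm : ∫ x, x ∂gaussianReal 0 1 = 0 := by
    simp
  refine ⟨h2.integrable one_le_two, hm, ?_, ?_⟩
  · simpa [sq] using h2.integrable_sq
  · have h := variance_id_gaussianReal (μ := 0) (v := 1)
    rw [variance_eq_integral measurable_id.aemeasurable] at h
    simpa [hm, sq] using h

/-- The constant `1` together with the coordinates of a vector. -/
def optCoord (x : κ → ℝ) (p : Option κ) : ℝ := p.elim 1 x

lemma optCoord_mul (p q : Option κ) : ∃ f : κ → ℝ → ℝ,
    (∀ x, optCoord x p * optCoord x q = ∏ j, f j (x j)) ∧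
    (∀ j, Integrable (f j) (gaussianReal 0 1)) ∧
    ∏ j, ∫ x, f j x ∂gaussianReal 0 1 = if p = q then 1 else 0 := by
  obtain ⟨i1, v1, i2, v2⟩ := gaussian_moments
  have i0 : Integrable (fun _ : ℝ => (1 : ℝ)) (gaussianReal 0 1) := integrable_const _
  refine ⟨fun j x => (if p = some j then x else 1) * (if q = some j then x else 1), ?_, ?_, ?_⟩
  · intro x
    rw [Finset.prod_mul_distrib]
    congr 1
    · cases p <;> simp [optCoord]
    · cases q <;> simp [optCoord]
  · intro j
    by_cases hp : p = some j <;> by_cases hq : q = some j <;> simp [hp, hq, i1, i2]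
  · by_cases hpq : p = q
    · subst hpq
      simp only [if_true]
      refine Finset.prod_eq_one fun j _ => ?_
      by_cases hp : p = some j <;> simp [hp, v2]
    · rw [if_neg hpq]
      cases p with
      | none =>
        cases q with
        | none => exact absurd rfl hpq
        | some k =>
          refine Finset.prod_eq_zero (Finset.mem_univ k) ?_
          simp [v1]
      | some k =>
        refine Finset.prod_eq_zero (Finset.mem_univ k) ?_
        simp [Ne.symm hpq, v1]

lemma integral_optCoord (p q : Option κ) :
    Integrable (fun x : κ → ℝ => optCoord x p * optCoord x q)
      (Measure.pi fun _ => gaussianReal 0 1) ∧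
    ∫ x : κ → ℝ, optCoord x p * optCoord x q ∂(Measure.pi fun _ => gaussianReal 0 1) =
      if p = q then 1 else 0 := by
  obtain ⟨f, h1, h2, h3⟩ := optCoord_mul p q
  simp_rw [h1]
  exact ⟨Integrable.fintype_prod h2, by rw [integral_fintype_prod_eq_prod, h3]⟩

/-- Row `k` of `M` when `p = some k`, and row `i` of the identity when `p = none`. -/
def optRow (M : Matrix κ κ ℝ) (i : κ) (p : Option κ) (j : κ) : ℝ :=
  p.elim (if i = j then 1 else 0) (fun k => M k j)

/-- Replace the `i`-th row by row `k` of `M` when `o i = some k`, and by that of the identity when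
`o i = none`. -/
def optRows (M : Matrix κ κ ℝ) (o : κ → Option κ) : Matrix κ κ ℝ :=
  Matrix.of fun i => optRow M i (o i)

lemma det_expand (a c : κ → ℝ) (X M : Matrix κ κ ℝ) :
    (diagonal c + diagonal a * (X * M)).det =
      ∑ o : κ → Option κ, (∏ i, (o i).elim (c i) (fun _ => a i) * optCoord (X i) (o i)) *
        (optRows M o).det := by
  have h : diagonal c + diagonal a * (X * M) = Matrix.of fun i => ∑ p : Option κ,
      ((p.elim (c i) (fun _ => a i) * optCoord (X i) p) • optRow M i p) := by
    ext i j
    simp [optCoord, optRow, Matrix.mul_apply, Matrix.diagonal_apply, Finset.mul_sum, mul_assoc]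
  rw [h]
  have h2 := (detRowAlternating (R := ℝ) (n := κ)).toMultilinearMap.map_sum
    (fun i (p : Option κ) =>
      (p.elim (c i) (fun _ => a i) * optCoord (X i) p) • optRow M i p)
  refine Eq.trans h2 (Finset.sum_congr rfl fun o _ => ?_)
  exact (detRowAlternating (R := ℝ) (n := κ)).toMultilinearMap.map_smul_univ
    (fun i => (o i).elim (c i) (fun _ => a i) * optCoord (X i) (o i)) _

/-- Gaussian average of a product of two determinants. -/
lemma integral_det_mul_det (a c a' c' : κ → ℝ) (M : Matrix κ κ ℝ) :
    Integrable (fun X => (diagonal c + diagonal a * (X * M)).det *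
      (diagonal c' + diagonal a' * (X * M)).det) (gin κ κ) ∧
    ∫ X, (diagonal c + diagonal a * (X * M)).det *
      (diagonal c' + diagonal a' * (X * M)).det ∂gin κ κ =
      ∑ o : κ → Option κ, (∏ i, (o i).elim (c i * c' i) (fun _ => a i * a' i)) *
        (optRows M o).det ^ 2 := by
  set w : κ → Option κ → ℝ := fun i p => p.elim (c i) (fun _ => a i) with hw
  set w' : κ → Option κ → ℝ := fun i p => p.elim (c' i) (fun _ => a' i) with hw'
  have hexp : ∀ X : κ → κ → ℝ, (diagonal c + diagonal a * (matOf κ κ X * M)).det *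
      (diagonal c' + diagonal a' * (matOf κ κ X * M)).det =
      ∑ o : κ → Option κ, ∑ o' : κ → Option κ, ((∏ i, w i (o i) * w' i (o' i)) *
        ((optRows M o).det * (optRows M o').det)) *
        ∏ i, optCoord (X i) (o i) * optCoord (X i) (o' i) := by
    intro X
    rw [det_expand, det_expand, Finset.sum_mul_sum]
    refine Finset.sum_congr rfl fun o _ => Finset.sum_congr rfl fun o' _ => ?_
    simp only [Finset.prod_mul_distrib]
    change (_ * ∏ i, optCoord (X i) (o i)) * _ * ((_ * ∏ i, optCoord (X i) (o' i)) * _) = _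
    ring
  have hInt : ∀ o o' : κ → Option κ, Integrable
      (fun X : κ → κ → ℝ => ∏ i, optCoord (X i) (o i) * optCoord (X i) (o' i))
      (Measure.pi fun _ => Measure.pi fun _ => gaussianReal 0 1) := fun o o' =>
    Integrable.fintype_prod (f := fun i x => optCoord x (o i) * optCoord x (o' i))
      fun i => (integral_optCoord _ _).1
  have hval : ∀ o o' : κ → Option κ,
      ∫ X : κ → κ → ℝ, ∏ i, optCoord (X i) (o i) * optCoord (X i) (o' i)
      ∂(Measure.pi fun _ => Measure.pi fun _ => gaussianReal 0 1) = if o = o' then 1 else 0 := by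
    intro o o'
    rw [integral_fintype_prod_eq_prod (f := fun i x => optCoord x (o i) * optCoord x (o' i))]
    simp_rw [(integral_optCoord _ _).2]
    split_ifs with h
    · simp [h]
    · obtain ⟨i, hi⟩ := Function.ne_iff.1 h
      exact Finset.prod_eq_zero (Finset.mem_univ i) (by simp [hi])
  constructor
  · rw [gin, matMeasure, integrable_map_equiv]
    simp only [Function.comp_def, hexp]
    exact integrable_finsetSum _ fun o _ => integrable_finsetSum _ fun o' _ =>
      (hInt o o').const_mul _
  · rw [gin, matMeasure, integral_map_equiv]
    simp only [hexp]
    rw [integral_finsetSum _ fun o _ => integrable_finsetSum _ fun o' _ => (hInt o o').const_mul _]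
    refine Finset.sum_congr rfl fun o _ => ?_
    rw [integral_finsetSum _ fun o' _ => (hInt o o').const_mul _]
    simp_rw [integral_const_mul, hval]
    simp only [mul_ite, mul_one, mul_zero, Finset.sum_ite_eq, Finset.mem_univ, if_true, sq]
    congr 1
    refine Finset.prod_congr rfl fun i _ => ?_
    cases o i <;> simp [hw, hw']

end DetMoments

section MinorSums
open Matrix
set_option linter.unusedSectionVars false

variable {κ : Type*} [Fintype κ] [DecidableEq κ]

/-- Extend a function on `S` by `none`. -/
def optExt (S : Finset κ) (f : S → κ) (i : κ) : Option κ :=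
  if h : i ∈ S then some (f ⟨i, h⟩) else none

/-- The matrix of a map, as a zero-one matrix. -/
def mapMat (g : κ → κ) : Matrix κ κ ℝ := Matrix.of fun i j => if g i = j then 1 else 0

lemma mapMat_mul (g : κ → κ) (M : Matrix κ κ ℝ) (i j : κ) : (mapMat g * M) i j = M (g i) j := by
  simp [mapMat, Matrix.mul_apply]

lemma mapMat_orthogonal {g : κ → κ} (hg : Function.Injective g) :
    (mapMat g).transpose * mapMat g = 1 := by
  rw [mul_eq_one_comm]
  ext i j
  rw [mapMat_mul]
  simp only [transpose_apply, mapMat, of_apply, one_apply, hg.eq_iff, eq_comm]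

lemma det_mapMat_sq (g : κ → κ) :
    (mapMat g).det ^ 2 = if Function.Injective g then 1 else 0 := by
  split_ifs with h
  · have := congrArg Matrix.det (mapMat_orthogonal h)
    rw [det_mul, det_transpose, det_one] at this
    rw [sq, this]
  · simp only [Function.Injective, not_forall] at h
    obtain ⟨i, j, h1, h2⟩ := h
    rw [Matrix.det_zero_of_row_eq h2 (by ext k; simp [mapMat, h1]), zero_pow two_ne_zero]

/-- The sum of the squares of all minors of `M` with columns in `S`. -/
noncomputable def minorSq (S : Finset κ) (M : Matrix κ κ ℝ) : ℝ :=
  ∑ f : S → κ, (optRows M (optExt S f)).det ^ 2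

lemma minorSq_nonneg (S : Finset κ) (M : Matrix κ κ ℝ) : 0 ≤ minorSq S M :=
  Finset.sum_nonneg fun _ _ => sq_nonneg _

/-- The rows of `Y` indexed by `S`, completed by rows of the identity. -/
def rowsOn (S : Finset κ) (Y : Matrix κ κ ℝ) : Matrix κ κ ℝ :=
  diagonal (fun i => if i ∈ S then 0 else 1) + diagonal (fun i => if i ∈ S then 1 else 0) * Y

lemma rowsOn_apply (S : Finset κ) (Y : Matrix κ κ ℝ) (i j : κ) :
    rowsOn S Y i j = if i ∈ S then Y i j else if i = j then 1 else 0 := by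
  by_cases h : i ∈ S <;> simp [rowsOn, diagonal_apply, h]

lemma sum_filter_support (S : Finset κ) (F : (κ → Option κ) → ℝ) :
    ∑ o : κ → Option κ with Finset.univ.filter (fun i => o i ≠ none) = S, F o =
      ∑ f : S → κ, F (optExt S f) := by
  symm
  refine Finset.sum_nbij (optExt S) ?_ ?_ ?_ fun _ _ => rfl
  · intro f _
    simp only [Finset.mem_filter, Finset.mem_univ, true_and]
    ext i
    by_cases h : i ∈ S <;> simp [optExt, h]
  · intro f _ f' _ h
    ext ⟨i, hi⟩
    have := congrFun h i
    simpa [optExt, hi] using this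
  · intro o ho
    simp only [Finset.coe_filter, Finset.mem_univ, true_and] at ho
    have ho : Finset.univ.filter (fun i => o i ≠ none) = S := ho
    have hS : ∀ i, i ∈ S ↔ o i ≠ none := fun i => by rw [← ho]; simp
    refine ⟨fun i => (o i).get (Option.isSome_iff_ne_none.2 ((hS i).1 i.2)), Finset.mem_coe.2 (Finset.mem_univ _), ?_⟩
    ext1 i
    by_cases h : i ∈ S
    · simp [optExt, h]
    · simp only [optExt, h, dif_neg, not_false_eq_true]
      have := (hS i).not.1 h
      push Not at this
      exact this.symm

lemma sum_prod_elim (u : ℝ) (F : (κ → Option κ) → ℝ) :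
    ∑ o : κ → Option κ, (∏ i, (o i).elim 1 (fun _ => u)) * F o =
      ∑ S : Finset κ, u ^ S.card * ∑ f : S → κ, F (optExt S f) := by
  rw [← Finset.sum_fiberwise (s := Finset.univ)
    (g := fun o : κ → Option κ => Finset.univ.filter (fun i => o i ≠ none))]
  refine Finset.sum_congr rfl fun S _ => ?_
  rw [← sum_filter_support, Finset.mul_sum]
  refine Finset.sum_congr rfl fun o ho => ?_
  rw [Finset.mem_filter] at ho
  congr 1
  rw [← ho.2, ← Finset.prod_const, Finset.prod_filter]
  refine Finset.prod_congr rfl fun i _ => ?_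
  cases o i <;> simp

lemma sum_prod_elim_support (S : Finset κ) (F : (κ → Option κ) → ℝ) :
    ∑ o : κ → Option κ, (∏ i, (o i).elim (if i ∈ S then 0 else 1)
      (fun _ => if i ∈ S then 1 else 0)) * F o = ∑ f : S → κ, F (optExt S f) := by
  rw [← sum_filter_support, Finset.sum_filter]
  refine Finset.sum_congr rfl fun o _ => ?_
  split_ifs with h
  · rw [Finset.prod_eq_one, one_mul]
    intro i _
    subst h
    cases hi : o i <;> simp [hi]
  · have : ∃ i, ¬ (o i ≠ none ↔ i ∈ S) := by
      by_contra! hc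
      exact h (by ext i; simpa using hc i)
    obtain ⟨i, hi⟩ := this
    rw [Finset.prod_eq_zero (Finset.mem_univ i), zero_mul]
    cases ho : o i <;> by_cases hS : i ∈ S <;> simp_all

lemma measurable_det : Measurable fun X : Matrix κ κ ℝ => X.det :=
  (continuous_id.matrix_det).measurable

lemma lintegral_rowsOn (S : Finset κ) (M : Matrix κ κ ℝ) :
    ∫⁻ X, ENNReal.ofReal ((rowsOn S (X * M)).det ^ 2) ∂gin κ κ = ENNReal.ofReal (minorSq S M) := by
  obtain ⟨h1, h2⟩ := integral_det_mul_det (fun i => if i ∈ S then 1 else 0)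
    (fun i => if i ∈ S then 0 else 1) (fun i => if i ∈ S then 1 else 0)
    (fun i => if i ∈ S then 0 else 1) M
  simp only [← sq] at h1 h2
  refine (ofReal_integral_eq_lintegral_ofReal h1 (ae_of_all _ fun _ => sq_nonneg _)).symm.trans ?_
  change ENNReal.ofReal (∫ X, (rowsOn S (X * M)).det ^ 2 ∂gin κ κ) = _
  congr 1
  refine Eq.trans h2 ?_
  rw [minorSq, ← sum_prod_elim_support S (fun o => (optRows M o).det ^ 2)]
  refine Finset.sum_congr rfl fun o _ => ?_
  congr 1
  refine Finset.prod_congr rfl fun i _ => ?_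
  cases o i <;> by_cases h : i ∈ S <;> simp [h]

lemma optRows_optExt_apply (S : Finset κ) (f : S → κ) (M : Matrix κ κ ℝ) (i j : κ) :
    optRows M (optExt S f) i j =
      if h : i ∈ S then M (f ⟨i, h⟩) j else if i = j then 1 else 0 := by
  by_cases h : i ∈ S <;> simp [optRows, optRow, optExt, h]

lemma measurable_optRows_det (o : κ → Option κ) :
    Measurable fun X : Matrix κ κ ℝ => (optRows X o).det := by
  refine measurable_det.comp (measurable_matrix_iff.2 fun i j => ?_)
  simp only [optRows, of_apply, optRow]
  cases o i with
  | none => exact measurable_const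
  | some k => exact measurable_matrix_apply k j

lemma measurable_minorSq (S : Finset κ) : Measurable (minorSq S) := by
  unfold minorSq
  exact Finset.measurable_sum _ fun f _ => (measurable_optRows_det _).pow_const 2

lemma measurable_rowsOn (S : Finset κ) : Measurable (rowsOn S) := by
  refine measurable_matrix_iff.2 fun i j => ?_
  simp only [rowsOn_apply]
  split_ifs
  · exact measurable_matrix_apply i j
  · exact measurable_const
  · exact measurable_const

lemma lintegral_optRows (S : Finset κ) (f : S → κ) (M : Matrix κ κ ℝ) :
    ∫⁻ X, ENNReal.ofReal ((optRows (X * M) (optExt S f)).det ^ 2) ∂gin κ κ =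
      if Function.Injective f then ENNReal.ofReal (minorSq S M) else 0 := by
  split_ifs with hf
  · have hinj : Set.InjOn (fun i => if h : i ∈ S then f ⟨i, h⟩ else i) (S : Set κ) := by
      intro i hi j hj h
      have hi' : i ∈ S := hi
      have hj' : j ∈ S := hj
      simp only [hi', hj', dif_pos] at h
      simpa using hf h
    obtain ⟨g, hg⟩ := Finset.exists_equiv_extend_of_card_eq (t := (Finset.univ : Finset κ))
      (by simp) (Finset.subset_univ _) hinj
    set σ : κ → κ := fun i => (g i : κ) with hσ
    have hσi : Function.Injective σ := Subtype.val_injective.comp g.injective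
    have h1 : ∀ X : Matrix κ κ ℝ, optRows (X * M) (optExt S f) = rowsOn S (mapMat σ * X * M) := by
      intro X
      ext i j
      rw [optRows_optExt_apply, rowsOn_apply]
      split_ifs with h
      · rw [Matrix.mul_assoc, mapMat_mul, hσ]
        simp [hg i h, h]
      · rfl
      · rfl
    simp_rw [h1]
    rw [lintegral_gin_mul_left (F := fun X => ENNReal.ofReal ((rowsOn S (X * M)).det ^ 2))
      (mapMat_orthogonal hσi), lintegral_rowsOn]
    have hX : Measurable fun X : Matrix κ κ ℝ => X * M := measurable_matrix_mul_const M
    have h2 := measurable_det.comp ((measurable_rowsOn S).comp hX)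
    exact (h2.pow_const 2).ennreal_ofReal
  · simp only [Function.Injective, not_forall] at hf
    obtain ⟨i, j, h1, h2⟩ := hf
    have h0 : ∀ X : Matrix κ κ ℝ, (optRows (X * M) (optExt S f)).det = 0 := by
      intro X
      refine Matrix.det_zero_of_row_eq (i := (i : κ)) (j := j) (fun h => h2 (Subtype.ext h)) ?_
      ext k
      simp [optRows_optExt_apply, h1]
    simp [h0]

lemma lintegral_minorSq_mul (S : Finset κ) (M : Matrix κ κ ℝ) :
    ∫⁻ X, ENNReal.ofReal (minorSq S (X * M)) ∂gin κ κ =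
      (Fintype.card κ).descFactorial S.card * ENNReal.ofReal (minorSq S M) := by
  have h1 : ∀ X : Matrix κ κ ℝ, ENNReal.ofReal (minorSq S (X * M)) =
      ∑ f : S → κ, ENNReal.ofReal ((optRows (X * M) (optExt S f)).det ^ 2) := fun X =>
    ENNReal.ofReal_sum_of_nonneg fun _ _ => sq_nonneg _
  have hX : Measurable fun X : Matrix κ κ ℝ => X * M := measurable_matrix_mul_const M
  simp_rw [h1]
  rw [lintegral_finsetSum _ fun f _ => by
    have h2 := (measurable_optRows_det (optExt S f)).comp hX
    exact (h2.pow_const 2).ennreal_ofReal]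
  simp_rw [lintegral_optRows]
  rw [← Finset.sum_filter, Finset.sum_const, nsmul_eq_mul]
  congr 2
  rw [← Fintype.card_subtype, Fintype.card_congr (Equiv.subtypeInjectiveEquivEmbedding S κ),
    Fintype.card_embedding_eq, Fintype.card_coe]

lemma minorSq_one (S : Finset κ) : minorSq S (1 : Matrix κ κ ℝ) = S.card.factorial := by
  have h1 : ∀ f : S → κ, optRows (1 : Matrix κ κ ℝ) (optExt S f) =
      mapMat fun i => if h : i ∈ S then f ⟨i, h⟩ else i := by
    intro f
    ext i j
    rw [optRows_optExt_apply, mapMat, of_apply]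
    split_ifs <;> simp_all [one_apply]
  simp_rw [minorSq, h1, det_mapMat_sq]
  rw [Finset.sum_boole, ← Fintype.card_coe S, ← Fintype.card_perm]
  congr 1
  symm
  refine Finset.card_nbij (fun (σ : Equiv.Perm S) i => (σ i : κ)) ?_ ?_ ?_
  · intro σ _
    refine Finset.mem_coe.2 (Finset.mem_filter.2 ⟨Finset.mem_univ _, ?_⟩)
    intro i j h
    by_cases hi : i ∈ S <;> by_cases hj : j ∈ S <;>
      simp only [hi, hj, dif_pos, dif_neg, not_false_eq_true] at h
    · have := σ.injective (Subtype.ext h)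
      simpa using this
    · exact absurd (h ▸ (σ ⟨i, hi⟩).2) hj
    · exact absurd (h ▸ (σ ⟨j, hj⟩).2) hi
    · exact h
  · intro σ _ τ _ h
    ext i
    exact congrFun h i
  · intro f hf
    have hf : Function.Injective (fun i => if h : i ∈ S then f ⟨i, h⟩ else i) := by
      simpa using hf
    have hS : ∀ i, f i ∈ S := by
      intro i
      by_contra h
      have := @hf (f i) i (by simp [h])
      exact h (this ▸ i.2)
    have hinj : Function.Injective fun i : S => (⟨f i, hS i⟩ : S) := by
      intro i j h
      have h' : f i = f j := congrArg Subtype.val h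
      exact Subtype.ext (@hf i j (by simp [h']))
    exact ⟨Equiv.ofBijective _ (Finite.injective_iff_bijective.1 hinj),
      Finset.mem_coe.2 (Finset.mem_univ _), rfl⟩

lemma lintegral_minorSq_mpow (S : Finset κ) (m : ℕ) :
    ∫⁻ P, ENNReal.ofReal (minorSq S P) ∂mpow (gin κ κ) m =
      ((Fintype.card κ).descFactorial S.card : ENNReal) ^ m * S.card.factorial := by
  induction m with
  | zero =>
    rw [lintegral_mpow_zero _ (measurable_minorSq S).ennreal_ofReal, minorSq_one]
    simp
  | succ m ih =>
    rw [lintegral_mpow_succ' _ m (measurable_minorSq S).ennreal_ofReal]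
    simp_rw [lintegral_minorSq_mul]
    rw [lintegral_const_mul _ (measurable_minorSq S).ennreal_ofReal, ih, pow_succ]
    ring

end MinorSums

section DetKernel
open Matrix
set_option linter.unusedSectionVars false

variable {κ : Type*} [Fintype κ] [DecidableEq κ]

lemma integral_mpow_succ' {M : Type*} [Monoid M] [MeasurableSpace M] [MeasurableMul₂ M]
    (μ : Measure M) [IsProbabilityMeasure μ] (m : ℕ) {f : M → ℝ} (hf : Integrable f (mpow μ (m + 1))) :
    ∫ x, f x ∂mpow μ (m + 1) = ∫ y, ∫ x, f (x * y) ∂μ ∂mpow μ m := by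
  have h : Integrable (fun p : M × M => f (p.1 * p.2)) (μ.prod (mpow μ m)) := by
    rw [mpow, Measure.mconv] at hf
    exact hf.comp_measurable measurable_mul
  rw [mpow, integral_mconv hf]
  exact integral_integral_swap (f := fun x y => f (x * y)) h

lemma measurable_det_one_sub (s : ℝ) :
    Measurable fun P : Matrix κ κ ℝ => (1 - s • P).det := by
  have : Continuous fun P : Matrix κ κ ℝ => (1 - s • P).det := by fun_prop
  exact this.measurable

lemma integral_det_one_sub_mul (s t : ℝ) (M : Matrix κ κ ℝ) :
    Integrable (fun X => (1 - s • (X * M)).det * (1 - t • (X * M)).det) (gin κ κ) ∧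
    ∫ X, (1 - s • (X * M)).det * (1 - t • (X * M)).det ∂gin κ κ =
      ∑ S : Finset κ, (s * t) ^ S.card * minorSq S M := by
  have h0 : ∀ (s : ℝ) (Y : Matrix κ κ ℝ), 1 - s • Y =
      diagonal (fun _ => 1) + diagonal (fun _ => -s) * Y := by
    intro s Y
    rw [diagonal_one, ← Matrix.smul_one_eq_diagonal, neg_smul, Matrix.neg_mul, Matrix.smul_mul,
      Matrix.one_mul, sub_eq_add_neg]
  simp_rw [h0]
  obtain ⟨h1, h2⟩ := integral_det_mul_det (fun _ => -s) (fun _ : κ => 1) (fun _ => -t)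
    (fun _ => 1) M
  refine ⟨h1, h2.trans ?_⟩
  simp only [minorSq]
  rw [← sum_prod_elim (s * t) (fun o => (optRows M o).det ^ 2)]
  simp

lemma integral_minorSq_mpow (S : Finset κ) (m : ℕ) :
    Integrable (minorSq S) (mpow (gin κ κ) m) ∧ ∫ P, minorSq S P ∂mpow (gin κ κ) m =
      ((Fintype.card κ).descFactorial S.card : ℝ) ^ m * S.card.factorial := by
  have h := lintegral_minorSq_mpow S m
  have hm := (measurable_minorSq S).aestronglyMeasurable (μ := mpow (gin κ κ) m)
  constructor
  · refine ⟨hm, ?_⟩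
    rw [hasFiniteIntegral_iff_ofReal (ae_of_all _ (minorSq_nonneg S)), h]
    exact ENNReal.mul_lt_top (ENNReal.pow_lt_top (ENNReal.natCast_lt_top _))
      (ENNReal.natCast_lt_top _)
  · rw [integral_eq_lintegral_of_nonneg_ae (ae_of_all _ (minorSq_nonneg S)) hm, h]
    simp

lemma sum_finset_descFactorial (u : ℝ) (m : ℕ) :
    ∑ S : Finset κ, u ^ S.card * (((Fintype.card κ).descFactorial S.card : ℝ) ^ m *
      S.card.factorial) = ∑ j ∈ Finset.range (Fintype.card κ + 1),
        u ^ j * ((Fintype.card κ).descFactorial j : ℝ) ^ (m + 1) := by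
  have := Finset.sum_powerset_apply_card (fun j => u ^ j *
    (((Fintype.card κ).descFactorial j : ℝ) ^ m * j.factorial)) (x := (Finset.univ : Finset κ))
  rw [Finset.powerset_univ] at this
  rw [this, Finset.card_univ]
  refine Finset.sum_congr rfl fun j _ => ?_
  rw [pow_succ, nsmul_eq_mul]
  conv_rhs => rw [Nat.descFactorial_eq_factorial_mul_choose]
  conv_lhs => rw [Nat.descFactorial_eq_factorial_mul_choose]
  push_cast
  ring

lemma memLp_det_one_sub (s : ℝ) (m : ℕ) :
    MemLp (fun P : Matrix κ κ ℝ => (1 - s • P).det) 2 (mpow (gin κ κ) (m + 1)) := by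
  refine (memLp_two_iff_integrable_sq (measurable_det_one_sub s).aestronglyMeasurable).2 ?_
  refine ⟨((measurable_det_one_sub s).pow_const 2).aestronglyMeasurable, ?_⟩
  rw [hasFiniteIntegral_iff_ofReal (ae_of_all _ fun _ => sq_nonneg _),
    lintegral_mpow_succ' _ m ((measurable_det_one_sub s).pow_const 2).ennreal_ofReal]
  have h : ∀ M : Matrix κ κ ℝ, ∫⁻ X, ENNReal.ofReal ((1 - s • (X * M)).det ^ 2) ∂gin κ κ =
      ENNReal.ofReal (∑ S : Finset κ, (s * s) ^ S.card * minorSq S M) := by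
    intro M
    obtain ⟨h1, h2⟩ := integral_det_one_sub_mul s s M
    simp only [← sq] at h1 h2 ⊢
    rw [← ofReal_integral_eq_lintegral_ofReal h1 (ae_of_all _ fun _ => sq_nonneg _), h2]
  simp_rw [h]
  have hi : Integrable (fun M : Matrix κ κ ℝ => ∑ S : Finset κ, (s * s) ^ S.card * minorSq S M)
      (mpow (gin κ κ) m) :=
    integrable_finsetSum _ fun S _ => (integral_minorSq_mpow S m).1.const_mul _
  have := hi.2
  rwa [hasFiniteIntegral_iff_ofReal (ae_of_all _ fun M => Finset.sum_nonneg fun S _ =>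
    mul_nonneg (pow_nonneg (mul_self_nonneg s) _) (minorSq_nonneg S M))] at this

/-- The two-point determinantal moment of a product of Gaussian matrices. -/
noncomputable def detKernel (n m : ℕ) (u : ℝ) : ℝ :=
  ∑ j ∈ Finset.range (n + 1), u ^ j * (n.descFactorial j : ℝ) ^ m

theorem integral_det_one_sub_mpow (s t : ℝ) (m : ℕ) :
    Integrable (fun P : Matrix κ κ ℝ => (1 - s • P).det * (1 - t • P).det)
      (mpow (gin κ κ) (m + 1)) ∧
    ∫ P, (1 - s • P).det * (1 - t • P).det ∂mpow (gin κ κ) (m + 1) =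
      detKernel (Fintype.card κ) (m + 1) (s * t) := by
  have hInt : Integrable (fun P : Matrix κ κ ℝ => (1 - s • P).det * (1 - t • P).det)
      (mpow (gin κ κ) (m + 1)) := (memLp_det_one_sub s m).integrable_mul (memLp_det_one_sub t m)
  refine ⟨hInt, ?_⟩
  rw [integral_mpow_succ' _ m hInt]
  simp_rw [(integral_det_one_sub_mul s t _).2]
  rw [integral_finsetSum _ fun S _ => (integral_minorSq_mpow S m).1.const_mul _]
  simp_rw [integral_const_mul, (integral_minorSq_mpow _ m).2]
  exact sum_finset_descFactorial (s * t) m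

end DetKernel

section ChiMoments

lemma chiMass_eq (s : ℕ) : chiMass s =
    ENNReal.ofReal ((1 / 2 : ℝ) ^ (-((s : ℝ) + 1) / 2) * (1 / 2) * Real.Gamma (((s : ℝ) + 1) / 2)) := by
  have hs : (-1 : ℝ) < (s : ℝ) := by have : (0 : ℝ) ≤ s := s.cast_nonneg; linarith
  have h1 := integral_rpow_mul_exp_neg_mul_rpow (p := 2) (q := s) (b := 1 / 2) two_pos hs
    (by norm_num)
  have h2 := integrableOn_rpow_mul_exp_neg_mul_rpow (p := 2) (s := s) (b := 1 / 2) hs two_pos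
    (by norm_num)
  rw [← h1, ofReal_integral_eq_lintegral_ofReal h2, chiMass]
  · refine setLIntegral_congr_fun measurableSet_Ioi fun r hr => ?_
    have hr : 0 < r := hr
    simp only [chiWeight, abs_of_pos hr, Real.rpow_natCast, Real.rpow_ofNat]
    congr 3
    ring
  · refine (ae_restrict_iff' measurableSet_Ioi).2 (ae_of_all _ fun r hr => ?_)
    have hr : 0 < r := hr
    simp only [Pi.zero_apply]
    positivity

lemma chiMass_add_two (s : ℕ) : chiMass (s + 2) = (s + 1 : ℕ) * chiMass s := by
  rw [chiMass_eq, chiMass_eq, ← ENNReal.ofReal_natCast, ← ENNReal.ofReal_mul (by positivity)]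
  congr 1
  have e1 : (((s + 2 : ℕ) : ℝ) + 1) / 2 = ((s : ℝ) + 1) / 2 + 1 := by push_cast; ring
  have e2 : -(((s + 2 : ℕ) : ℝ) + 1) / 2 = -((s : ℝ) + 1) / 2 + -1 := by push_cast; ring
  rw [e1, e2, Real.Gamma_add_one (by positivity), Real.rpow_add (by norm_num), Real.rpow_neg_one]
  push_cast
  ring

lemma chiMass_mul_chiMass_succ (s : ℕ) :
    chiMass s * chiMass (s + 1) = s.factorial * (chiMass 0 * chiMass 1) := by
  induction s with
  | zero => simp
  | succ s ih =>
    rw [chiMass_add_two, Nat.factorial_succ, Nat.cast_mul, mul_assoc _ _ (chiMass 0 * chiMass 1),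
      ← ih]
    ring

lemma lintegral_chi_zpow (s s' : ℕ) {f : ℝ → ENNReal} (hf : Measurable f) :
    ∫⁻ r, ENNReal.ofReal (|r| ^ ((s' : ℤ) - s)) * f r ∂chi s =
      chiMass s' / chiMass s * ∫⁻ r, f r ∂chi s' := by
  have hm : Measurable fun r : ℝ => ENNReal.ofReal (|r| ^ ((s' : ℤ) - s)) := by fun_prop
  rw [lintegral_chi s (f := fun r => ENNReal.ofReal (|r| ^ ((s' : ℤ) - s)) * f r) (hm.mul hf), lintegral_chi s' hf, ← mul_assoc,
    ENNReal.div_eq_inv_mul, mul_assoc _ (chiMass s') _,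
    ENNReal.mul_inv_cancel (chiMass_ne s').1 (chiMass_ne s').2, mul_one]
  congr 1
  refine setLIntegral_congr_fun measurableSet_Ioi fun r hr => ?_
  have hr : 0 < r := hr
  rw [← mul_assoc, ← ENNReal.ofReal_mul (chiWeight_nonneg _ _)]
  congr 2
  rw [chiWeight, chiWeight, zpow_sub₀ (abs_pos.2 hr.ne').ne', zpow_natCast, zpow_natCast]
  field_simp

lemma lintegral_mpow_chi_zpow (s s' m : ℕ) {f : ℝ → ENNReal} (hf : Measurable f) :
    ∫⁻ r, ENNReal.ofReal (|r| ^ ((s' : ℤ) - s)) * f r ∂mpow (chi s) m =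
      (chiMass s' / chiMass s) ^ m * ∫⁻ r, f r ∂mpow (chi s') m := by
  have hm : Measurable fun r : ℝ => ENNReal.ofReal (|r| ^ ((s' : ℤ) - s)) := by fun_prop
  induction m generalizing f with
  | zero => rw [lintegral_mpow_zero _ (f := fun r => ENNReal.ofReal (|r| ^ ((s' : ℤ) - s)) * f r) (hm.mul hf), lintegral_mpow_zero _ hf]; simp
  | succ m ih =>
    rw [lintegral_mpow_succ _ m
      (f := fun r => ENNReal.ofReal (|r| ^ ((s' : ℤ) - s)) * f r) (hm.mul hf), lintegral_mpow_succ _ m hf]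
    have hx : ∀ x : ℝ, Measurable fun y => f (x * y) := fun x => hf.comp (measurable_const_mul x)
    have h1 : ∀ x : ℝ, ∫⁻ y, ENNReal.ofReal (|x * y| ^ ((s' : ℤ) - s)) * f (x * y)
        ∂mpow (chi s) m = (chiMass s' / chiMass s) ^ m *
          (ENNReal.ofReal (|x| ^ ((s' : ℤ) - s)) * ∫⁻ y, f (x * y) ∂mpow (chi s') m) := by
      intro x
      rw [mul_left_comm, ← ih (hx x), ← lintegral_const_mul' _ _ ENNReal.ofReal_ne_top]
      refine lintegral_congr fun y => ?_
      rw [abs_mul, mul_zpow, ENNReal.ofReal_mul (by positivity), mul_assoc]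
    have h2 : Measurable fun x => ∫⁻ y, f (x * y) ∂mpow (chi s') m := by
      have : Measurable fun p : ℝ × ℝ => f (p.1 * p.2) := hf.comp measurable_mul
      exact this.lintegral_prod_right'
    simp_rw [h1]
    rw [lintegral_const_mul' _ _ (ENNReal.pow_ne_top
      (ENNReal.div_ne_top (chiMass_ne _).2 (chiMass_ne _).1)), lintegral_chi_zpow s s' h2, pow_succ]
    ring

lemma lintegral_mpow_chi_id_ne_top (s m : ℕ) :
    ∫⁻ r, ENNReal.ofReal |r| ∂mpow (chi s) m ≠ ⊤ := by
  have h := lintegral_mpow_chi_zpow s (s + 1) m (f := fun _ => 1) measurable_const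
  have e : ((s + 1 : ℕ) : ℤ) - s = 1 := by push_cast; ring
  simp only [e, zpow_one, mul_one, lintegral_one, measure_univ] at h
  rw [h]
  exact ENNReal.pow_ne_top (ENNReal.div_ne_top (chiMass_ne _).2 (chiMass_ne _).1)

end ChiMoments

section SignIdentity

/-- The sign of a real number, with values in `{-1, 0, 1}`. -/
noncomputable def sg (x : ℝ) : ℝ := x / |x|

lemma sg_mul (x y : ℝ) : sg (x * y) = sg x * sg y := by
  rw [sg, sg, sg, abs_mul, mul_div_mul_comm]

lemma sg_of_pos {x : ℝ} (h : 0 < x) : sg x = 1 := by rw [sg, abs_of_pos h, div_self h.ne']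

lemma sg_of_neg {x : ℝ} (h : x < 0) : sg x = -1 := by
  rw [sg, abs_of_neg h, div_neg, div_self h.ne]

lemma abs_mul_sg (x : ℝ) : |x| * sg x = x := by
  rcases eq_or_ne x 0 with rfl | h
  · simp
  · rw [sg, mul_div_cancel₀ _ (abs_pos.2 h).ne']

lemma mul_sg (x : ℝ) : x * sg x = |x| := by
  rcases eq_or_ne x 0 with rfl | h
  · simp
  · rw [sg, ← mul_div_assoc, ← abs_mul_abs_self, mul_div_cancel_right₀ _ (abs_pos.2 h).ne']

lemma measurable_sg : Measurable sg := measurable_id.div measurable_id.norm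

lemma sg_prod {ι : Type*} (s : Finset ι) (f : ι → ℝ) : sg (∏ i ∈ s, f i) = ∏ i ∈ s, sg (f i) := by
  classical
  induction s using Finset.induction_on with
  | empty => simp [sg]
  | insert a s ha ih => rw [Finset.prod_insert ha, Finset.prod_insert ha, sg_mul, ih]

lemma sg_prod_sub {s : Finset ℝ} {x : ℝ} (hx : x ∉ s) :
    sg (∏ y ∈ s, (x - y)) = (-1) ^ (s.filter (x < ·)).card := by
  rw [sg_prod, ← Finset.prod_const, Finset.prod_filter]
  refine Finset.prod_congr rfl fun y hy => ?_
  rcases lt_or_gt_of_ne (show x ≠ y from fun h => hx (h ▸ hy)) with h | h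
  · rw [if_pos h, sg_of_neg (sub_neg.2 h)]
  · rw [if_neg h.not_gt, sg_of_pos (sub_pos.2 h)]

lemma two_mul_sum_neg_one_pow_card (s : Finset ℝ) :
    2 * ∑ x ∈ s, (-1 : ℝ) ^ (s.filter (x < ·)).card = 1 - (-1) ^ s.card := by
  induction s using Finset.induction_on_min with
  | empty => simp
  | insert a s ha ih =>
    have has : a ∉ s := fun h => lt_irrefl _ (ha a h)
    rw [Finset.sum_insert has, Finset.card_insert_of_notMem has]
    have h1 : (insert a s).filter (a < ·) = s := by
      rw [Finset.filter_insert, if_neg (lt_irrefl a), Finset.filter_true_of_mem ha]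
    have h2 : ∀ x ∈ s, (-1 : ℝ) ^ ((insert a s).filter (x < ·)).card =
        (-1) ^ (s.filter (x < ·)).card := by
      intro x hx
      rw [Finset.filter_insert, if_neg (ha x hx).not_gt]
    rw [h1, Finset.sum_congr rfl h2, mul_add, ih, pow_succ]
    ring

open Polynomial in
lemma Polynomial.Monic.eval_pos_of_roots_eq_zero {r : ℝ[X]} (hr : r.Monic) (h0 : r.roots = 0)
    (x : ℝ) : 0 < r.eval x := by
  have hne : ∀ y, r.eval y ≠ 0 := fun y hy => by
    have : y ∈ r.roots := (mem_roots hr.ne_zero).2 hy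
    simp [h0] at this
  by_contra! hx
  have hx := lt_of_le_of_ne hx (hne x)
  rcases Nat.eq_zero_or_pos r.natDegree with hd | hd
  · rw [hr.natDegree_eq_zero.1 hd] at hx
    simp at hx
    linarith
  · have h1 := r.tendsto_atTop_of_leadingCoeff_nonneg (natDegree_pos_iff_degree_pos.1 hd)
      (by rw [hr.leadingCoeff]; exact zero_le_one)
    obtain ⟨y, hy, hxy⟩ := ((h1.eventually (eventually_ge_atTop 0)).and
      (eventually_ge_atTop x)).exists
    obtain ⟨z, -, hz⟩ := intermediate_value_Icc hxy r.continuous.continuousOn ⟨hx.le, hy⟩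
    exact hne z hz

open Polynomial in
lemma abs_eval_eq_of_nodup_roots {q : ℝ[X]} (hq : q.Monic) (hn : q.roots.Nodup) (x : ℝ) :
    |q.eval x| = q.eval x + 2 * ∑ l ∈ q.roots.toFinset,
      if x < l then (l - x) * (q /ₘ (X - C l)).eval x * sg ((q /ₘ (X - C l)).eval l) else 0 := by
  set S := q.roots.toFinset with hS
  have hmem : ∀ {l}, l ∈ S ↔ q.eval l = 0 := by
    intro l; rw [hS, Multiset.mem_toFinset, mem_roots hq.ne_zero, IsRoot]
  obtain ⟨r, hr, -, hr0⟩ := q.exists_prod_multiset_X_sub_C_mul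
  have hprod : (q.roots.map fun a => X - C a).prod = ∏ a ∈ S, (X - C a) := by
    rw [Finset.prod_eq_multiset_prod, hS, Multiset.toFinset_val, hn.dedup]
  rw [hprod] at hr
  have hrm : r.Monic := by
    have h1 : (∏ a ∈ S, (X - C a)).Monic := monic_prod_of_monic _ _ fun a _ => monic_X_sub_C a
    exact h1.of_mul_monic_left (hr.symm ▸ hq)
  have hrpos := hrm.eval_pos_of_roots_eq_zero hr0
  have hQ : ∀ l ∈ S, q /ₘ (X - C l) = (∏ a ∈ S.erase l, (X - C a)) * r := by
    intro l hl
    rw [← hr, ← Finset.mul_prod_erase S _ hl, mul_assoc,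
      mul_divByMonic_cancel_left _ (monic_X_sub_C l)]
  have hQx : ∀ l ∈ S, (l - x) * (q /ₘ (X - C l)).eval x = - q.eval x := by
    intro l hl
    conv_rhs => rw [← hr, ← Finset.mul_prod_erase S _ hl]
    rw [hQ l hl]
    simp only [eval_mul, eval_sub, eval_X, eval_C]
    ring
  have hsg : ∀ l ∈ S, sg ((q /ₘ (X - C l)).eval l) = (-1) ^ (S.filter (l < ·)).card := by
    intro l hl
    rw [hQ l hl, eval_mul, sg_mul, sg_of_pos (hrpos l), mul_one, eval_prod]
    simp only [eval_sub, eval_X, eval_C]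
    rw [sg_prod_sub (Finset.notMem_erase l S), Finset.filter_erase, Finset.erase_eq_of_notMem]
    simp
  rw [Finset.sum_congr rfl (g := fun l => if x < l then -q.eval x *
    (-1) ^ (S.filter (l < ·)).card else 0) fun l hl => by rw [hQx l hl, hsg l hl]]
  by_cases hx : q.eval x = 0
  · simp [hx]
  have hxS : x ∉ S := fun h => hx (hmem.1 h)
  have h1 : sg (q.eval x) = (-1) ^ (S.filter (x < ·)).card := by
    rw [← hr, eval_mul, sg_mul, sg_of_pos (hrpos x), mul_one, eval_prod]
    simp only [eval_sub, eval_X, eval_C]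
    exact sg_prod_sub hxS
  have h2 := two_mul_sum_neg_one_pow_card (S.filter (x < ·))
  rw [← Finset.sum_filter, ← Finset.mul_sum, ← mul_sg, h1]
  rw [Finset.sum_congr rfl (g := fun l => (-1 : ℝ) ^ (S.filter (l < ·)).card)] at h2
  · linear_combination (q.eval x) * h2
  · intro l hl
    rw [Finset.filter_filter]
    congr 2
    refine Finset.filter_congr fun y _ => ?_
    have := (Finset.mem_filter.1 hl).2
    exact ⟨fun h => h.2, fun h => ⟨this.trans h, h⟩⟩

end SignIdentity

section AbsDet
set_option linter.unusedSectionVars false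

variable {κ : Type*} [Fintype κ] [DecidableEq κ]

lemma det_one_sub_inv_smul (A : Matrix κ κ ℝ) {x : ℝ} (hx : x ≠ 0) :
    (1 - x⁻¹ • A).det = A.charpoly.eval x / x ^ Fintype.card κ := by
  have h : Matrix.scalar κ x - A = x • (1 - x⁻¹ • A) := by
    rw [smul_sub, smul_smul, mul_inv_cancel₀ hx, one_smul, Matrix.scalar_apply,
      Matrix.smul_one_eq_diagonal]
  rw [Matrix.eval_charpoly, h, Matrix.det_smul, mul_div_cancel_left₀ _ (pow_ne_zero _ hx)]

/-- The signed contribution to `|det (1 - x⁻¹ A)|` of a real eigenvalue `l` of `A`, in terms of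
the characteristic polynomial `Q` of the deflated matrix of size `n`. -/
noncomputable def signTerm (n : ℕ) (x l : ℝ) (Q : Polynomial ℝ) : ℝ :=
  if x < l then (l / x - 1) * (Q.eval x / x ^ n) * sg (Q.eval l) else 0

lemma abs_det_one_sub_eq_add_sum {A : Matrix (Unit ⊕ κ) (Unit ⊕ κ) ℝ}
    (hn : A.charpoly.roots.Nodup) {x : ℝ} (hx : 0 < x) :
    |(1 - x⁻¹ • A).det| = (1 - x⁻¹ • A).det + 2 * ∑ l ∈ A.charpoly.roots.toFinset,
      signTerm (Fintype.card κ) x l (A.charpoly /ₘ (Polynomial.X - Polynomial.C l)) := by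
  have h := abs_eval_eq_of_nodup_roots A.charpoly_monic hn x
  have hp : (0 : ℝ) < x ^ Fintype.card (Unit ⊕ κ) := by positivity
  rw [det_one_sub_inv_smul _ hx.ne', abs_div, abs_of_pos hp, h, add_div, mul_div_assoc,
    Finset.sum_div]
  congr 2
  refine Finset.sum_congr rfl fun l _ => ?_
  rw [signTerm, ite_div, zero_div]
  split_ifs with hl
  · rw [Fintype.card_sum, Fintype.card_unit]
    field_simp
    ring
  · rfl

lemma ofReal_abs_add_two_mul_sum {ι : Type*} (s : Finset ι) (d : ℝ) (T : ι → ℝ)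
    (h : |d| = d + 2 * ∑ i ∈ s, T i) :
    ENNReal.ofReal |d| + ENNReal.ofReal (-d) + 2 * ∑ i ∈ s, ENNReal.ofReal (-T i) =
      ENNReal.ofReal d + 2 * ∑ i ∈ s, ENNReal.ofReal (T i) := by
  have e : ∀ x : ℝ, ENNReal.ofReal x = ENNReal.ofReal (max x 0) := fun x => by
    rcases le_total x 0 with h | h
    · rw [max_eq_right h, ENNReal.ofReal_of_nonpos h, ENNReal.ofReal_zero]
    · rw [max_eq_left h]
  have e2 : ∀ f : ι → ℝ, 2 * ∑ i ∈ s, ENNReal.ofReal (f i) =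
      ENNReal.ofReal (2 * ∑ i ∈ s, max (f i) 0) := fun f => by
    rw [ENNReal.ofReal_mul zero_le_two, ENNReal.ofReal_sum_of_nonneg fun i _ => le_max_right _ _,
      ENNReal.ofReal_ofNat]
    simp_rw [← e]
  have hnn : ∀ f : ι → ℝ, 0 ≤ 2 * ∑ i ∈ s, max (f i) 0 := fun f =>
    mul_nonneg zero_le_two (Finset.sum_nonneg fun i _ => le_max_right _ _)
  have hm : ∀ x : ℝ, max x 0 = x + max (-x) 0 := fun x => by
    rcases le_total x 0 with h | h
    · rw [max_eq_right h, max_eq_left (neg_nonneg.2 h)]; ring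
    · rw [max_eq_left h, max_eq_right (neg_nonpos.2 h)]; ring
  rw [e2, e2, e (-d), e d, ← ENNReal.ofReal_add (abs_nonneg _) (le_max_right _ _),
    ← ENNReal.ofReal_add (by positivity) (hnn _), ← ENNReal.ofReal_add (le_max_right _ _) (hnn _)]
  congr 1
  rw [hm d, Finset.sum_congr rfl fun i _ => hm (T i), Finset.sum_add_distrib, h]
  ring

/-- The truncated contribution as a function of an eigenvalue and the deflated matrix. -/
noncomputable def signTermMat (e x : ℝ) (p : ℝ × Matrix κ κ ℝ) : ENNReal :=
  ENNReal.ofReal (e * signTerm (Fintype.card κ) x p.1 p.2.charpoly)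

lemma measurable_signTermMat (e x : ℝ) : Measurable (signTermMat (κ := κ) e x) := by
  have h1 : Measurable fun p : ℝ × Matrix κ κ ℝ => p.2.charpoly.eval x := by
    simp_rw [Matrix.eval_charpoly]
    refine measurable_det.comp (measurable_matrix_iff.2 fun i j => ?_)
    simp only [Matrix.sub_apply]
    exact measurable_const.sub ((measurable_matrix_apply i j).comp measurable_snd)
  have h2 : Measurable fun p : ℝ × Matrix κ κ ℝ => p.2.charpoly.eval p.1 := by
    simp_rw [Matrix.eval_charpoly]
    refine measurable_det.comp (measurable_matrix_iff.2 fun i j => ?_)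
    simp only [Matrix.sub_apply, Matrix.scalar_apply, Matrix.diagonal_apply]
    refine Measurable.sub ?_ ((measurable_matrix_apply i j).comp measurable_snd)
    split_ifs
    exacts [measurable_fst, measurable_const]
  have h3 : Measurable fun p : ℝ × Matrix κ κ ℝ => sg (p.2.charpoly.eval p.1) :=
    measurable_sg.comp h2
  unfold signTermMat signTerm
  refine ENNReal.measurable_ofReal.comp (measurable_const.mul (Measurable.ite ?_ ?_ ?_))
  · exact measurableSet_lt measurable_const measurable_fst
  · exact (((measurable_fst.div_const x).sub_const 1).mul (h1.div_const _)).mul h3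
  · exact measurable_const

lemma charpoly_inv_mul_mul (L B : Matrix κ κ ℝ) (hL : L.det ≠ 0) :
    (L⁻¹ * B * L).charpoly = B.charpoly := by
  rw [Matrix.mul_assoc, Matrix.charpoly_mul_comm, Matrix.mul_assoc,
    Matrix.mul_nonsing_inv _ (isUnit_iff_ne_zero.2 hL), Matrix.mul_one]

lemma abs_det_mul_signTermMat (e : ℝ) {x l : ℝ} (hx : 0 < x) (hl : l ≠ 0) (A : Matrix κ κ ℝ) :
    ENNReal.ofReal |(1 - l⁻¹ • A).det| * signTermMat e x (l, A) =
      if x < l then ENNReal.ofReal (l / x - 1) *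
        ENNReal.ofReal (e * ((1 - x⁻¹ • A).det * (1 - l⁻¹ • A).det)) else 0 := by
  rw [signTermMat, signTerm]
  split_ifs with h
  · have hl0 := hx.trans h
    have h1 : 0 ≤ l / x - 1 := by rw [sub_nonneg, le_div_iff₀ hx, one_mul]; exact h.le
    rw [← ENNReal.ofReal_mul (abs_nonneg _), ← ENNReal.ofReal_mul h1]
    congr 1
    have hp : (0 : ℝ) < l ^ Fintype.card κ := by positivity
    rw [det_one_sub_inv_smul _ hl, det_one_sub_inv_smul _ hx.ne', abs_div, abs_of_pos hp]
    have := abs_mul_sg (A.charpoly.eval l)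
    simp only
    linear_combination (e * (l / x - 1) * (A.charpoly.eval x / x ^ Fintype.card κ) /
      l ^ Fintype.card κ) * this
  · simp

end AbsDet

section AbsDetMoment
set_option linter.unusedSectionVars false

variable {κ : Type*} [Fintype κ] [DecidableEq κ]

/-- The averaged truncated contribution of an eigenvalue at `r`. -/
noncomputable def signKernel (κ : Type*) [Fintype κ] [DecidableEq κ] (m : ℕ) (e x r : ℝ) :
    ENNReal :=
  if x < r then ENNReal.ofReal (r / x - 1) * ∫⁻ A : Matrix κ κ ℝ,
    ENNReal.ofReal (e * ((1 - x⁻¹ • A).det * (1 - r⁻¹ • A).det)) ∂mpow (gin κ κ) (m + 1) else 0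

lemma measurable_signKernel (m : ℕ) (e x : ℝ) : Measurable (signKernel κ m e x) := by
  have h1 : Measurable fun p : ℝ × Matrix κ κ ℝ => (1 - p.1⁻¹ • p.2).det := by
    refine measurable_det.comp (measurable_matrix_iff.2 fun i j => ?_)
    simp only [Matrix.sub_apply, Matrix.smul_apply, smul_eq_mul]
    exact measurable_const.sub
      (measurable_fst.inv.mul ((measurable_matrix_apply i j).comp measurable_snd))
  have h2 : Measurable fun p : ℝ × Matrix κ κ ℝ => (1 - x⁻¹ • p.2).det :=
    (measurable_det_one_sub x⁻¹).comp measurable_snd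
  have h3 : Measurable fun p : ℝ × Matrix κ κ ℝ =>
      ENNReal.ofReal (e * ((1 - x⁻¹ • p.2).det * (1 - p.1⁻¹ • p.2).det)) :=
    ENNReal.measurable_ofReal.comp (measurable_const.mul (h2.mul h1))
  unfold signKernel
  refine Measurable.ite measurableSet_Ioi ?_ measurable_const
  refine Measurable.mul ?_ h3.lintegral_prod_right'
  exact ENNReal.measurable_ofReal.comp ((measurable_id.div_const x).sub_const 1)

lemma two_mul_lintegral_eigSum_signTermMat (m : ℕ) (e : ℝ) {x : ℝ} (hx : 0 < x) :
    2 * ∫⁻ P, eigSum (signTermMat (κ := κ) e x) P ∂mpow (gin (Unit ⊕ κ) (Unit ⊕ κ)) (m + 1) =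
      ∫⁻ r, signKernel κ m e x r ∂mpow (chi (Fintype.card κ)) (m + 1) := by
  rw [two_mul_lintegral_eigSum_mpow (measurable_signTermMat e x) ?_ m
    (measurable_signKernel (κ := κ) m e x) ?_]
  · refine lintegral_congr_ae ?_
    filter_upwards [ae_mpow_chi_pos (Fintype.card κ) (m + 1)] with r hr
    have : signKernel κ m e x (-r) = 0 := if_neg (by linarith)
    rw [this, add_zero]
  · intro l L B hL
    rw [signTermMat, signTermMat]
    simp only
    rw [charpoly_inv_mul_mul L B hL]
  · intro l hl
    simp_rw [abs_det_mul_signTermMat e hx hl]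
    rw [signKernel]
    split_ifs with h
    · rw [lintegral_const_mul' _ _ ENNReal.ofReal_ne_top]
    · simp

lemma detKernel_nonneg (n m : ℕ) {u : ℝ} (hu : 0 ≤ u) : 0 ≤ detKernel n m u :=
  Finset.sum_nonneg fun _ _ => by positivity

lemma detKernel_mono (n m : ℕ) {u v : ℝ} (hu : 0 ≤ u) (huv : u ≤ v) :
    detKernel n m u ≤ detKernel n m v :=
  Finset.sum_le_sum fun _ _ => by gcongr

lemma lintegral_ofReal_eq_add {α : Type*} [MeasurableSpace α] {μ : Measure α} {f : α → ℝ}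
    (hf : Integrable f μ) (h : 0 ≤ ∫ a, f a ∂μ) :
    ∫⁻ a, ENNReal.ofReal (f a) ∂μ =
      ENNReal.ofReal (∫ a, f a ∂μ) + ∫⁻ a, ENNReal.ofReal (-f a) ∂μ := by
  have h1 : ∫⁻ a, ENNReal.ofReal (f a) ∂μ ≠ ⊤ := hf.lintegral_lt_top.ne
  have h2 : ∫⁻ a, ENNReal.ofReal (-f a) ∂μ ≠ ⊤ := hf.neg.lintegral_lt_top.ne
  rw [← ENNReal.toReal_eq_toReal_iff' h1 (ENNReal.add_ne_top.2 ⟨ENNReal.ofReal_ne_top, h2⟩),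
    ENNReal.toReal_add ENNReal.ofReal_ne_top h2, ENNReal.toReal_ofReal h,
    integral_eq_lintegral_pos_part_sub_lintegral_neg_part hf]
  ring

lemma signKernel_one (m : ℕ) {x : ℝ} (hx : 0 < x) (r : ℝ) :
    signKernel κ m 1 x r = (if x < r then ENNReal.ofReal ((r / x - 1) *
      detKernel (Fintype.card κ) (m + 1) (x⁻¹ * r⁻¹)) else 0) + signKernel κ m (-1) x r := by
  rw [signKernel, signKernel]
  split_ifs with h
  · have h0 := hx.trans h
    have h1 : 0 ≤ r / x - 1 := by rw [sub_nonneg, le_div_iff₀ hx, one_mul]; exact h.le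
    obtain ⟨hi, he⟩ := integral_det_one_sub_mpow (κ := κ) x⁻¹ r⁻¹ m
    simp only [one_mul, neg_one_mul]
    rw [lintegral_ofReal_eq_add hi (by rw [he]; exact detKernel_nonneg _ _ (by positivity)), he,
      mul_add, ENNReal.ofReal_mul h1]
  · simp

lemma lintegral_signKernel_ne_top (m : ℕ) (e : ℝ) (he : |e| ≤ 1) {x : ℝ} (hx : 0 < x) :
    ∫⁻ r, signKernel κ m e x r ∂mpow (chi (Fintype.card κ)) (m + 1) ≠ ⊤ := by
  set C := ENNReal.ofReal (2 * detKernel (Fintype.card κ) (m + 1) (x⁻¹ * x⁻¹))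
  have hb : ∀ r, signKernel κ m e x r ≤ ENNReal.ofReal x⁻¹ * C * ENNReal.ofReal |r| := by
    intro r
    rw [signKernel]
    split_ifs with h
    · have h0 := hx.trans h
      rw [mul_right_comm, ← ENNReal.ofReal_mul (by positivity)]
      refine mul_le_mul' (ENNReal.ofReal_le_ofReal ?_) ?_
      · rw [abs_of_pos h0, inv_mul_eq_div]; linarith
      · obtain ⟨hi1, he1⟩ := integral_det_one_sub_mpow (κ := κ) x⁻¹ x⁻¹ m
        obtain ⟨hi2, he2⟩ := integral_det_one_sub_mpow (κ := κ) r⁻¹ r⁻¹ m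
        have h2 : ∫ A : Matrix κ κ ℝ, ((1 - x⁻¹ • A).det * (1 - x⁻¹ • A).det +
            (1 - r⁻¹ • A).det * (1 - r⁻¹ • A).det) ∂mpow (gin κ κ) (m + 1) ≤
            2 * detKernel (Fintype.card κ) (m + 1) (x⁻¹ * x⁻¹) := by
          rw [integral_add hi1 hi2, he1, he2, two_mul]
          have : r⁻¹ ≤ x⁻¹ := inv_anti₀ hx h.le
          gcongr
          exact detKernel_mono _ _ (by positivity) (by gcongr)
        refine le_trans (lintegral_mono fun A => ?_) ((ofReal_integral_eq_lintegral_ofReal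
          (hi1.add hi2) (ae_of_all _ fun A => add_nonneg (mul_self_nonneg _)
            (mul_self_nonneg _))).symm.le.trans (ENNReal.ofReal_le_ofReal h2))
        refine ENNReal.ofReal_le_ofReal ?_
        simp only [Pi.add_apply]
        generalize (1 - x⁻¹ • A).det = a
        generalize (1 - r⁻¹ • A).det = b
        calc e * (a * b) ≤ |e * (a * b)| := le_abs_self _
          _ ≤ 1 * |a * b| := by rw [abs_mul]; gcongr
          _ ≤ a * a + b * b := by
            rw [one_mul, abs_le]
            constructor <;> nlinarith [sq_nonneg (a + b), sq_nonneg (a - b), sq_nonneg a,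
              sq_nonneg b]
    · exact zero_le
  refine ((lintegral_mono hb).trans_lt ?_).ne
  rw [lintegral_const_mul' _ _ (ENNReal.mul_ne_top ENNReal.ofReal_ne_top ENNReal.ofReal_ne_top)]
  exact ENNReal.mul_lt_top (ENNReal.mul_lt_top ENNReal.ofReal_lt_top ENNReal.ofReal_lt_top)
    (lintegral_mpow_chi_id_ne_top _ _).lt_top

/-- The mean absolute characteristic polynomial of a product of Ginibre matrices. -/
lemma lintegral_abs_det_one_sub (m : ℕ) {x : ℝ} (hx : 0 < x) :
    ∫⁻ A, ENNReal.ofReal |(1 - x⁻¹ • A).det| ∂mpow (gin (Unit ⊕ κ) (Unit ⊕ κ)) (m + 1) =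
      1 + ∫⁻ r, (if x < r then ENNReal.ofReal ((r / x - 1) *
        detKernel (Fintype.card κ) (m + 1) (x⁻¹ * r⁻¹)) else 0)
          ∂mpow (chi (Fintype.card κ)) (m + 1) := by
  set μ := mpow (gin (Unit ⊕ κ) (Unit ⊕ κ)) (m + 1)
  have hd := measurable_det_one_sub (κ := Unit ⊕ κ) x⁻¹
  have key : ∀ᵐ A ∂μ, ENNReal.ofReal |(1 - x⁻¹ • A).det| +
      (ENNReal.ofReal (-(1 - x⁻¹ • A).det) + 2 * eigSum (signTermMat (κ := κ) (-1) x) A) =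
      ENNReal.ofReal (1 - x⁻¹ • A).det + 2 * eigSum (signTermMat (κ := κ) 1 x) A := by
    filter_upwards [ae_isGeneric (κ := κ) m] with A hA
    have e : ∀ e : ℝ, eigSum (signTermMat (κ := κ) e x) A =
        ∑ l ∈ A.charpoly.roots.toFinset, ENNReal.ofReal (e * signTerm (Fintype.card κ) x l
          (A.charpoly /ₘ (Polynomial.X - Polynomial.C l))) := fun e =>
      hA.eigSum_eq fun l Q => ENNReal.ofReal (e * signTerm (Fintype.card κ) x l Q)
    have := ofReal_abs_add_two_mul_sum _ _ _ (abs_det_one_sub_eq_add_sum hA.nodup_roots hx)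
    rw [e, e, ← add_assoc]
    simpa only [neg_one_mul, one_mul] using this
  have h2 := lintegral_congr_ae key
  have hm1 : Measurable fun A : Matrix (Unit ⊕ κ) (Unit ⊕ κ) ℝ =>
      ENNReal.ofReal |(1 - x⁻¹ • A).det| := ENNReal.measurable_ofReal.comp hd.norm
  have hm2 : Measurable fun A : Matrix (Unit ⊕ κ) (Unit ⊕ κ) ℝ =>
      ENNReal.ofReal (1 - x⁻¹ • A).det := ENNReal.measurable_ofReal.comp hd
  have hm3 : Measurable fun A : Matrix (Unit ⊕ κ) (Unit ⊕ κ) ℝ =>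
      ENNReal.ofReal (-(1 - x⁻¹ • A).det) := ENNReal.measurable_ofReal.comp hd.neg
  obtain ⟨hi, he⟩ := integral_det_one_sub_mpow (κ := Unit ⊕ κ) x⁻¹ 0 m
  simp only [zero_smul, sub_zero, Matrix.det_one, mul_one, mul_zero] at hi he
  have he1 : detKernel (Fintype.card (Unit ⊕ κ)) (m + 1) 0 = 1 := by
    rw [detKernel, Finset.sum_range_succ']
    simp
  rw [he1] at he
  rw [lintegral_add_left hm1, lintegral_add_left hm3, lintegral_add_left hm2,
    lintegral_const_mul' _ _ (by simp), lintegral_const_mul' _ _ (by simp),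
    two_mul_lintegral_eigSum_signTermMat m _ hx, two_mul_lintegral_eigSum_signTermMat m _ hx,
    lintegral_ofReal_eq_add hi (by rw [he]; exact zero_le_one), he, ENNReal.ofReal_one] at h2
  simp_rw [signKernel_one (κ := κ) m hx] at h2
  rw [lintegral_add_right _ (measurable_signKernel m (-1) x)] at h2
  have hfin : (∫⁻ A, ENNReal.ofReal (-(1 - x⁻¹ • A).det) ∂μ +
      ∫⁻ r, signKernel κ m (-1) x r ∂mpow (chi (Fintype.card κ)) (m + 1)) ≠ ⊤ :=
    ENNReal.add_ne_top.2 ⟨hi.neg.lintegral_lt_top.ne,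
      lintegral_signKernel_ne_top m (-1) (by simp) hx⟩
  refine (ENNReal.add_left_inj hfin).1 (h2.trans ?_)
  ring

end AbsDetMoment

section ExpectedCount
set_option linter.unusedSectionVars false

variable {κ : Type*} [Fintype κ] [DecidableEq κ]

lemma lintegral_mpow_gin_neg (m : ℕ) {F : Matrix κ κ ℝ → ENNReal} (hF : Measurable F) :
    ∫⁻ A, F (-A) ∂mpow (gin κ κ) (m + 1) = ∫⁻ A, F A ∂mpow (gin κ κ) (m + 1) := by
  have hn : Measurable fun A : Matrix κ κ ℝ => -A :=
    measurable_matrix_iff.2 fun i j => (measurable_matrix_apply i j).neg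
  have h1 : Measurable fun X : Matrix κ κ ℝ => ∫⁻ Y, F (X * Y) ∂mpow (gin κ κ) m := by
    have : Measurable fun p : Matrix κ κ ℝ × Matrix κ κ ℝ => F (p.1 * p.2) :=
      hF.comp measurable_mul
    exact this.lintegral_prod_right'
  have h2 := lintegral_gin_mul_left (ι := κ) (κ := κ) (Q := -1) (by simp) h1
  rw [lintegral_mpow_succ _ m hF, ← h2, lintegral_mpow_succ _ m (f := fun A => F (-A))
    (hF.comp hn)]
  simp

lemma lintegral_card_roots_eq (m : ℕ) :
    ∫⁻ Z : Matrix (Unit ⊕ κ) (Unit ⊕ κ) ℝ, (Z.charpoly.roots.card : ENNReal)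
        ∂mpow (gin (Unit ⊕ κ) (Unit ⊕ κ)) (m + 1) =
      ∫⁻ r, ∫⁻ A, ENNReal.ofReal |(1 - r⁻¹ • A).det| ∂mpow (gin κ κ) (m + 1)
        ∂mpow (chi (Fintype.card κ)) (m + 1) := by
  set g : ℝ → ENNReal := fun r =>
    ∫⁻ A, ENNReal.ofReal |(1 - r⁻¹ • A).det| ∂mpow (gin κ κ) (m + 1) with hg
  have hgm : Measurable g := by
    have h1 : Measurable fun p : ℝ × Matrix κ κ ℝ => ENNReal.ofReal |(1 - p.1⁻¹ • p.2).det| := by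
      refine ENNReal.measurable_ofReal.comp (Measurable.norm (measurable_det.comp
        (measurable_matrix_iff.2 fun i j => ?_)))
      simp only [Matrix.sub_apply, Matrix.smul_apply, smul_eq_mul]
      exact measurable_const.sub
        (measurable_fst.inv.mul ((measurable_matrix_apply i j).comp measurable_snd))
    exact h1.lintegral_prod_right'
  have hneg : ∀ r, g (-r) = g r := by
    intro r
    have h := lintegral_mpow_gin_neg (κ := κ) m
      (F := fun A => ENNReal.ofReal |(1 - r⁻¹ • A).det|)
      (ENNReal.measurable_ofReal.comp (measurable_det_one_sub r⁻¹).norm)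
    simp only [hg]
    rw [← h]
    simp only [inv_neg, neg_smul, smul_neg]
  have hD := two_mul_lintegral_eigSum_mpow (κ := κ) (h := fun _ => 1) measurable_const
    (fun _ _ _ _ => rfl) m hgm (fun l _ => by simp [hg])
  have hE : ∫⁻ Z : Matrix (Unit ⊕ κ) (Unit ⊕ κ) ℝ, (Z.charpoly.roots.card : ENNReal)
      ∂mpow (gin (Unit ⊕ κ) (Unit ⊕ κ)) (m + 1) =
      ∫⁻ Z, eigSum (κ := κ) (fun _ => 1) Z ∂mpow (gin (Unit ⊕ κ) (Unit ⊕ κ)) (m + 1) := by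
    refine lintegral_congr_ae ?_
    filter_upwards [ae_isGeneric (κ := κ) m] with Z hZ
    have h := hZ.eigSum_eq fun _ _ => 1
    rw [h, Finset.sum_const, nsmul_one, Multiset.toFinset_card_of_nodup hZ.nodup_roots]
  simp_rw [hneg, ← two_mul] at hD
  rw [lintegral_const_mul' _ _ (by simp)] at hD
  rw [hE]
  exact (ENNReal.mul_right_inj (by simp) (by simp)).1 hD

/-- The probability that an independent product of `m` chi variables with parameter `a` exceeds
one with parameter `b`. -/
noncomputable def chiProb (m a b : ℕ) : ENNReal :=
  ∫⁻ x, ∫⁻ r, (if x < r then 1 else 0) ∂mpow (chi a) m ∂mpow (chi b) m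

lemma lintegral_zpow_mul_zpow (m a b a' b' : ℕ) :
    ∫⁻ x, ∫⁻ r, ENNReal.ofReal (|x| ^ ((b' : ℤ) - b)) * (ENNReal.ofReal (|r| ^ ((a' : ℤ) - a)) *
      (if x < r then 1 else 0)) ∂mpow (chi a) m ∂mpow (chi b) m =
      (chiMass a' / chiMass a) ^ m * (chiMass b' / chiMass b) ^ m * chiProb m a' b' := by
  have h1 : Measurable fun p : ℝ × ℝ => (if p.1 < p.2 then 1 else 0 : ENNReal) :=
    Measurable.ite (measurableSet_lt measurable_fst measurable_snd) measurable_const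
      measurable_const
  have h2 : ∀ x : ℝ, Measurable fun r => (if x < r then 1 else 0 : ENNReal) := fun x =>
    h1.comp measurable_prodMk_left
  simp_rw [lintegral_const_mul' _ _ ENNReal.ofReal_ne_top,
    lintegral_mpow_chi_zpow a a' m (h2 _)]
  rw [lintegral_mpow_chi_zpow b b' m (f := fun x => (chiMass a' / chiMass a) ^ m *
    ∫⁻ r, (if x < r then 1 else 0) ∂mpow (chi a') m) (h1.lintegral_prod_right'.const_mul _),
    lintegral_const_mul' _ _ (ENNReal.pow_ne_top
      (ENNReal.div_ne_top (chiMass_ne _).2 (chiMass_ne _).1)), chiProb]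
  ring

lemma chiMass_ratio_mul {n k : ℕ} (h : k ≤ n) :
    chiMass k / chiMass n * (chiMass (k + 1) / chiMass (n + 1)) *
      (n.descFactorial (n - k) : ENNReal) = 1 := by
  have hn := chiMass_ne n
  have hn' := chiMass_ne (n + 1)
  rw [ENNReal.div_eq_inv_mul, ENNReal.div_eq_inv_mul]
  have e : (chiMass n)⁻¹ * chiMass k * ((chiMass (n + 1))⁻¹ * chiMass (k + 1)) *
      (n.descFactorial (n - k) : ENNReal) = (chiMass n)⁻¹ * (chiMass (n + 1))⁻¹ *
      ((chiMass k * chiMass (k + 1)) * (n.descFactorial (n - k) : ENNReal)) := by ring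
  have hf : (k.factorial : ENNReal) * n.descFactorial (n - k) = n.factorial := by
    have := Nat.factorial_mul_descFactorial (n := n) (k := n - k) (Nat.sub_le _ _)
    rw [Nat.sub_sub_self h] at this
    exact_mod_cast this
  rw [e, chiMass_mul_chiMass_succ, mul_right_comm (k.factorial : ENNReal), hf,
    ← chiMass_mul_chiMass_succ, ← ENNReal.mul_inv (Or.inl hn.1) (Or.inl hn.2)]
  exact ENNReal.inv_mul_cancel (mul_ne_zero hn.1 hn'.1) (ENNReal.mul_ne_top hn.2 hn'.2)

lemma lintegral_detKernel_eq_sum (n m : ℕ) (c : ℕ) (hc : c ≤ 1) :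
    ∫⁻ x, ∫⁻ r, (if x < r then ENNReal.ofReal ((r / x) ^ c * detKernel n m (x⁻¹ * r⁻¹)) else 0)
        ∂mpow (chi n) m ∂mpow (chi (n + 1)) m =
      ∑ k ∈ Finset.range (n + 1), chiProb m (k + c) (k + 1 - c) := by
  have e1 : ∀ᵐ x ∂mpow (chi (n + 1)) m,
      ∫⁻ r, (if x < r then ENNReal.ofReal ((r / x) ^ c * detKernel n m (x⁻¹ * r⁻¹)) else 0)
        ∂mpow (chi n) m = ∫⁻ r, ∑ k ∈ Finset.range (n + 1), (n.descFactorial (n - k) : ENNReal) ^ m *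
        (ENNReal.ofReal (|x| ^ (((k + 1 - c : ℕ) : ℤ) - (n + 1 : ℕ))) *
          (ENNReal.ofReal (|r| ^ (((k + c : ℕ) : ℤ) - n)) * (if x < r then 1 else 0)))
        ∂mpow (chi n) m := by
    filter_upwards [ae_mpow_chi_pos (n + 1) m] with x hx
    refine lintegral_congr_ae ?_
    filter_upwards [ae_mpow_chi_pos n m] with r hr
    split_ifs with h
    · rw [detKernel, ← Finset.sum_range_reflect, Finset.mul_sum,
        ENNReal.ofReal_sum_of_nonneg fun k _ => by positivity]
      refine Finset.sum_congr rfl fun k hk => ?_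
      have hk : k ≤ n := Nat.lt_succ_iff.1 (Finset.mem_range.1 hk)
      rw [Nat.add_sub_cancel, mul_one, abs_of_pos hx, abs_of_pos hr,
        ← ENNReal.ofReal_mul (by positivity), ← ENNReal.ofReal_natCast, ← ENNReal.ofReal_pow
        (Nat.cast_nonneg _), ← ENNReal.ofReal_mul (by positivity)]
      congr 1
      have hz1 : ((k + 1 - c : ℕ) : ℤ) - (n + 1 : ℕ) = -((n - k : ℕ) : ℤ) - c := by omega
      have hz2 : ((k + c : ℕ) : ℤ) - n = -((n - k : ℕ) : ℤ) + c := by omega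
      rw [hz1, hz2, zpow_sub₀ hx.ne', zpow_add₀ hr.ne', zpow_neg, zpow_neg, zpow_natCast,
        zpow_natCast, zpow_natCast, zpow_natCast, div_pow, mul_pow, inv_pow, inv_pow]
      field_simp
    · simp
  have hm1 : Measurable fun p : ℝ × ℝ => (if p.1 < p.2 then 1 else 0 : ENNReal) :=
    Measurable.ite (measurableSet_lt measurable_fst measurable_snd) measurable_const
      measurable_const
  have hm2 : ∀ k, Measurable fun p : ℝ × ℝ => (n.descFactorial (n - k) : ENNReal) ^ m *
      (ENNReal.ofReal (|p.1| ^ (((k + 1 - c : ℕ) : ℤ) - (n + 1 : ℕ))) *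
        (ENNReal.ofReal (|p.2| ^ (((k + c : ℕ) : ℤ) - n)) * (if p.1 < p.2 then 1 else 0))) := by
    intro k
    refine Measurable.const_mul (Measurable.mul ?_ (Measurable.mul ?_ hm1)) _ <;> fun_prop
  rw [lintegral_congr_ae e1]
  have e2 : ∀ x, ∫⁻ r, ∑ k ∈ Finset.range (n + 1), (n.descFactorial (n - k) : ENNReal) ^ m *
        (ENNReal.ofReal (|x| ^ (((k + 1 - c : ℕ) : ℤ) - (n + 1 : ℕ))) *
          (ENNReal.ofReal (|r| ^ (((k + c : ℕ) : ℤ) - n)) * (if x < r then 1 else 0)))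
        ∂mpow (chi n) m = ∑ k ∈ Finset.range (n + 1), (n.descFactorial (n - k) : ENNReal) ^ m *
        ∫⁻ r, (ENNReal.ofReal (|x| ^ (((k + 1 - c : ℕ) : ℤ) - (n + 1 : ℕ))) *
          (ENNReal.ofReal (|r| ^ (((k + c : ℕ) : ℤ) - n)) * (if x < r then 1 else 0)))
        ∂mpow (chi n) m := by
    intro x
    have hx : ∀ k, Measurable fun r : ℝ => (n.descFactorial (n - k) : ENNReal) ^ m *
        (ENNReal.ofReal (|x| ^ (((k + 1 - c : ℕ) : ℤ) - (n + 1 : ℕ))) *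
          (ENNReal.ofReal (|r| ^ (((k + c : ℕ) : ℤ) - n)) * (if x < r then 1 else 0))) :=
      fun k => (hm2 k).comp measurable_prodMk_left
    rw [lintegral_finsetSum _ fun k _ => hx k]
    refine Finset.sum_congr rfl fun k _ => ?_
    rw [lintegral_const_mul' _ _ (by finiteness)]
  simp_rw [e2]
  rw [lintegral_finsetSum]
  · refine Finset.sum_congr rfl fun k hk => ?_
    have hk : k ≤ n := Nat.lt_succ_iff.1 (Finset.mem_range.1 hk)
    rw [lintegral_const_mul' _ _ (by finiteness), lintegral_zpow_mul_zpow, ← mul_assoc,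
      ← mul_pow, ← mul_pow]
    convert one_mul _
    convert one_pow _
    rw [← chiMass_ratio_mul hk]
    interval_cases c
    · simp only [add_zero, Nat.sub_zero]; ring
    · simp only [Nat.add_sub_cancel, ENNReal.div_eq_inv_mul]; ring
  · intro k _
    have h := (hm2 k).lintegral_prod_right' (ν := mpow (chi n) m)
    simp_rw [lintegral_const_mul' _ _ (show (n.descFactorial (n - k) : ENNReal) ^ m ≠ ⊤ by
      finiteness)] at h
    exact h

/-- The expected number of real eigenvalues of a product of Ginibre matrices. -/
lemma lintegral_card_roots_add_sum (m : ℕ) :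
    ∫⁻ Z : Matrix (Unit ⊕ Unit ⊕ κ) (Unit ⊕ Unit ⊕ κ) ℝ, (Z.charpoly.roots.card : ENNReal)
        ∂mpow (gin (Unit ⊕ Unit ⊕ κ) (Unit ⊕ Unit ⊕ κ)) (m + 1) +
      ∑ k ∈ Finset.range (Fintype.card κ + 1), chiProb (m + 1) k (k + 1) =
      1 + ∑ k ∈ Finset.range (Fintype.card κ + 1), chiProb (m + 1) (k + 1) k := by
  have h0 := lintegral_detKernel_eq_sum (Fintype.card κ) (m + 1) 0 zero_le_one
  have h1 := lintegral_detKernel_eq_sum (Fintype.card κ) (m + 1) 1 le_rfl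
  simp only [pow_zero, one_mul, pow_one, add_zero, Nat.sub_zero, Nat.add_sub_cancel] at h0 h1
  have hc : Fintype.card (Unit ⊕ κ) = Fintype.card κ + 1 := by
    rw [Fintype.card_sum, Fintype.card_unit, add_comm]
  have hk : Measurable fun p : ℝ × ℝ => detKernel (Fintype.card κ) (m + 1) (p.1⁻¹ * p.2⁻¹) := by
    unfold detKernel
    fun_prop
  have hm : Measurable fun p : ℝ × ℝ => (if p.1 < p.2 then
      ENNReal.ofReal (detKernel (Fintype.card κ) (m + 1) (p.1⁻¹ * p.2⁻¹)) else 0) :=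
    Measurable.ite (measurableSet_lt measurable_fst measurable_snd)
      (ENNReal.measurable_ofReal.comp hk) measurable_const
  rw [lintegral_card_roots_eq, hc, ← h0, ← h1, ← lintegral_add_right _ hm.lintegral_prod_right']
  have e1 : ∫⁻ _, 1 ∂mpow (chi (Fintype.card κ + 1)) (m + 1) = 1 := by simp
  conv_rhs => rw [← e1, ← lintegral_add_left measurable_const]
  refine lintegral_congr_ae ?_
  filter_upwards [ae_mpow_chi_pos (Fintype.card κ + 1) (m + 1)] with x hx
  have hmx : Measurable fun r : ℝ => (if x < r then
      ENNReal.ofReal (detKernel (Fintype.card κ) (m + 1) (x⁻¹ * r⁻¹)) else 0) :=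
    hm.comp measurable_prodMk_left
  rw [lintegral_abs_det_one_sub m hx, add_assoc, ← lintegral_add_right _ hmx]
  congr 1
  refine lintegral_congr fun r => ?_
  split_ifs with h
  · have h1 : 0 ≤ r / x - 1 := by rw [sub_nonneg, le_div_iff₀ hx, one_mul]; exact h.le
    have hr := hx.trans h
    have h2 := detKernel_nonneg (Fintype.card κ) (m + 1) (u := x⁻¹ * r⁻¹) (by positivity)
    rw [← ENNReal.ofReal_add (mul_nonneg h1 h2) h2]
    congr 1
    ring
  · simp

end ExpectedCount

section Ensemble
set_option linter.unusedSectionVars false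

lemma mpow_map_eq {X M : Type*} [MeasurableSpace X] [Monoid M] [MeasurableSpace M]
    [MeasurableMul₂ M] (ν : Measure X) [IsProbabilityMeasure ν] {φ : X → M} (hφ : Measurable φ)
    (m : ℕ) : Measurable (fun ω : Fin m → X => (List.ofFn fun i => φ (ω i)).prod) ∧
      mpow (ν.map φ) m =
        (Measure.pi fun _ : Fin m => ν).map fun ω => (List.ofFn fun i => φ (ω i)).prod := by
  have hp : IsProbabilityMeasure (ν.map φ) := Measure.isProbabilityMeasure_map hφ.aemeasurable
  induction m with
  | zero =>
    refine ⟨by simp, ?_⟩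
    simp [mpow]
  | succ m ih =>
    have hm : Measurable fun p : X × (Fin m → X) =>
        φ p.1 * (List.ofFn fun i => φ (p.2 i)).prod :=
      (hφ.comp measurable_fst).mul (ih.1.comp measurable_snd)
    have e : (fun ω : Fin (m + 1) → X => (List.ofFn fun i => φ (ω i)).prod) =
        (fun p : X × (Fin m → X) => φ p.1 * (List.ofFn fun i => φ (p.2 i)).prod) ∘
          MeasurableEquiv.piFinSuccAbove (fun _ => X) 0 := by
      funext ω
      simp [List.ofFn_succ, MeasurableEquiv.piFinSuccAbove, Fin.insertNthEquiv, Fin.tail]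
    refine ⟨by rw [e]; exact hm.comp (MeasurableEquiv.measurable _), ?_⟩
    rw [e, ← Measure.map_map hm (MeasurableEquiv.measurable _),
      (measurePreserving_piFinSuccAbove (fun _ => ν) 0).map_eq, mpow, ih.2, Measure.mconv,
      Measure.map_prod_map _ _ hφ ih.1, Measure.map_map measurable_mul (by
        exact (hφ.comp measurable_fst).prodMk (ih.1.comp measurable_snd))]
    rfl

lemma card_roots_charpoly_smul {ι : Type*} [Fintype ι] [DecidableEq ι] (A : Matrix ι ι ℝ) {c : ℝ}
    (hc : c ≠ 0) : (c • A).charpoly.roots.card = A.charpoly.roots.card := by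
  have h1 : (c • A).charpoly.comp (Polynomial.C c * Polynomial.X + Polynomial.C 0) =
      Polynomial.C (c ^ Fintype.card ι) * A.charpoly := by
    refine Polynomial.funext fun t => ?_
    simp only [Polynomial.eval_comp, Polynomial.eval_add, Polynomial.eval_mul, Polynomial.eval_C,
      Polynomial.eval_X, add_zero, Matrix.eval_charpoly]
    rw [← Matrix.det_smul]
    congr 1
    ext i j
    by_cases h : i = j <;> simp [h, mul_sub]
  have h2 := (c • A).charpoly.map_roots_comp_C_mul_X_add_C c 0 (isUnit_iff_ne_zero.2 hc)
  rw [h1, Polynomial.roots_C_mul _ (pow_ne_zero _ hc)] at h2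
  rw [← h2, Multiset.card_map]

variable {ι : Type*} [Fintype ι] [DecidableEq ι]

/-- Rescaling and reindexing of the entries of a matrix. -/
noncomputable def rescale {N : ℕ} (e : ι ≃ Fin N) (f : Fin N → Fin N → ℝ) : Matrix ι ι ℝ :=
  Matrix.of fun i j => Real.sqrt N * f (e i) (e j)

lemma measurable_rescale {N : ℕ} (e : ι ≃ Fin N) : Measurable (rescale e) :=
  measurable_matrix_iff.2 fun i j => by
    simp only [rescale, Matrix.of_apply]
    fun_prop

lemma map_rescale {N : ℕ} (hN : N ≠ 0) (e : ι ≃ Fin N) :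
    (Measure.pi fun _ : Fin N => Measure.pi fun _ : Fin N => gaussianReal 0 (1 / N)).map
      (rescale e) = gin ι ι := by
  refine matMeasure_eq_of_map _ fun s hs => ?_
  have hms : MeasurableSet {Z : Matrix ι ι ℝ | ∀ i j, Z i j ∈ s (i, j)} := by
    simp only [Set.ofPred_forall]
    exact MeasurableSet.iInter fun i => MeasurableSet.iInter fun j =>
      measurable_matrix_apply i j (hs _)
  have hg : (gaussianReal 0 (1 / N)).map (Real.sqrt N * ·) = gaussianReal 0 1 := by
    rw [gaussianReal_map_const_mul, mul_zero]
    congr 1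
    ext
    have : (N : ℝ) ≠ 0 := by exact_mod_cast hN
    simp [this]
  rw [Measure.map_apply (measurable_rescale e) hms]
  have hset : rescale e ⁻¹' {Z : Matrix ι ι ℝ | ∀ i j, Z i j ∈ s (i, j)} =
      Set.univ.pi fun a => Set.univ.pi fun b =>
        (Real.sqrt N * ·) ⁻¹' s (e.symm a, e.symm b) := by
    ext f
    simp only [Set.mem_preimage, Set.mem_ofPred_eq, Set.mem_pi, Set.mem_univ, true_imp_iff, rescale,
      Matrix.of_apply]
    constructor
    · intro h a b
      simpa using h (e.symm a) (e.symm b)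
    · intro h i j
      simpa using h (e i) (e j)
  rw [hset, Measure.pi_pi]
  simp_rw [Measure.pi_pi]
  rw [← e.prod_comp]
  refine Finset.prod_congr rfl fun i _ => ?_
  rw [← e.prod_comp]
  refine Finset.prod_congr rfl fun j _ => ?_
  rw [← hg, Measure.map_apply (measurable_const_mul _) (hs _)]
  simp

lemma prod_rescale {N m : ℕ} (e : ι ≃ Fin N) (ω : Fin m → Fin N → Fin N → ℝ) :
    (List.ofFn fun i => rescale e (ω i)).prod =
      Real.sqrt N ^ m • (Matrix.reindex e.symm e.symm (prodMatrix N m ω)) := by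
  unfold prodMatrix
  induction m with
  | zero => simp
  | succ m ih =>
    simp only [List.ofFn_succ, List.prod_cons]
    rw [ih, pow_succ']
    have : rescale e (ω 0) = Real.sqrt N • Matrix.reindex e.symm e.symm (Matrix.of (ω 0)) := by
      ext i j; simp [rescale]
    rw [this, Matrix.smul_mul, Matrix.mul_smul, smul_smul]
    simp only [Matrix.reindex_apply, Matrix.submatrix_mul_equiv]

lemma aemeasurable_card_roots {κ : Type*} [Fintype κ] [DecidableEq κ] (m : ℕ) :
    AEMeasurable (fun Z : Matrix (Unit ⊕ κ) (Unit ⊕ κ) ℝ => (Z.charpoly.roots.card : ENNReal))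
      (mpow (gin (Unit ⊕ κ) (Unit ⊕ κ)) (m + 1)) := by
  refine ⟨eigSum (κ := κ) fun _ => 1, measurable_eigSum measurable_const, ?_⟩
  filter_upwards [ae_isGeneric (κ := κ) m] with Z hZ
  have h := hZ.eigSum_eq fun _ _ => 1
  rw [h, Finset.sum_const, nsmul_one, Multiset.toFinset_card_of_nodup hZ.nodup_roots]

lemma EN_eq_toReal_lintegral {κ : Type*} [Fintype κ] [DecidableEq κ] {N : ℕ}
    (e : Unit ⊕ κ ≃ Fin N) (m : ℕ) :
    EN N (m + 1) = (∫⁻ Z : Matrix (Unit ⊕ κ) (Unit ⊕ κ) ℝ, (Z.charpoly.roots.card : ENNReal)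
      ∂mpow (gin (Unit ⊕ κ) (Unit ⊕ κ)) (m + 1)).toReal := by
  have hN : N ≠ 0 := by
    rintro rfl
    exact (e (Sum.inl ())).elim0
  have hs : Real.sqrt N ^ (m + 1) ≠ 0 := by positivity
  have hcard := aemeasurable_card_roots (κ := κ) m
  obtain ⟨h1, h2⟩ := mpow_map_eq (Measure.pi fun _ : Fin N => Measure.pi fun _ : Fin N =>
    gaussianReal 0 (1 / N)) (measurable_rescale e) (m + 1)
  rw [map_rescale hN] at h2
  have hpt : ∀ ω : Fin (m + 1) → Fin N → Fin N → ℝ,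
      (numRealEigs N (prodMatrix N (m + 1) ω) : ENNReal) =
        (((List.ofFn fun i => rescale e (ω i)).prod).charpoly.roots.card : ENNReal) := by
    intro ω
    rw [prod_rescale, card_roots_charpoly_smul _ hs, Matrix.charpoly_reindex, numRealEigs]
  rw [h2] at hcard ⊢
  rw [lintegral_map' hcard h1.aemeasurable]
  have hae := hcard.comp_measurable h1
  have hae' : AEMeasurable (fun ω => (numRealEigs N (prodMatrix N (m + 1) ω) : ENNReal))
      (ensembleMeasure N (m + 1)) := by
    simp_rw [hpt]
    exact hae
  have hR : (fun ω => (numRealEigs N (prodMatrix N (m + 1) ω) : ℝ)) = fun ω =>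
      ((numRealEigs N (prodMatrix N (m + 1) ω) : ENNReal)).toReal := by
    funext ω; simp
  rw [EN, hR, integral_toReal hae' (ae_of_all _ fun ω => by simp)]
  simp_rw [hpt]
  rfl

/-- The probability that an independent product of `m` chi variables with parameter `k + 1`
exceeds one with parameter `k`, minus the probability of the reverse. -/
noncomputable def chiGap (m k : ℕ) : ℝ :=
  (chiProb m (k + 1) k).toReal - (chiProb m k (k + 1)).toReal

lemma chiProb_le_one (m a b : ℕ) : chiProb m a b ≤ 1 := by
  have h : ∀ x : ℝ, ∫⁻ r, (if x < r then 1 else 0 : ENNReal) ∂mpow (chi a) m ≤ 1 := by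
    intro x
    calc _ ≤ ∫⁻ _, 1 ∂mpow (chi a) m := lintegral_mono fun r => by split_ifs <;> simp
      _ = 1 := by simp
  calc chiProb m a b ≤ ∫⁻ _, 1 ∂mpow (chi b) m := lintegral_mono h
    _ = 1 := by simp

lemma abs_chiGap_le (m k : ℕ) : |chiGap m k| ≤ 1 := by
  have h1 := ENNReal.toReal_mono ENNReal.one_ne_top (chiProb_le_one m (k + 1) k)
  have h2 := ENNReal.toReal_mono ENNReal.one_ne_top (chiProb_le_one m k (k + 1))
  have h3 := (chiProb m (k + 1) k).toReal_nonneg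
  have h4 := (chiProb m k (k + 1)).toReal_nonneg
  rw [ENNReal.toReal_one] at h1 h2
  rw [chiGap, abs_le]
  constructor <;> linarith

/-- The expected number of real eigenvalues as a sum of gap probabilities. -/
lemma EN_eq_one_add_sum (n m : ℕ) :
    EN (n + 2) (m + 1) = 1 + ∑ k ∈ Finset.range (n + 1), chiGap (m + 1) k := by
  have hc : Fintype.card (Unit ⊕ Unit ⊕ Fin n) = n + 2 := by simp; omega
  rw [EN_eq_toReal_lintegral (Fintype.equivFinOfCardEq hc) m]
  have h := lintegral_card_roots_add_sum (κ := Fin n) m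
  rw [Fintype.card_fin] at h
  have hne : ∀ a b, chiProb (m + 1) a b ≠ ⊤ := fun a b =>
    ((chiProb_le_one _ _ _).trans_lt ENNReal.one_lt_top).ne
  have hs1 : ∑ k ∈ Finset.range (n + 1), chiProb (m + 1) k (k + 1) ≠ ⊤ :=
    ENNReal.sum_ne_top.2 fun k _ => hne _ _
  have hs2 : ∑ k ∈ Finset.range (n + 1), chiProb (m + 1) (k + 1) k ≠ ⊤ :=
    ENNReal.sum_ne_top.2 fun k _ => hne _ _
  have hE : ∫⁻ Z : Matrix (Unit ⊕ Unit ⊕ Fin n) (Unit ⊕ Unit ⊕ Fin n) ℝ,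
      (Z.charpoly.roots.card : ENNReal) ∂mpow (gin _ _) (m + 1) ≠ ⊤ := by
    intro hE
    rw [hE, top_add] at h
    exact ENNReal.add_ne_top.2 ⟨ENNReal.one_ne_top, hs2⟩ h.symm
  have h' := congrArg ENNReal.toReal h
  rw [ENNReal.toReal_add hE hs1, ENNReal.toReal_add ENNReal.one_ne_top hs2,
    ENNReal.toReal_sum fun k _ => hne _ _, ENNReal.toReal_sum fun k _ => hne _ _,
    ENNReal.toReal_one] at h'
  simp only [chiGap, Finset.sum_sub_distrib]
  linarith

end Ensemble

section ChiRatio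

lemma chiMass_toReal_pos (s : ℕ) : 0 < (chiMass s).toReal :=
  ENNReal.toReal_pos (chiMass_ne s).1 (chiMass_ne s).2

lemma chiMass_toReal_add_two (s : ℕ) :
    (chiMass (s + 2)).toReal = (s + 1) * (chiMass s).toReal := by
  rw [chiMass_add_two, ENNReal.toReal_mul, ENNReal.toReal_natCast]
  push_cast
  rfl

lemma hasIntegral_chi_zpow (s s' : ℕ) :
    Integrable (fun r : ℝ => |r| ^ ((s' : ℤ) - s)) (chi s) ∧
      ∫ r, |r| ^ ((s' : ℤ) - s) ∂chi s = (chiMass s').toReal / (chiMass s).toReal := by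
  have h := lintegral_chi_zpow s s' (f := fun _ => 1) measurable_const
  simp only [mul_one, lintegral_const, measure_univ] at h
  have hm : Measurable fun r : ℝ => |r| ^ ((s' : ℤ) - s) := by fun_prop
  have hn : ∀ᵐ r ∂chi s, 0 ≤ |r| ^ ((s' : ℤ) - s) := ae_of_all _ fun r => by positivity
  refine ⟨⟨hm.aestronglyMeasurable, ?_⟩, ?_⟩
  · rw [hasFiniteIntegral_iff_ofReal hn, h]
    exact ENNReal.div_lt_top (chiMass_ne _).2 (chiMass_ne _).1
  · rw [integral_eq_lintegral_of_nonneg_ae hn hm.aestronglyMeasurable, h, ENNReal.toReal_div]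

lemma hasIntegral_chi_sq (s : ℕ) :
    Integrable (fun r : ℝ => r ^ 2) (chi s) ∧ ∫ r, r ^ 2 ∂chi s = s + 1 := by
  have h := hasIntegral_chi_zpow s (s + 2)
  have e : ((s + 2 : ℕ) : ℤ) - s = (2 : ℕ) := by push_cast; ring
  simp only [e, zpow_natCast, sq_abs] at h
  rw [chiMass_toReal_add_two, mul_div_cancel_right₀ _ (chiMass_toReal_pos s).ne'] at h
  exact h

lemma hasIntegral_chi_pow_four (s : ℕ) :
    Integrable (fun r : ℝ => r ^ 4) (chi s) ∧ ∫ r, r ^ 4 ∂chi s = (s + 1) * (s + 3) := by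
  have h := hasIntegral_chi_zpow s (s + 2 + 2)
  have e : ((s + 2 + 2 : ℕ) : ℤ) - s = (4 : ℕ) := by push_cast; ring
  have e' : ∀ r : ℝ, |r| ^ 4 = r ^ 4 := fun r => Even.pow_abs (by decide) r
  simp only [e, zpow_natCast, e'] at h
  rw [chiMass_toReal_add_two, chiMass_toReal_add_two, ← mul_assoc,
    mul_div_cancel_right₀ _ (chiMass_toReal_pos s).ne'] at h
  refine ⟨h.1, h.2.trans ?_⟩
  push_cast
  ring

lemma hasIntegral_chi_inv_sq (s : ℕ) :
    Integrable (fun r : ℝ => (r ^ 2)⁻¹) (chi (s + 2)) ∧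
      ∫ r, (r ^ 2)⁻¹ ∂chi (s + 2) = ((s : ℝ) + 1)⁻¹ := by
  have h := hasIntegral_chi_zpow (s + 2) s
  have e : (s : ℤ) - (s + 2 : ℕ) = -(2 : ℕ) := by push_cast; ring
  simp only [e, zpow_neg, zpow_natCast, sq_abs] at h
  refine ⟨h.1, h.2.trans ?_⟩
  rw [chiMass_toReal_add_two]
  have := chiMass_toReal_pos s
  field_simp

lemma hasIntegral_chi_inv_pow_four (s : ℕ) :
    Integrable (fun r : ℝ => (r ^ 4)⁻¹) (chi (s + 4)) ∧
      ∫ r, (r ^ 4)⁻¹ ∂chi (s + 4) = (((s : ℝ) + 1) * (s + 3))⁻¹ := by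
  have h := hasIntegral_chi_zpow (s + 4) s
  have e : (s : ℤ) - (s + 4 : ℕ) = -(4 : ℕ) := by push_cast; ring
  have e' : ∀ r : ℝ, |r| ^ 4 = r ^ 4 := fun r => Even.pow_abs (by decide) r
  simp only [e, zpow_neg, zpow_natCast, e'] at h
  refine ⟨h.1, h.2.trans ?_⟩
  rw [show s + 4 = s + 2 + 2 from rfl, chiMass_toReal_add_two, chiMass_toReal_add_two]
  have := chiMass_toReal_pos s
  push_cast
  field_simp
  ring

/-- The quantity `V + V⁻¹ - 2` for `V = r² / s²`. -/
noncomputable def ratioDefect (p : ℝ × ℝ) : ℝ :=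
  p.1 ^ 2 * (p.2 ^ 2)⁻¹ + (p.1 ^ 2)⁻¹ * p.2 ^ 2 - 2

lemma hasIntegral_ratio_sub (j : ℕ) :
    Integrable (fun p : ℝ × ℝ => p.1 ^ 2 * (p.2 ^ 2)⁻¹ - (p.1 ^ 2)⁻¹ * p.2 ^ 2)
      ((chi (j + 5)).prod (chi (j + 4))) ∧
    ∫ p, (p.1 ^ 2 * (p.2 ^ 2)⁻¹ - (p.1 ^ 2)⁻¹ * p.2 ^ 2) ∂(chi (j + 5)).prod (chi (j + 4)) =
      ((j : ℝ) + 6) / (j + 3) - (j + 5) / (j + 4) := by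
  have i1 := (hasIntegral_chi_sq (j + 5)).1.mul_prod (hasIntegral_chi_inv_sq (j + 2)).1
  have i2 := (hasIntegral_chi_inv_sq (j + 3)).1.mul_prod (hasIntegral_chi_sq (j + 4)).1
  refine ⟨i1.sub i2, ?_⟩
  rw [integral_sub i1 i2, integral_prod_mul (fun r : ℝ => r ^ 2) fun r : ℝ => (r ^ 2)⁻¹,
    integral_prod_mul (fun r : ℝ => (r ^ 2)⁻¹) fun r : ℝ => r ^ 2,
    (hasIntegral_chi_sq (j + 5)).2, (hasIntegral_chi_inv_sq (j + 2)).2,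
    (hasIntegral_chi_inv_sq (j + 3)).2, (hasIntegral_chi_sq (j + 4)).2]
  push_cast
  rw [div_eq_mul_inv, div_eq_mul_inv]
  ring_nf

lemma hasIntegral_ratioDefect (j : ℕ) :
    Integrable ratioDefect ((chi (j + 5)).prod (chi (j + 4))) ∧
    ∫ p, ratioDefect p ∂(chi (j + 5)).prod (chi (j + 4)) =
      ((j : ℝ) + 6) / (j + 3) + (j + 5) / (j + 4) - 2 := by
  have i1 := (hasIntegral_chi_sq (j + 5)).1.mul_prod (hasIntegral_chi_inv_sq (j + 2)).1
  have i2 := (hasIntegral_chi_inv_sq (j + 3)).1.mul_prod (hasIntegral_chi_sq (j + 4)).1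
  have i3 : Integrable (fun p : ℝ × ℝ => p.1 ^ 2 * (p.2 ^ 2)⁻¹ + (p.1 ^ 2)⁻¹ * p.2 ^ 2)
      ((chi (j + 5)).prod (chi (j + 4))) := i1.add i2
  refine ⟨i3.sub (integrable_const 2), ?_⟩
  unfold ratioDefect
  rw [integral_sub i3 (integrable_const 2), integral_add i1 i2,
    integral_prod_mul (fun r : ℝ => r ^ 2) fun r : ℝ => (r ^ 2)⁻¹,
    integral_prod_mul (fun r : ℝ => (r ^ 2)⁻¹) fun r : ℝ => r ^ 2,
    (hasIntegral_chi_sq (j + 5)).2, (hasIntegral_chi_inv_sq (j + 2)).2,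
    (hasIntegral_chi_inv_sq (j + 3)).2, (hasIntegral_chi_sq (j + 4)).2]
  simp only [integral_const, probReal_univ, one_smul]
  push_cast
  rw [div_eq_mul_inv, div_eq_mul_inv]
  ring_nf

lemma ae_pos_prod_chi (a b : ℕ) : ∀ᵐ p ∂(chi a).prod (chi b), 0 < p.1 ∧ 0 < p.2 := by
  have h1 : ∀ᵐ p ∂(chi a).prod (chi b), 0 < p.1 :=
    Measure.quasiMeasurePreserving_fst.ae (ae_chi_pos a)
  have h2 : ∀ᵐ p ∂(chi a).prod (chi b), 0 < p.2 :=
    Measure.quasiMeasurePreserving_snd.ae (ae_chi_pos b)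
  exact h1.and h2

lemma hasIntegral_ratioDefect_sq (j : ℕ) :
    Integrable (fun p => ratioDefect p ^ 2) ((chi (j + 5)).prod (chi (j + 4))) ∧
    ∫ p, ratioDefect p ^ 2 ∂(chi (j + 5)).prod (chi (j + 4)) =
      ((j : ℝ) + 6) * (j + 8) / ((j + 3) * (j + 1)) + (j + 5) * (j + 7) / ((j + 4) * (j + 2)) -
        2 - 4 * (((j : ℝ) + 6) / (j + 3) + (j + 5) / (j + 4) - 2) := by
  have i1 := (hasIntegral_chi_pow_four (j + 5)).1.mul_prod (hasIntegral_chi_inv_pow_four j).1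
  have i2 := (hasIntegral_chi_inv_pow_four (j + 1)).1.mul_prod (hasIntegral_chi_pow_four (j + 4)).1
  have i3 : Integrable (fun p : ℝ × ℝ => p.1 ^ 4 * (p.2 ^ 4)⁻¹ + (p.1 ^ 4)⁻¹ * p.2 ^ 4)
      ((chi (j + 5)).prod (chi (j + 4))) := i1.add i2
  have i4 : Integrable (fun p : ℝ × ℝ => p.1 ^ 4 * (p.2 ^ 4)⁻¹ + (p.1 ^ 4)⁻¹ * p.2 ^ 4 - 2)
      ((chi (j + 5)).prod (chi (j + 4))) := i3.sub (integrable_const 2)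
  have i5 := (hasIntegral_ratioDefect j).1.const_mul 4
  have e : (fun p => ratioDefect p ^ 2) =ᵐ[(chi (j + 5)).prod (chi (j + 4))]
      fun p => p.1 ^ 4 * (p.2 ^ 4)⁻¹ + (p.1 ^ 4)⁻¹ * p.2 ^ 4 - 2 - 4 * ratioDefect p := by
    filter_upwards [ae_pos_prod_chi (j + 5) (j + 4)] with p hp
    have h1 := hp.1.ne'
    have h2 := hp.2.ne'
    simp only [ratioDefect]
    field_simp
    ring
  refine ⟨(i4.sub i5).congr e.symm, ?_⟩
  rw [integral_congr_ae e, integral_sub i4 i5, integral_sub i3 (integrable_const _),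
    integral_add i1 i2, integral_const_mul, (hasIntegral_ratioDefect j).2,
    integral_prod_mul (fun r : ℝ => r ^ 4) fun r : ℝ => (r ^ 4)⁻¹,
    integral_prod_mul (fun r : ℝ => (r ^ 4)⁻¹) fun r : ℝ => r ^ 4,
    (hasIntegral_chi_pow_four (j + 5)).2, (hasIntegral_chi_inv_pow_four j).2,
    (hasIntegral_chi_inv_pow_four (j + 1)).2, (hasIntegral_chi_pow_four (j + 4)).2]
  simp only [integral_const, probReal_univ, one_smul]
  push_cast
  rw [div_eq_mul_inv, div_eq_mul_inv, div_eq_mul_inv, div_eq_mul_inv]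
  ring_nf

end ChiRatio

section SinhTaylor

lemma sinh_le_mul_cosh {x : ℝ} (hx : 0 ≤ x) : Real.sinh x ≤ x * Real.cosh x := by
  have h : MonotoneOn (fun x => x * Real.cosh x - Real.sinh x) (Set.Ici 0) := by
    refine monotoneOn_of_deriv_nonneg (convex_Ici 0) (by fun_prop) (by fun_prop) fun y hy => ?_
    rw [interior_Ici, Set.mem_Ioi] at hy
    have hd : HasDerivAt (fun x => x * Real.cosh x - Real.sinh x)
        (1 * Real.cosh y + y * Real.sinh y - Real.cosh y) y :=
      ((hasDerivAt_id y).mul (Real.hasDerivAt_cosh y)).sub (Real.hasDerivAt_sinh y)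
    rw [hd.deriv]
    have := Real.sinh_nonneg_iff.2 hy.le
    nlinarith
  have h0 := h Set.self_mem_Ici hx hx
  simp only [zero_mul, Real.sinh_zero, sub_zero] at h0
  linarith

lemma norm_cexp_mul_I_sub_le (θ : ℝ) :
    ‖Complex.exp (θ * Complex.I) - 1 - θ * Complex.I + θ ^ 2 / 2‖ ≤ 4 * |θ| ^ 3 := by
  rcases le_total |θ| 1 with h | h
  · have h1 : ‖(θ * Complex.I : ℂ)‖ ≤ 1 := by simpa using h
    have h2 := Complex.exp_bound h1 (n := 3) (by norm_num)
    have e : Complex.exp (θ * Complex.I) - 1 - θ * Complex.I + θ ^ 2 / 2 =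
        Complex.exp (θ * Complex.I) -
          ∑ m ∈ Finset.range 3, (θ * Complex.I : ℂ) ^ m / (m.factorial : ℂ) := by
      simp only [Finset.sum_range_succ, Finset.sum_range_zero, mul_pow, Complex.I_sq]
      simp [Nat.factorial]
      ring
    rw [e]
    refine h2.trans ?_
    have h3 : ‖(θ * Complex.I : ℂ)‖ = |θ| := by simp
    rw [h3]
    have := pow_nonneg (abs_nonneg θ) 3
    norm_num [Nat.factorial]
    linarith
  · have h1 : ‖Complex.exp (θ * Complex.I) - 1 - θ * Complex.I + θ ^ 2 / 2‖ ≤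
        1 + 1 + |θ| + |θ| ^ 2 / 2 := by
      refine (norm_add_le _ _).trans (add_le_add ((norm_sub_le _ _).trans
        (add_le_add ((norm_sub_le _ _).trans ?_) ?_)) ?_)
      · rw [Complex.norm_exp_ofReal_mul_I, norm_one]
      · simp
      · simp
    nlinarith [mul_self_nonneg (|θ| - 1), pow_le_pow_left₀ zero_le_one h 2,
      mul_nonneg (sub_nonneg.2 h) (sq_nonneg |θ|)]

lemma norm_cexp_sub_sinh_cosh_le_of_nonneg (t : ℝ) {y : ℝ} (hy : 0 ≤ y) :
    ‖Complex.exp ((t * y : ℝ) * Complex.I) - 1 - ((t * Real.sinh y : ℝ) : ℂ) * Complex.I +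
      ((t ^ 2 * (Real.cosh y - 1) : ℝ) : ℂ)‖ ≤
      (32 * |t| ^ 3 + 4 * |t| + 2 * t ^ 2) *
        (Real.sinh (y / 2) ^ 3 + Real.sinh (y / 2) ^ 4) := by
  set S := Real.sinh (y / 2) with hS
  have hw : 0 ≤ y / 2 := by positivity
  have hS0 : 0 ≤ S := Real.sinh_nonneg_iff.2 hw
  have hwS : y / 2 ≤ S := Real.self_le_sinh_iff.2 hw
  have hc : Real.cosh y - 1 = 2 * S ^ 2 := by
    have h := Real.cosh_two_mul (y / 2)
    have h2 := Real.cosh_sq (y / 2)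
    rw [mul_div_cancel₀ _ (two_ne_zero)] at h
    linarith
  have hcw : Real.cosh (y / 2) ≤ 1 + S ^ 2 / 2 := by
    refine (pow_le_pow_iff_left₀ (Real.cosh_pos _).le (by positivity) two_ne_zero).1 ?_
    rw [Real.cosh_sq (y / 2)]
    nlinarith [sq_nonneg (S ^ 2)]
  have hSw : S - y / 2 ≤ S ^ 3 / 2 := by
    have h1 := sinh_le_mul_cosh hw
    have h2 := mul_le_mul_of_nonneg_left hcw hw
    have h3 := mul_le_mul_of_nonneg_right hwS (sq_nonneg S)
    nlinarith
  have hsy : |Real.sinh y - y| ≤ 4 * S ^ 3 := by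
    have h1 := sinh_le_mul_cosh hy
    have h2 := Real.self_le_sinh_iff.2 hy
    rw [abs_of_nonneg (by linarith)]
    have h3 : y * (Real.cosh y - 1) ≤ (2 * S) * (2 * S ^ 2) := by
      rw [hc]
      exact mul_le_mul_of_nonneg_right (by linarith) (by positivity)
    nlinarith
  have hcy : |Real.cosh y - 1 - y ^ 2 / 2| ≤ 2 * S ^ 4 := by
    rw [hc, abs_of_nonneg (by nlinarith)]
    have h1 : (S - y / 2) * (S + y / 2) ≤ (S ^ 3 / 2) * (2 * S) :=
      mul_le_mul hSw (by linarith) (by linarith) (by positivity)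
    nlinarith
  have e : Complex.exp ((t * y : ℝ) * Complex.I) - 1 - ((t * Real.sinh y : ℝ) : ℂ) * Complex.I +
      ((t ^ 2 * (Real.cosh y - 1) : ℝ) : ℂ) =
      (Complex.exp ((t * y : ℝ) * Complex.I) - 1 - (t * y : ℝ) * Complex.I +
        ((t * y : ℝ) : ℂ) ^ 2 / 2) - ((t * (Real.sinh y - y) : ℝ) : ℂ) * Complex.I +
        ((t ^ 2 * (Real.cosh y - 1 - y ^ 2 / 2) : ℝ) : ℂ) := by
    push_cast
    ring
  rw [e]
  refine (norm_add_le _ _).trans ((add_le_add ((norm_sub_le _ _).trans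
    (add_le_add (norm_cexp_mul_I_sub_le _) le_rfl)) le_rfl).trans ?_)
  rw [norm_mul, Complex.norm_I, mul_one, Complex.norm_real, Complex.norm_real, Real.norm_eq_abs,
    Real.norm_eq_abs, abs_mul, abs_mul, abs_mul, abs_of_nonneg (sq_nonneg t), abs_of_nonneg hy,
    mul_pow]
  have h1 : y ^ 3 ≤ 8 * S ^ 3 := by
    have := pow_le_pow_left₀ hw hwS 3
    nlinarith
  have h2 := mul_le_mul_of_nonneg_left h1 (pow_nonneg (abs_nonneg t) 3)
  have h3 := mul_le_mul_of_nonneg_left hsy (abs_nonneg t)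
  have h4 := mul_le_mul_of_nonneg_left hcy (sq_nonneg t)
  have h5 : 0 ≤ S ^ 3 := by positivity
  have h6 : 0 ≤ S ^ 4 := by positivity
  have h7 := mul_nonneg (pow_nonneg (abs_nonneg t) 3) h6
  have h8 := mul_nonneg (abs_nonneg t) h6
  have h9 := mul_nonneg (sq_nonneg t) h5
  nlinarith

lemma norm_cexp_sub_sinh_cosh_le (t y : ℝ) :
    ‖Complex.exp ((t * y : ℝ) * Complex.I) - 1 - ((t * Real.sinh y : ℝ) : ℂ) * Complex.I +
      ((t ^ 2 * (Real.cosh y - 1) : ℝ) : ℂ)‖ ≤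
      (32 * |t| ^ 3 + 4 * |t| + 2 * t ^ 2) *
        (|Real.sinh (y / 2)| ^ 3 + |Real.sinh (y / 2)| ^ 4) := by
  rcases le_total 0 y with hy | hy
  · rw [abs_of_nonneg (Real.sinh_nonneg_iff.2 (by positivity : 0 ≤ y / 2))]
    exact norm_cexp_sub_sinh_cosh_le_of_nonneg t hy
  · have h := norm_cexp_sub_sinh_cosh_le_of_nonneg (-t) (y := -y) (by linarith)
    have hs : Real.sinh (y / 2) ≤ 0 := Real.sinh_nonpos_iff.2 (by linarith)
    rw [abs_of_nonpos hs, ← Real.sinh_neg, ← neg_div]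
    simpa only [neg_mul_neg, Real.sinh_neg, Real.cosh_neg, neg_sq, abs_neg] using h

/-- The Taylor remainder of the characteristic function of `log V`, for `V + V⁻¹ - 2` small. -/
lemma exists_norm_cexp_log_sub_le (t : ℝ) {η : ℝ} (hη : 0 < η) : ∃ C : ℝ, 0 ≤ C ∧
    ∀ V : ℝ, 0 < V → ‖Complex.exp ((t * Real.log V : ℝ) * Complex.I) - 1 -
      ((t * ((V - V⁻¹) / 2) : ℝ) : ℂ) * Complex.I +
        ((t ^ 2 * ((V + V⁻¹ - 2) / 2) : ℝ) : ℂ)‖ ≤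
      η * (V + V⁻¹ - 2) + C * (V + V⁻¹ - 2) ^ 2 := by
  set K := 32 * |t| ^ 3 + 4 * |t| + 2 * t ^ 2 with hK
  have hK0 : 0 ≤ K := by positivity
  refine ⟨(K ^ 2 / η + K) / 16, by positivity, fun V hV => ?_⟩
  have h := norm_cexp_sub_sinh_cosh_le t (Real.log V)
  rw [← hK] at h
  set S := |Real.sinh (Real.log V / 2)| with hS
  have hW : V + V⁻¹ - 2 = 4 * S ^ 2 := by
    have h1 := Real.cosh_two_mul (Real.log V / 2)
    have h2 := Real.cosh_sq (Real.log V / 2)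
    rw [mul_div_cancel₀ _ (two_ne_zero), Real.cosh_log hV] at h1
    rw [hS, sq_abs]
    linarith
  have hc : (V + V⁻¹ - 2) / 2 = Real.cosh (Real.log V) - 1 := by
    rw [Real.cosh_log hV]; ring
  have hs : (V - V⁻¹) / 2 = Real.sinh (Real.log V) := by
    rw [Real.sinh_log hV]
  rw [hc, hs, hW]
  refine h.trans ?_
  have hS0 : 0 ≤ S := abs_nonneg _
  have h3 : K * S ^ 3 ≤ 4 * η * S ^ 2 + K ^ 2 / η * S ^ 4 := by
    have e : 4 * η * S ^ 2 + K ^ 2 / η * S ^ 4 - K * S ^ 3 =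
        S ^ 2 / η * ((K * S - η / 2) ^ 2 + 15 / 4 * η ^ 2) := by
      field_simp
      ring
    have : 0 ≤ S ^ 2 / η * ((K * S - η / 2) ^ 2 + 15 / 4 * η ^ 2) := by positivity
    linarith
  nlinarith

end SinhTaylor

section ChiCharFun

/-- The characteristic function of the logarithm of `r² / s²`, for `r` and `s` independent and
chi-distributed with `k + 2` and `k + 1` degrees of freedom. -/
noncomputable def logRatioChar (k : ℕ) (t : ℝ) : ℂ :=
  ∫ p, Complex.exp ((t * Real.log (p.1 ^ 2 * (p.2 ^ 2)⁻¹) : ℝ) * Complex.I)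
    ∂(chi (k + 1)).prod (chi k)

lemma integrable_cexp_mul_I {Ω : Type*} [MeasurableSpace Ω] (μ : Measure Ω) [IsFiniteMeasure μ]
    {f : Ω → ℝ} (hf : Measurable f) :
    Integrable (fun ω => Complex.exp ((f ω : ℂ) * Complex.I)) μ := by
  refine (integrable_const (1 : ℝ)).mono' (by fun_prop) (ae_of_all _ fun ω => ?_)
  rw [Complex.norm_exp_ofReal_mul_I]

lemma norm_logRatioChar_sub_le (t : ℝ) {η C : ℝ}
    (hC : ∀ V : ℝ, 0 < V → ‖Complex.exp ((t * Real.log V : ℝ) * Complex.I) - 1 -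
      ((t * ((V - V⁻¹) / 2) : ℝ) : ℂ) * Complex.I +
        ((t ^ 2 * ((V + V⁻¹ - 2) / 2) : ℝ) : ℂ)‖ ≤
      η * (V + V⁻¹ - 2) + C * (V + V⁻¹ - 2) ^ 2) (j : ℕ) :
    ‖logRatioChar (j + 4) t - 1 -
      ((t * ((((j : ℝ) + 6) / (j + 3) - (j + 5) / (j + 4)) / 2) : ℝ) : ℂ) * Complex.I +
        ((t ^ 2 * ((((j : ℝ) + 6) / (j + 3) + (j + 5) / (j + 4) - 2) / 2) : ℝ) : ℂ)‖ ≤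
      η * (((j : ℝ) + 6) / (j + 3) + (j + 5) / (j + 4) - 2) +
        C * (((j : ℝ) + 6) * (j + 8) / ((j + 3) * (j + 1)) +
          (j + 5) * (j + 7) / ((j + 4) * (j + 2)) -
          2 - 4 * (((j : ℝ) + 6) / (j + 3) + (j + 5) / (j + 4) - 2)) := by
  have d := hasIntegral_ratio_sub j
  have w := hasIntegral_ratioDefect j
  have w2 := hasIntegral_ratioDefect_sq j
  have hm : Measurable fun p : ℝ × ℝ => t * Real.log (p.1 ^ 2 * (p.2 ^ 2)⁻¹) := by fun_prop
  have i0 := integrable_cexp_mul_I ((chi (j + 5)).prod (chi (j + 4))) hm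
  have i1 : Integrable (fun p : ℝ × ℝ =>
      Complex.exp ((t * Real.log (p.1 ^ 2 * (p.2 ^ 2)⁻¹) : ℝ) * Complex.I) - 1)
      ((chi (j + 5)).prod (chi (j + 4))) := i0.sub (integrable_const 1)
  have i2 : Integrable (fun p : ℝ × ℝ =>
      ((t * ((p.1 ^ 2 * (p.2 ^ 2)⁻¹ - (p.1 ^ 2)⁻¹ * p.2 ^ 2) / 2) : ℝ) : ℂ) * Complex.I)
      ((chi (j + 5)).prod (chi (j + 4))) :=
    ((d.1.div_const 2).const_mul t).ofReal.mul_const Complex.I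
  have i3 : Integrable (fun p : ℝ × ℝ => ((t ^ 2 * (ratioDefect p / 2) : ℝ) : ℂ))
      ((chi (j + 5)).prod (chi (j + 4))) := ((w.1.div_const 2).const_mul (t ^ 2)).ofReal
  have i4 := i1.sub i2
  have hInt := integral_add i4 i3
  rw [integral_sub' i1 i2, integral_sub i0 (integrable_const 1), integral_mul_const,
    integral_complex_ofReal, integral_complex_ofReal, integral_const_mul, integral_const_mul, integral_div,
    integral_div, d.2, w.2, integral_const, probReal_univ, one_smul] at hInt
  rw [logRatioChar, show j + 4 + 1 = j + 5 from rfl, ← w2.2, ← w.2]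
  rw [← w.2] at hInt
  rw [← hInt, ← integral_const_mul, ← integral_const_mul,
    ← integral_add (w.1.const_mul η) (w2.1.const_mul C)]
  refine norm_integral_le_of_norm_le ((w.1.const_mul η).add (w2.1.const_mul C)) ?_
  filter_upwards [ae_pos_prod_chi (j + 5) (j + 4)] with p hp
  have h := hC (p.1 ^ 2 * (p.2 ^ 2)⁻¹) (by have := hp.1; have := hp.2; positivity)
  have e : (p.1 ^ 2 * (p.2 ^ 2)⁻¹)⁻¹ = (p.1 ^ 2)⁻¹ * p.2 ^ 2 := by
    rw [mul_inv, inv_inv]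
  rw [e] at h
  exact h

lemma tendsto_mul_logRatioChar_sub_one (t : ℝ) :
    Tendsto (fun k : ℕ => (k : ℂ) * (logRatioChar k t - 1)) atTop
      (nhds (t * Complex.I - 2 * t ^ 2)) := by
  rw [← tendsto_add_atTop_iff_nat 4]
  have hj : ∀ c : ℝ, Tendsto (fun j : ℕ => ((j : ℝ) + c)⁻¹) atTop (nhds 0) := fun c =>
    tendsto_inv_atTop_zero.comp (tendsto_atTop_add_const_right _ _ tendsto_natCast_atTop_atTop)
  have ha : Tendsto (fun j : ℕ => (((j : ℝ) + 4) *
      (t * ((((j : ℝ) + 6) / (j + 3) - (j + 5) / (j + 4)) / 2)))) atTop (nhds t) := by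
    have h : Tendsto (fun j : ℕ => t * (1 + 3 / 2 * ((j : ℝ) + 3)⁻¹)) atTop
        (nhds (t * (1 + 3 / 2 * 0))) :=
      (((hj 3).const_mul _).const_add _).const_mul _
    rw [mul_zero, add_zero, mul_one] at h
    refine h.congr fun j => ?_
    field_simp
    ring
  have hb : Tendsto (fun j : ℕ => (((j : ℝ) + 4) *
      (t ^ 2 * ((((j : ℝ) + 6) / (j + 3) + (j + 5) / (j + 4) - 2) / 2)))) atTop
      (nhds (2 * t ^ 2)) := by
    have h : Tendsto (fun j : ℕ => t ^ 2 * (2 + 3 / 2 * ((j : ℝ) + 3)⁻¹)) atTop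
        (nhds (t ^ 2 * (2 + 3 / 2 * 0))) :=
      (((hj 3).const_mul _).const_add _).const_mul _
    rw [mul_zero, add_zero, mul_comm] at h
    refine h.congr fun j => ?_
    field_simp
    ring
  have hab := ((Complex.continuous_ofReal.tendsto _).comp ha).mul_const Complex.I |>.sub
    ((Complex.continuous_ofReal.tendsto _).comp hb)
  have hr : Tendsto (fun j : ℕ => ((j : ℂ) + 4) * (logRatioChar (j + 4) t - 1 -
      ((t * ((((j : ℝ) + 6) / (j + 3) - (j + 5) / (j + 4)) / 2) : ℝ) : ℂ) * Complex.I +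
        ((t ^ 2 * ((((j : ℝ) + 6) / (j + 3) + (j + 5) / (j + 4) - 2) / 2) : ℝ) : ℂ)))
      atTop (nhds 0) := by
    rw [Metric.tendsto_nhds]
    intro ε hε
    obtain ⟨C, hC0, hC⟩ := exists_norm_cexp_log_sub_le t (η := ε / 10) (by positivity)
    have h1 : Tendsto (fun j : ℕ => C * 300 * ((j : ℝ) + 4)⁻¹) atTop (nhds (C * 300 * 0)) :=
      (hj 4).const_mul _
    rw [mul_zero] at h1
    filter_upwards [h1.eventually_lt_const (half_pos hε)] with j hj
    have hn := norm_logRatioChar_sub_le t hC j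
    have e4 : ‖(j : ℂ) + 4‖ = j + 4 := by
      rw [show (j : ℂ) + 4 = ((j + 4 : ℕ) : ℂ) by push_cast; rfl, Complex.norm_natCast]
      push_cast
      rfl
    rw [dist_zero_right, norm_mul, e4]
    have hp : (0 : ℝ) < j + 4 := by positivity
    have hw : ((j : ℝ) + 6) / (j + 3) + (j + 5) / (j + 4) - 2 ≤ 5 * ((j : ℝ) + 4)⁻¹ := by
      have e : 5 * ((j : ℝ) + 4)⁻¹ - (((j : ℝ) + 6) / (j + 3) + (j + 5) / (j + 4) - 2) =
          j / ((j + 3) * (j + 4)) := by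
        field_simp
        ring
      have : (0 : ℝ) ≤ j / ((j + 3) * (j + 4)) := by positivity
      linarith
    have hw2 : ((j : ℝ) + 6) * (j + 8) / ((j + 3) * (j + 1)) +
          (j + 5) * (j + 7) / ((j + 4) * (j + 2)) -
          2 - 4 * (((j : ℝ) + 6) / (j + 3) + (j + 5) / (j + 4) - 2) ≤
          300 * ((j : ℝ) + 4)⁻¹ * ((j : ℝ) + 4)⁻¹ := by
      have e : 300 * ((j : ℝ) + 4)⁻¹ * ((j : ℝ) + 4)⁻¹ - (((j : ℝ) + 6) * (j + 8) /
          ((j + 3) * (j + 1)) + (j + 5) * (j + 7) / ((j + 4) * (j + 2)) -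
          2 - 4 * (((j : ℝ) + 6) / (j + 3) + (j + 5) / (j + 4) - 2)) =
          (252 * j ^ 3 + 1344 * j ^ 2 + 1923 * j + 516) /
            ((j + 1) * (j + 2) * (j + 3) * (j + 4) ^ 2) := by
        field_simp
        ring
      have : (0 : ℝ) ≤ (252 * j ^ 3 + 1344 * j ^ 2 + 1923 * j + 516) /
            ((j + 1) * (j + 2) * (j + 3) * (j + 4) ^ 2) := by positivity
      linarith
    calc _ ≤ ((j : ℝ) + 4) * (ε / 10 * (5 * ((j : ℝ) + 4)⁻¹) +
          C * (300 * ((j : ℝ) + 4)⁻¹ * ((j : ℝ) + 4)⁻¹)) := by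
          refine mul_le_mul_of_nonneg_left (hn.trans ?_) hp.le
          gcongr
      _ = ε / 2 + C * 300 * ((j : ℝ) + 4)⁻¹ := by
          field_simp
          ring
      _ < ε := by linarith
  have := hr.add hab
  rw [zero_add] at this
  push_cast at this ⊢
  refine this.congr fun j => ?_
  simp only [Function.comp_apply]
  push_cast
  ring

end ChiCharFun

section LogRatio

/-- The law of the logarithm of `x² / y²`, for `x` and `y` independent products of `m` chi
variables. -/
noncomputable def logRatio (m k : ℕ) : Measure ℝ :=
  ((mpow (chi (k + 1)) m).prod (mpow (chi k) m)).map fun p => Real.log (p.1 ^ 2 * (p.2 ^ 2)⁻¹)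

lemma measurable_log_ratio :
    Measurable fun p : ℝ × ℝ => Real.log (p.1 ^ 2 * (p.2 ^ 2)⁻¹) := by fun_prop

instance (m k : ℕ) : IsProbabilityMeasure (logRatio m k) :=
  Measure.isProbabilityMeasure_map measurable_log_ratio.aemeasurable

lemma ae_pos_prod_mpow_chi (m a b : ℕ) :
    ∀ᵐ p ∂(mpow (chi a) m).prod (mpow (chi b) m), 0 < p.1 ∧ 0 < p.2 := by
  have h1 : ∀ᵐ p ∂(mpow (chi a) m).prod (mpow (chi b) m), 0 < p.1 :=
    Measure.quasiMeasurePreserving_fst.ae (ae_mpow_chi_pos a m)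
  have h2 : ∀ᵐ p ∂(mpow (chi a) m).prod (mpow (chi b) m), 0 < p.2 :=
    Measure.quasiMeasurePreserving_snd.ae (ae_mpow_chi_pos b m)
  exact h1.and h2

lemma integral_cexp_log_mpow_chi (s m : ℕ) (u : ℝ) :
    ∫ x, Complex.exp ((u * Real.log (x ^ 2) : ℝ) * Complex.I) ∂mpow (chi s) m =
      (∫ x, Complex.exp ((u * Real.log (x ^ 2) : ℝ) * Complex.I) ∂chi s) ^ m := by
  have hm : Measurable fun x : ℝ => u * Real.log (x ^ 2) := by fun_prop
  induction m with
  | zero => simp [mpow]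
  | succ m ih =>
    rw [mpow, integral_mconv (integrable_cexp_mul_I _ hm), pow_succ', ← ih,
      ← integral_mul_const]
    refine integral_congr_ae ?_
    filter_upwards [ae_chi_pos s] with x hx
    rw [← integral_const_mul]
    refine integral_congr_ae ?_
    filter_upwards [ae_mpow_chi_pos s m] with y hy
    rw [← Complex.exp_add, mul_pow, Real.log_mul (by positivity) (by positivity)]
    push_cast
    ring_nf

lemma integral_cexp_log_ratio (m a b : ℕ) (t : ℝ) :
    ∫ p, Complex.exp ((t * Real.log (p.1 ^ 2 * (p.2 ^ 2)⁻¹) : ℝ) * Complex.I)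
      ∂(mpow (chi a) m).prod (mpow (chi b) m) =
    ((∫ x, Complex.exp ((t * Real.log (x ^ 2) : ℝ) * Complex.I) ∂chi a) *
      ∫ x, Complex.exp ((-t * Real.log (x ^ 2) : ℝ) * Complex.I) ∂chi b) ^ m := by
  rw [mul_pow, ← integral_cexp_log_mpow_chi, ← integral_cexp_log_mpow_chi, ← integral_prod_mul
    (fun x : ℝ => Complex.exp ((t * Real.log (x ^ 2) : ℝ) * Complex.I))
    fun x : ℝ => Complex.exp ((-t * Real.log (x ^ 2) : ℝ) * Complex.I)]
  refine integral_congr_ae ?_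
  filter_upwards [ae_pos_prod_mpow_chi m a b] with p hp
  have h1 := hp.1
  have h2 := hp.2
  rw [← Complex.exp_add, Real.log_mul (by positivity) (by positivity), Real.log_inv]
  push_cast
  ring_nf

lemma charFun_logRatio (m k : ℕ) (t : ℝ) : charFun (logRatio m k) t = logRatioChar k t ^ m := by
  have h1 := integral_cexp_log_ratio 1 (k + 1) k t
  have e : ∀ s, mpow (chi s) 1 = chi s := fun s => by
    simp [mpow]
  rw [e, e, pow_one] at h1
  rw [logRatioChar, h1, ← integral_cexp_log_ratio, charFun_apply_real, logRatio, integral_map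
    measurable_log_ratio.aemeasurable (by fun_prop)]
  push_cast
  rfl

lemma logRatio_Ioi (m k : ℕ) : logRatio m k (Set.Ioi 0) = chiProb m (k + 1) k := by
  have hm : Measurable fun p : ℝ × ℝ => (if p.2 < p.1 then 1 else 0 : ENNReal) :=
    Measurable.ite (measurableSet_lt measurable_snd measurable_fst) measurable_const
      measurable_const
  have h := lintegral_prod_symm' (μ := mpow (chi (k + 1)) m) (ν := mpow (chi k) m) _ hm
  rw [chiProb, ← h, logRatio, Measure.map_apply measurable_log_ratio measurableSet_Ioi,
    ← lintegral_indicator_one (measurable_log_ratio measurableSet_Ioi)]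
  refine lintegral_congr_ae ?_
  filter_upwards [ae_pos_prod_mpow_chi m (k + 1) k] with p hp
  have h1 := hp.1
  have h2 := hp.2
  have e : p ∈ (fun p : ℝ × ℝ => Real.log (p.1 ^ 2 * (p.2 ^ 2)⁻¹)) ⁻¹' Set.Ioi 0 ↔
      p.2 < p.1 := by
    rw [Set.mem_preimage, Set.mem_Ioi, Real.log_pos_iff (by positivity), ← div_eq_mul_inv, one_lt_div (by positivity),
      pow_lt_pow_iff_left₀ h2.le h1.le two_ne_zero]
  by_cases hlt : p.2 < p.1
  · rw [if_pos hlt, Set.indicator_of_mem (e.2 hlt), Pi.one_apply]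
  · rw [if_neg hlt, Set.indicator_of_notMem (mt e.1 hlt)]

lemma logRatio_Iio (m k : ℕ) : logRatio m k (Set.Iio 0) = chiProb m k (k + 1) := by
  have hm : Measurable fun p : ℝ × ℝ => (if p.1 < p.2 then 1 else 0 : ENNReal) :=
    Measurable.ite (measurableSet_lt measurable_fst measurable_snd) measurable_const
      measurable_const
  have h := lintegral_prod (μ := mpow (chi (k + 1)) m) (ν := mpow (chi k) m) _ hm.aemeasurable
  rw [chiProb, ← h, logRatio, Measure.map_apply measurable_log_ratio measurableSet_Iio,
    ← lintegral_indicator_one (measurable_log_ratio measurableSet_Iio)]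
  refine lintegral_congr_ae ?_
  filter_upwards [ae_pos_prod_mpow_chi m (k + 1) k] with p hp
  have h1 := hp.1
  have h2 := hp.2
  have e : p ∈ (fun p : ℝ × ℝ => Real.log (p.1 ^ 2 * (p.2 ^ 2)⁻¹)) ⁻¹' Set.Iio 0 ↔
      p.1 < p.2 := by
    rw [Set.mem_preimage, Set.mem_Iio, Real.log_neg_iff (by positivity), ← div_eq_mul_inv, div_lt_one (by positivity),
      pow_lt_pow_iff_left₀ h1.le h2.le two_ne_zero]
  by_cases hlt : p.1 < p.2
  · rw [if_pos hlt, Set.indicator_of_mem (e.2 hlt), Pi.one_apply]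
  · rw [if_neg hlt, Set.indicator_of_notMem (mt e.1 hlt)]

lemma chiGap_eq_logRatio (m k : ℕ) :
    chiGap m k = (logRatio m k (Set.Ioi 0)).toReal - (logRatio m k (Set.Iio 0)).toReal := by
  rw [logRatio_Ioi, logRatio_Iio, chiGap]

end LogRatio

section GaussianLimit

lemma tendsto_pow_exp_of_tendsto_mul {ι : Type*} {l : Filter ι} {z : ι → ℂ} {m : ι → ℕ} {c : ℂ}
    (hm : Tendsto m l atTop) (hz : Tendsto (fun i => (m i : ℂ) * (z i - 1)) l (nhds c)) :
    Tendsto (fun i => z i ^ m i) l (nhds (Complex.exp c)) := by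
  have hm' : Tendsto (fun i => ((m i : ℂ))⁻¹) l (nhds 0) :=
    (tendsto_inv_atTop_nhds_zero_nat (𝕜 := ℂ)).comp hm
  have h0 : Tendsto (fun i => z i - 1) l (nhds 0) := by
    have h := hm'.mul hz
    rw [zero_mul] at h
    refine h.congr' ?_
    filter_upwards [hm.eventually_ge_atTop 1] with i hi
    have : (m i : ℂ) ≠ 0 := Nat.cast_ne_zero.2 (by omega)
    field_simp
  have hlog : Tendsto (fun i => (m i : ℂ) * (Complex.log (1 + (z i - 1)) - (z i - 1))) l
      (nhds 0) := by
    have h2 : Tendsto (fun i => ‖(m i : ℂ) * (z i - 1)‖ * ‖z i - 1‖) l (nhds (‖c‖ * 0)) := by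
      have := hz.norm.mul h0.norm
      rwa [norm_zero] at this
    rw [mul_zero] at h2
    refine squeeze_zero_norm' ?_ h2
    have h3 : ∀ᶠ i in l, ‖z i - 1‖ < 1 / 2 := by
      have := h0.norm
      rw [norm_zero] at this
      exact this.eventually_lt_const (by norm_num)
    filter_upwards [h3] with i hi
    rw [norm_mul, norm_mul, mul_assoc]
    refine mul_le_mul_of_nonneg_left ?_ (norm_nonneg _)
    refine (Complex.norm_log_one_add_sub_self_le (by linarith)).trans ?_
    have h4 : (1 - ‖z i - 1‖)⁻¹ ≤ 2 := by
      rw [inv_le_comm₀ (by linarith) two_pos]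
      linarith
    nlinarith [mul_le_mul_of_nonneg_left h4 (sq_nonneg ‖z i - 1‖)]
  have h5 := hlog.add hz
  rw [zero_add] at h5
  refine ((Complex.continuous_exp.tendsto c).comp h5).congr' ?_
  have h6 : ∀ᶠ i in l, z i ≠ 0 := by
    have h7 : Tendsto z l (nhds 1) := by simpa using h0.add_const 1
    exact h7.eventually_ne one_ne_zero
  filter_upwards [h6] with i hi
  simp only [Function.comp_apply]
  rw [← mul_add, sub_add_cancel, add_sub_cancel, Complex.exp_nat_mul, Complex.exp_log hi]

lemma tendsto_chiGap_gaussian {β : ℝ} (hβ : 0 < β) {m k : ℕ → ℕ} (hk : Tendsto k atTop atTop)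
    (hmk : Tendsto (fun j => (m j : ℝ) / k j) atTop (nhds β)) :
    Tendsto (fun j => chiGap (m j) (k j)) atTop
      (nhds ((gaussianReal β (4 * β.toNNReal) (Set.Ioi 0)).toReal -
        (gaussianReal β (4 * β.toNNReal) (Set.Iio 0)).toReal)) := by
  have hv : 4 * β.toNNReal ≠ 0 := mul_ne_zero (by norm_num) (Real.toNNReal_pos.2 hβ).ne'
  have := nullSingletonClass_gaussianReal (μ := β) hv
  have hm : Tendsto m atTop atTop := by
    have h := (tendsto_natCast_atTop_atTop (R := ℝ)).comp hk |>.atTop_mul_pos hβ hmk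
    refine tendsto_natCast_atTop_iff (R := ℝ) |>.1 (h.congr' ?_)
    filter_upwards [hk.eventually_ge_atTop 1] with j hj
    have : (k j : ℝ) ≠ 0 := Nat.cast_ne_zero.2 (by omega)
    simp only [Function.comp_apply]
    field_simp
  let P : ℕ → ProbabilityMeasure ℝ := fun j => ⟨logRatio (m j) (k j), inferInstance⟩
  let Q : ProbabilityMeasure ℝ := ⟨gaussianReal β (4 * β.toNNReal), inferInstance⟩
  have hPQ : Tendsto P atTop (nhds Q) := by
    refine ProbabilityMeasure.tendsto_of_tendsto_charFun fun t => ?_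
    change Tendsto (fun j => charFun (logRatio (m j) (k j)) t) atTop
      (nhds (charFun (gaussianReal β (4 * β.toNNReal)) t))
    simp_rw [charFun_logRatio]
    rw [charFun_gaussianReal]
    refine tendsto_pow_exp_of_tendsto_mul hm ?_
    have h1 := (tendsto_mul_logRatioChar_sub_one t).comp hk
    have h2 := ((Complex.continuous_ofReal.tendsto β).comp hmk).mul h1
    have e : (β : ℂ) * (t * Complex.I - 2 * t ^ 2) =
        t * β * Complex.I - ((4 * β.toNNReal : NNReal) : ℝ) * t ^ 2 / 2 := by
      push_cast
      rw [Real.coe_toNNReal _ hβ.le]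
      ring
    rw [e] at h2
    refine h2.congr' ?_
    filter_upwards [hk.eventually_ge_atTop 1] with j hj
    have : (k j : ℂ) ≠ 0 := Nat.cast_ne_zero.2 (by omega)
    simp only [Function.comp_apply]
    push_cast
    field_simp
  simp_rw [chiGap_eq_logRatio]
  have h1 := ProbabilityMeasure.tendsto_measure_of_null_frontier_of_tendsto' hPQ
    (E := Set.Ioi 0) (by rw [frontier_Ioi]; exact measure_singleton (μ := gaussianReal _ _) _)
  have h2 := ProbabilityMeasure.tendsto_measure_of_null_frontier_of_tendsto' hPQ
    (E := Set.Iio 0) (by rw [frontier_Iio]; exact measure_singleton (μ := gaussianReal _ _) _)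
  exact ((ENNReal.tendsto_toReal (measure_ne_top _ _)).comp h1).sub
    ((ENNReal.tendsto_toReal (measure_ne_top _ _)).comp h2)

end GaussianLimit

section GaussianErf

lemma gaussianReal_Iio_eq_Ioi (β : ℝ) (v : NNReal) :
    gaussianReal β v (Set.Iio 0) = gaussianReal β v (Set.Ioi (2 * β)) := by
  have h := gaussianReal_map_const_sub (μ := β) (v := v) (2 * β)
  rw [show 2 * β - β = β by ring] at h
  conv_rhs => rw [← h, Measure.map_apply (by fun_prop) measurableSet_Ioi]
  congr 1
  ext x
  simp

lemma gaussianReal_Ioi_sub_Iio {β : ℝ} (hβ : 0 < β) :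
    (gaussianReal β (4 * β.toNNReal) (Set.Ioi 0)).toReal -
      (gaussianReal β (4 * β.toNNReal) (Set.Iio 0)).toReal = erf (Real.sqrt (β / 8)) := by
  have hv : 4 * β.toNNReal ≠ 0 := mul_ne_zero (by norm_num) (Real.toNNReal_pos.2 hβ).ne'
  have hvr : ((4 * β.toNNReal : NNReal) : ℝ) = 4 * β := by
    push_cast
    rw [Real.coe_toNNReal _ hβ.le]
  have hu : Set.Ioi (0 : ℝ) = Set.Ioc 0 (2 * β) ∪ Set.Ioi (2 * β) :=
    (Set.Ioc_union_Ioi_eq_Ioi (by positivity)).symm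
  have hd : Disjoint (Set.Ioc (0 : ℝ) (2 * β)) (Set.Ioi (2 * β)) :=
    Set.disjoint_left.2 fun x hx hx' => not_lt.2 hx.2 hx'
  rw [gaussianReal_Iio_eq_Ioi, hu, measure_union hd measurableSet_Ioi,
    ENNReal.toReal_add (measure_ne_top _ _) (measure_ne_top _ _), add_sub_cancel_right,
    gaussianReal_apply_eq_integral _ hv, ENNReal.toReal_ofReal
      (integral_nonneg fun _ => gaussianPDFReal_nonneg _ _ _),
    ← intervalIntegral.integral_of_le (by positivity)]
  set c := Real.sqrt (8 * β) with hc
  have hc0 : 0 < c := Real.sqrt_pos.2 (by positivity)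
  have hc2 : c ^ 2 = 8 * β := Real.sq_sqrt (by positivity)
  have ha : Real.sqrt (β / 8) = β / c := by
    rw [Real.sqrt_eq_iff_mul_self_eq (by positivity) (by positivity)]
    field_simp
    rw [hc2]
    ring
  have hpdf : ∀ x : ℝ, gaussianPDFReal β (4 * β.toNNReal) x =
      (fun s => (Real.sqrt Real.pi)⁻¹ * c⁻¹ * Real.exp (-s ^ 2)) (x / c - β / c) := by
    intro x
    simp only [gaussianPDFReal, hvr]
    rw [show 2 * Real.pi * (4 * β) = Real.pi * (8 * β) by ring,
      Real.sqrt_mul Real.pi_pos.le, ← hc, mul_inv]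
    congr 2
    rw [← sub_div, div_pow, hc2]
    ring
  simp_rw [hpdf]
  rw [intervalIntegral.integral_comp_div_sub
    (fun s => (Real.sqrt Real.pi)⁻¹ * c⁻¹ * Real.exp (-s ^ 2)) hc0.ne', intervalIntegral.integral_const_mul, erf,
    ha, show 0 / c - β / c = -(β / c) by ring, show 2 * β / c - β / c = β / c by ring]
  have hi : ∀ a b : ℝ, IntervalIntegrable (fun s : ℝ => Real.exp (-s ^ 2)) volume a b :=
    fun a b => Continuous.intervalIntegrable (by fun_prop) _ _
  have hn := intervalIntegral.integral_comp_neg (a := 0) (b := β / c)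
    (fun s : ℝ => Real.exp (-s ^ 2))
  simp only [neg_sq, neg_zero] at hn
  rw [← intervalIntegral.integral_add_adjacent_intervals (hi _ 0) (hi 0 _), ← hn, smul_eq_mul]
  field_simp
  ring

lemma tendsto_chiGap {β : ℝ} (hβ : 0 < β) {m k : ℕ → ℕ} (hk : Tendsto k atTop atTop)
    (hmk : Tendsto (fun j => (m j : ℝ) / k j) atTop (nhds β)) :
    Tendsto (fun j => chiGap (m j) (k j)) atTop (nhds (erf (Real.sqrt (β / 8)))) := by
  rw [← gaussianReal_Ioi_sub_Iio hβ]
  exact tendsto_chiGap_gaussian hβ hk hmk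

end GaussianErf

section RiemannSum

lemma measurable_floor_comp (f : ℕ → ℝ) (N : ℝ) : Measurable fun t : ℝ => f ⌊t * N⌋₊ :=
  (measurable_from_nat (f := f)).comp (Nat.measurable_floor.comp (measurable_mul_const N))

lemma sum_div_eq_integral_floor {f : ℕ → ℝ} (hf : ∀ k, |f k| ≤ 1) {N : ℕ} (hN : 0 < N) :
    (∑ k ∈ Finset.range N, f k) / N = ∫ t in (0 : ℝ)..1, f ⌊t * N⌋₊ := by
  have hN' : (0 : ℝ) < N := Nat.cast_pos.2 hN
  have hi : ∀ a b : ℝ, IntervalIntegrable (fun t : ℝ => f ⌊t * N⌋₊) volume a b := fun a b =>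
    (intervalIntegrable_const (c := (1 : ℝ))).mono_fun'
      (measurable_floor_comp f N).aestronglyMeasurable (ae_of_all _ fun t => hf _)
  have h := intervalIntegral.sum_integral_adjacent_intervals (μ := volume)
    (f := fun t : ℝ => f ⌊t * N⌋₊) (a := fun k : ℕ => (k : ℝ) / N) (n := N) fun k _ => hi _ _
  rw [div_self hN'.ne', Nat.cast_zero, zero_div] at h
  rw [← h, Finset.sum_div]
  refine Finset.sum_congr rfl fun k _ => ?_
  have hle : (k : ℝ) / N ≤ ((k + 1 : ℕ) : ℝ) / N := by
    push_cast
    gcongr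
    linarith
  rw [intervalIntegral.integral_congr_Ioo_of_le (g := fun _ => f k) hle]
  · rw [intervalIntegral.integral_const, smul_eq_mul]
    push_cast
    field_simp
    ring
  · intro t ht
    have h1 : (k : ℝ) < t * N := (div_lt_iff₀ hN').1 ht.1
    have h2 : t * N < (k : ℝ) + 1 := by
      have := (lt_div_iff₀ hN').1 ht.2
      push_cast at this
      exact this
    have : ⌊t * N⌋₊ = k := (Nat.floor_eq_iff (by linarith [Nat.cast_nonneg (α := ℝ) k])).2
      ⟨h1.le, h2⟩
    simp only [this]

end RiemannSum

lemma tendsto_sum_chiGap {α : ℝ} (hα : 0 < α) {m : ℕ → ℕ}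
    (hlim : Tendsto (fun n : ℕ => (m n : ℝ) / (2 * n : ℕ)) atTop (nhds α)) :
    Tendsto (fun n : ℕ => (∑ k ∈ Finset.range (2 * n), chiGap (m n) k) / (2 * n : ℕ)) atTop
      (nhds (cFun α)) := by
  have hN : Tendsto (fun n : ℕ => 2 * n) atTop atTop :=
    tendsto_id.const_mul_atTop' two_pos
  have hNr : Tendsto (fun n : ℕ => ((2 * n : ℕ) : ℝ)) atTop atTop :=
    tendsto_natCast_atTop_atTop.comp hN
  have h : Tendsto (fun n : ℕ => ∫ t in (0 : ℝ)..1, chiGap (m n) ⌊t * (2 * n : ℕ)⌋₊) atTop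
      (nhds (cFun α)) := by
    refine intervalIntegral.tendsto_integral_filter_of_dominated_convergence (fun _ => 1)
      (Eventually.of_forall fun n => (measurable_floor_comp _ _).aestronglyMeasurable)
      (Eventually.of_forall fun n => ae_of_all _ fun t _ => abs_chiGap_le _ _)
      intervalIntegrable_const (ae_of_all _ fun t ht => ?_)
    rw [Set.uIoc_of_le zero_le_one] at ht
    have ht0 : 0 < t := ht.1
    have h1 : Tendsto (fun n : ℕ => (⌊t * (2 * n : ℕ)⌋₊ : ℝ) / (2 * n : ℕ)) atTop (nhds t) :=
      (tendsto_nat_floor_mul_div_atTop ht0.le).comp hNr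
    have h2 : Tendsto (fun n : ℕ => ⌊t * (2 * n : ℕ)⌋₊) atTop atTop :=
      tendsto_nat_floor_atTop.comp (hNr.const_mul_atTop ht0)
    have h3 := hlim.div h1 ht0.ne'
    rw [show α / (8 * t) = α / t / 8 by rw [div_div, mul_comm]]
    refine tendsto_chiGap (div_pos hα ht0) h2 (h3.congr' ?_)
    filter_upwards [eventually_ge_atTop 1] with n hn
    have : ((2 * n : ℕ) : ℝ) ≠ 0 := Nat.cast_ne_zero.2 (by omega)
    exact div_div_div_cancel_right₀ this _ _
  refine h.congr' ?_
  filter_upwards [eventually_ge_atTop 1] with n hn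
  exact (sum_div_eq_integral_floor (abs_chiGap_le (m n)) (by omega)).symm

/-- In the critical regime `m = αN`, the expected number of real
eigenvalues of the product of `m` independent `N × N` real Gaussian matrices
satisfies `E_N(m_N)/N → c(α)` as the (even) matrix size `N = 2n → ∞`. -/
theorem expected_real_eigenvalues_critical (α : ℝ) (hα : 0 < α)
    (m : ℕ → ℕ) (hm : ∀ n, 0 < m n)
    (hlim : Tendsto (fun n : ℕ => (m n : ℝ) / (2 * n : ℕ)) atTop (nhds α)) :
    Tendsto (fun n : ℕ => EN (2 * n) (m n) / (2 * n : ℕ)) atTop (nhds (cFun α)) := by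
  have hN : Tendsto (fun n : ℕ => 2 * n) atTop atTop :=
    tendsto_id.const_mul_atTop' two_pos
  have hr : Tendsto (fun n : ℕ => (1 - chiGap (m n) (2 * n - 1)) / (2 * n : ℕ)) atTop
      (nhds 0) := by
    refine squeeze_zero_norm (a := fun n : ℕ => 2 / ((2 * n : ℕ) : ℝ)) (fun n => ?_)
      ((tendsto_const_div_atTop_nhds_zero_nat (2 : ℝ)).comp hN)
    rw [norm_div, Real.norm_natCast, Real.norm_eq_abs]
    have h := abs_le.1 (abs_chiGap_le (m n) (2 * n - 1))
    gcongr
    exact abs_le.2 ⟨by linarith, by linarith⟩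
  have h := (tendsto_sum_chiGap hα hlim).add hr
  rw [add_zero] at h
  refine h.congr' ?_
  filter_upwards [eventually_ge_atTop 1] with n hn
  obtain ⟨p, rfl⟩ : ∃ p, n = p + 1 := ⟨n - 1, by omega⟩
  obtain ⟨q, hq⟩ : ∃ q, m (p + 1) = q + 1 := ⟨m (p + 1) - 1, by have := hm (p + 1); omega⟩
  rw [hq, ← add_div, show 2 * (p + 1) = 2 * p + 2 from rfl, EN_eq_one_add_sum,
    Finset.sum_range_succ _ (2 * p + 1), show 2 * p + 2 - 1 = 2 * p + 1 from rfl]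
  congr 1
  ring
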